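/- arXiv:2401.03982 — 2 statements merged into one kernel-verified Lean document; each statement's English description precedes it below -/
import Mathlib

section
/- There exist an absolute constant c and an absolute constant κ such that for every integer d > 1, every irreducible polynomial f ∈ ℚ[x₁,x₂] of degree d defining the affine plane curve C ⊆ 𝔸²_ℚ, and every real H > 2, one has #C(ℤ,H) ≤ c·d²·H^{1/d}·(log H)^κ. -/
open MvPolynomial

/-- The exponents of total degree less than `n` in two variables. -/
noncomputable def degBox (n : ℕ) : Finset (Fin 2 →₀ ℕ) :=
  (Finsupp.finite_of_degree_lt n).toFinset

theorem mem_degBox {n : ℕ} {m : Fin 2 →₀ ℕ} : m ∈ degBox n ↔ m.degree < n := by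
  simp [degBox]

theorem card_filter_degree_eq (n t : ℕ) (h : t < n) :
    ((degBox n).filter (fun m => m.degree = t)).card = t + 1 := by
  have : (degBox n).filter (fun m => m.degree = t) = Finset.finsuppAntidiag Finset.univ t := by
    ext m
    simp only [Finset.mem_filter, mem_degBox, Finset.mem_finsuppAntidiag, Finsupp.degree_eq_sum,
      Finset.subset_univ, and_true]
    exact and_iff_right_of_imp fun h' => h'.trans_lt h
  rw [this, Finset.card_finsuppAntidiag_nat_eq_choose]
  simp [add_comm]

theorem two_mul_card_degBox (n : ℕ) : 2 * (degBox n).card = n * (n + 1) := by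
  have h : (degBox n).card = ∑ t ∈ Finset.range n, (t + 1) := by
    rw [Finset.card_eq_sum_card_fiberwise (f := fun m => m.degree) (t := Finset.range n)]
    · refine Finset.sum_congr rfl fun t ht => ?_
      exact card_filter_degree_eq n t (Finset.mem_range.1 ht)
    · intro m hm
      simpa [mem_degBox] using hm
  rw [h]
  clear h
  induction n with
  | zero => simp
  | succ n ih => rw [Finset.sum_range_succ, mul_add, ih]; ring

/-- Substituting `r * X i` for each variable `X i`. -/
noncomputable def scaleVars {σ R : Type*} [CommRing R] (r : R) :
    MvPolynomial σ R →ₐ[R] MvPolynomial σ R :=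
  aeval fun i => C r * X i

theorem coeff_scaleVars {σ R : Type*} [CommRing R] (r : R) (F : MvPolynomial σ R)
    (m : σ →₀ ℕ) : coeff m (scaleVars r F) = r ^ m.degree * coeff m F := by
  classical
  induction F using MvPolynomial.induction_on' with
  | monomial u a =>
    have : scaleVars r (monomial u a) = monomial u (r ^ u.degree * a) := by
      rw [scaleVars, aeval_monomial, Finsupp.prod]
      simp_rw [mul_pow]
      rw [Finset.prod_mul_distrib, Finset.prod_pow_eq_pow_sum, ← C_pow, monomial_eq,
        Finsupp.prod, Finsupp.degree_apply, algebraMap_eq, C_mul]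
      ring
    rw [this, coeff_monomial, coeff_monomial]
    split_ifs with h
    · rw [h]
    · simp
  | add p q hp hq => simp [hp, hq, mul_add]

theorem Prime.pow_sub_dvd_of_pow_dvd_mul {M : Type*} [CommMonoidWithZero M] [IsCancelMulZero M]
    {p a b : M} (hp : Prime p) {ν k : ℕ} (ha : ¬ p ^ (ν + 1) ∣ a) (hab : p ^ k ∣ a * b) :
    p ^ (k - ν) ∣ b := by
  rw [pow_dvd_iff_le_emultiplicity, emultiplicity_mul hp] at hab
  rw [← emultiplicity_lt_iff_not_dvd] at ha
  rw [pow_dvd_iff_le_emultiplicity]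
  generalize emultiplicity p a = x at *
  generalize emultiplicity p b = y at *
  cases y with
  | top => simp
  | coe y =>
    cases x with
    | top => simp at ha
    | coe x =>
      norm_cast at *
      omega

theorem dvd_coeff_of_dvd_coeff_mul {σ : Type*} {p : ℕ} (hp : p.Prime) {F q : MvPolynomial σ ℤ}
    {ν k : ℕ} (hF : ∃ m, ¬ (p : ℤ) ^ (ν + 1) ∣ (p : ℤ) ^ m.degree * coeff m F)
    (h : ∀ m, (p : ℤ) ^ k ∣ (p : ℤ) ^ m.degree * coeff m (F * q)) (m : σ →₀ ℕ) :
    (p : ℤ) ^ (k - ν) ∣ (p : ℤ) ^ m.degree * coeff m q := by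
  have hpr : Prime (C (p : ℤ) : MvPolynomial σ ℤ) :=
    (prime_C_iff σ).2 (Nat.prime_iff_prime_int.1 hp)
  have h1 : ¬ (C (p : ℤ) : MvPolynomial σ ℤ) ^ (ν + 1) ∣ scaleVars (p : ℤ) F := by
    rw [← C_pow, C_dvd_iff_dvd_coeff]
    push Not
    simpa [coeff_scaleVars] using hF
  have h2 : (C (p : ℤ) : MvPolynomial σ ℤ) ^ k ∣ scaleVars (p : ℤ) F * scaleVars (p : ℤ) q := by
    rw [← map_mul, ← C_pow, C_dvd_iff_dvd_coeff]
    intro m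
    rw [coeff_scaleVars]
    exact h m
  have h3 := hpr.pow_sub_dvd_of_pow_dvd_mul h1 h2
  rw [← C_pow, C_dvd_iff_dvd_coeff] at h3
  simpa [coeff_scaleVars] using h3 m

theorem pow_dvd_eval_of_dvd_coeff {σ : Type*} {p : ℤ} {k : ℕ} {u : MvPolynomial σ ℤ}
    (hu : ∀ m, p ^ k ∣ p ^ m.degree * coeff m u) {x : σ → ℤ} (hx : ∀ i, p ∣ x i) :
    p ^ k ∣ eval x u := by
  rw [eval_eq]
  refine Finset.dvd_sum fun m _ => (hu m).trans ?_
  rw [mul_comm]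
  refine mul_dvd_mul_left _ ?_
  rw [Finsupp.degree_apply, ← Finset.prod_pow_eq_pow_sum]
  exact Finset.prod_dvd_prod_of_dvd _ _ fun i _ => pow_dvd_pow_of_dvd (hx i) _

/-- A polynomial with prescribed coefficients on a finite set of exponents. -/
noncomputable def ofCoeffs {σ R : Type*} [CommRing R] (N : Finset (σ →₀ ℕ)) (c : N → R) :
    MvPolynomial σ R :=
  ∑ m : N, monomial m.1 (c m)

theorem coeff_ofCoeffs_of_mem {σ R : Type*} [CommRing R] (N : Finset (σ →₀ ℕ)) (c : N → R)
    (m : N) : coeff m.1 (ofCoeffs N c) = c m := by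
  classical
  rw [ofCoeffs, coeff_sum, Finset.sum_eq_single m]
  · simp
  · intro b _ hb
    rw [coeff_monomial, if_neg]
    exact fun h => hb (Subtype.ext h)
  · simp

theorem coeff_ofCoeffs_of_notMem {σ R : Type*} [CommRing R] (N : Finset (σ →₀ ℕ)) (c : N → R)
    {m : σ →₀ ℕ} (hm : m ∉ N) : coeff m (ofCoeffs N c) = 0 := by
  classical
  rw [ofCoeffs, coeff_sum, Finset.sum_eq_zero]
  intro b _
  rw [coeff_monomial, if_neg]
  rintro rfl
  exact hm b.2

theorem support_ofCoeffs_subset {σ R : Type*} [CommRing R] (N : Finset (σ →₀ ℕ)) (c : N → R) :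
    (ofCoeffs N c).support ⊆ N := by
  intro m hm
  by_contra h
  exact (mem_support_iff.1 hm) (coeff_ofCoeffs_of_notMem N c h)

theorem ofCoeffs_sub {σ R : Type*} [CommRing R] (N : Finset (σ →₀ ℕ)) (c c' : N → R) :
    ofCoeffs N (fun m => c m - c' m) = ofCoeffs N c - ofCoeffs N c' := by
  simp [ofCoeffs, Finset.sum_sub_distrib]

/-- Pigeonhole principle in `ℤ[x, y] / ((p, x, y) ^ k + (F))`: if `F` has order at most `ν` at
`(p, x, y)`, any sufficiently large box of polynomials contains two whose difference is divisible
by `p ^ k` at the zeros of `F` reducing to the origin modulo `p`. -/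
theorem exists_pow_dvd_eval {p : ℕ} (hp : p.Prime) (F : MvPolynomial (Fin 2) ℤ) {ν : ℕ} (k : ℕ)
    (hF : ∃ m, ¬ (p : ℤ) ^ (ν + 1) ∣ (p : ℤ) ^ m.degree * coeff m F)
    (N : Finset (Fin 2 →₀ ℕ)) (w : (Fin 2 →₀ ℕ) → ℕ)
    (hcard : p ^ (ν * (degBox k).card) < ∏ m ∈ N, w m) :
    ∃ h : MvPolynomial (Fin 2) ℤ, h ≠ 0 ∧ h.support ⊆ N ∧ (∀ m ∈ N, |coeff m h| < w m) ∧
      ∀ x : Fin 2 → ℤ, (∀ i, (p : ℤ) ∣ x i) → eval x F = 0 → (p : ℤ) ^ k ∣ eval x h := by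
  classical
  have hne : ∀ j : ℕ, NeZero (p ^ j) := fun j => ⟨pow_ne_zero _ hp.ne_zero⟩
  let G : (∀ m : N, Fin (w m)) → MvPolynomial (Fin 2) ℤ := fun c => ofCoeffs N fun m => (c m : ℕ)
  let Q : (∀ m : degBox k, Fin (p ^ (k - ν - m.1.degree))) → MvPolynomial (Fin 2) ℤ :=
    fun c => ofCoeffs (degBox k) fun m => (c m : ℕ)
  let Φ : (∀ m : N, Fin (w m)) × (∀ m : degBox k, Fin (p ^ (k - ν - m.1.degree))) →
      ∀ m : degBox k, ZMod (p ^ (k - m.1.degree)) :=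
    fun c m => ((coeff m.1 (G c.1 + F * Q c.2) : ℤ) : ZMod (p ^ (k - m.1.degree)))
  have hlt : Fintype.card (∀ m : degBox k, ZMod (p ^ (k - m.1.degree))) <
      Fintype.card ((∀ m : N, Fin (w m)) ×
        (∀ m : degBox k, Fin (p ^ (k - ν - m.1.degree)))) := by
    simp only [Fintype.card_prod, Fintype.card_pi, ZMod.card, Fintype.card_fin]
    rw [Finset.prod_coe_sort N (fun m => w m),
      Finset.prod_coe_sort (degBox k) (fun m => p ^ (k - ν - m.degree)),
      Finset.prod_coe_sort (degBox k) (fun m => p ^ (k - m.degree)),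
      Finset.prod_pow_eq_pow_sum, Finset.prod_pow_eq_pow_sum]
    calc p ^ ∑ m ∈ degBox k, (k - m.degree)
        ≤ p ^ (∑ m ∈ degBox k, (ν + (k - ν - m.degree))) := by
          refine Nat.pow_le_pow_right hp.pos (Finset.sum_le_sum fun m _ => by omega)
      _ = p ^ (ν * (degBox k).card) * p ^ (∑ m ∈ degBox k, (k - ν - m.degree)) := by
          rw [Finset.sum_add_distrib, pow_add, Finset.sum_const, smul_eq_mul, mul_comm ν]
      _ < _ := by
          exact Nat.mul_lt_mul_of_pos_right hcard (pow_pos hp.pos _)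
  obtain ⟨⟨g₁, q₁⟩, ⟨g₂, q₂⟩, hneq, heq⟩ := Fintype.exists_ne_map_eq_of_card_lt Φ hlt
  set h := G g₁ - G g₂ with h_def
  set q := Q q₁ - Q q₂ with q_def
  have hcoef : ∀ m, (p : ℤ) ^ k ∣ (p : ℤ) ^ m.degree * coeff m (h + F * q) := by
    intro m
    by_cases hm : m.degree < k
    · have h1 := congrFun heq ⟨m, mem_degBox.2 hm⟩
      simp only [Φ] at h1
      rw [ZMod.intCast_eq_intCast_iff_dvd_sub] at h1
      have h2 : coeff m (h + F * q) =
          -(coeff m (G g₂ + F * Q q₂) - coeff m (G g₁ + F * Q q₁)) := by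
        rw [← coeff_sub, ← coeff_neg]
        congr 1
        rw [h_def, q_def]
        ring
      have hk : (p : ℤ) ^ k = (p : ℤ) ^ m.degree * (p : ℤ) ^ (k - m.degree) := by
        rw [← pow_add, Nat.add_sub_cancel' hm.le]
      rw [h2, hk]
      refine mul_dvd_mul_left _ ((dvd_neg).2 ?_)
      exact_mod_cast h1
    · exact (pow_dvd_pow _ (not_lt.1 hm)).mul_right _
  refine ⟨h, ?_, ?_, ?_, ?_⟩
  · intro h0
    have hq := dvd_coeff_of_dvd_coeff_mul (q := q) (k := k) hp hF (by simpa [h0] using hcoef)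
    refine hneq (Prod.ext ?_ ?_)
    · funext m
      have h1 : coeff m.1 h = 0 := by rw [h0, coeff_zero]
      rw [h_def, coeff_sub, coeff_ofCoeffs_of_mem, coeff_ofCoeffs_of_mem] at h1
      exact Fin.ext (by simp only; omega)
    · funext m
      have h1 := hq m.1
      rw [q_def, coeff_sub, coeff_ofCoeffs_of_mem, coeff_ofCoeffs_of_mem] at h1
      have b1 := (q₁ m).2
      have b2 := (q₂ m).2
      have h2 : (p : ℤ) ^ (k - ν - m.1.degree) ∣ ((q₁ m : ℕ) : ℤ) - ((q₂ m : ℕ) : ℤ) := by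
        by_cases hm : m.1.degree < k - ν
        · have hk : (p : ℤ) ^ (k - ν) =
              (p : ℤ) ^ m.1.degree * (p : ℤ) ^ (k - ν - m.1.degree) := by
            rw [← pow_add, Nat.add_sub_cancel' hm.le]
          rw [hk] at h1
          exact (mul_dvd_mul_iff_left
            (pow_ne_zero _ (by exact_mod_cast hp.ne_zero))).1 h1
        · have hk : (p : ℤ) ^ (k - ν - m.1.degree) = 1 := by
            rw [Nat.sub_eq_zero_of_le (not_lt.1 hm), pow_zero]
          exact hk.dvd.trans (one_dvd _)
      have h3 : ((q₁ m : ℕ) : ℤ) - ((q₂ m : ℕ) : ℤ) = 0 := by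
        refine Int.eq_zero_of_abs_lt_dvd h2 ?_
        zify at b1 b2
        rw [abs_lt]
        constructor <;> linarith [Int.natCast_nonneg (q₁ m : ℕ), Int.natCast_nonneg (q₂ m : ℕ)]
      exact Fin.ext (by simp only; omega)
  · rw [h_def]
    change (ofCoeffs N _ - ofCoeffs N _).support ⊆ N
    rw [← ofCoeffs_sub]
    exact support_ofCoeffs_subset _ _
  · intro m hm
    have e1 := coeff_ofCoeffs_of_mem N (fun m => ((g₁ m : ℕ) : ℤ)) ⟨m, hm⟩
    have e2 := coeff_ofCoeffs_of_mem N (fun m => ((g₂ m : ℕ) : ℤ)) ⟨m, hm⟩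
    rw [h_def, coeff_sub]
    simp only [G]
    rw [e1, e2]
    have b1 : (g₁ ⟨m, hm⟩ : ℕ) < w m := (g₁ ⟨m, hm⟩).2
    have b2 : (g₂ ⟨m, hm⟩ : ℕ) < w m := (g₂ ⟨m, hm⟩).2
    rw [abs_lt]
    constructor <;> omega
  · intro x hx hFx
    have := pow_dvd_eval_of_dvd_coeff hcoef hx
    simpa [hFx] using this

theorem finrank_restrictTotalDegree (K : Type*) [Field K] (n : ℕ) :
    Module.finrank K (restrictTotalDegree (Fin 2) K n) = (degBox (n + 1)).card := by
  have e : {m : Fin 2 →₀ ℕ | m.sum (fun _ e => e) ≤ n} = ↑(degBox (n + 1)) := by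
    ext m
    simp [mem_degBox, Finsupp.sum, Finsupp.degree_apply]
  unfold restrictTotalDegree
  rw [Module.finrank_eq_nat_card_basis (basisRestrictSupport K _), Nat.card_coe_set_eq, e,
    Set.ncard_coe_finset]

theorem exists_totalDegree_le_eval_ne {σ K : Type*} [Field K] (Z : Finset (σ → K)) (z : σ → K)
    (hz : z ∉ Z) :
    ∃ g : MvPolynomial σ K, g.totalDegree ≤ Z.card ∧ (∀ y ∈ Z, eval y g = 0) ∧
      eval z g ≠ 0 := by
  classical
  have h : ∀ y ∈ Z, ∃ i, z i ≠ y i := fun y hy => by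
    by_contra! h
    exact hz ((funext h : z = y) ▸ hy)
  choose i hi using h
  refine ⟨∏ y : Z, (X (i y.1 y.2) - C (y.1 (i y.1 y.2))), ?_, fun y hy => ?_, ?_⟩
  · refine (totalDegree_finsetProd _ _).trans ?_
    calc _ ≤ ∑ y : Z, 1 := Finset.sum_le_sum fun y _ => by
            refine (totalDegree_sub _ _).trans ?_
            simp
      _ = _ := by simp
  · rw [map_prod]
    exact Finset.prod_eq_zero (Finset.mem_univ ⟨y, hy⟩) (by simp)
  · rw [map_prod]
    refine Finset.prod_ne_zero_iff.2 fun y hy => ?_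
    simpa [sub_eq_zero] using hi y.1 y.2

theorem exists_totalDegree_le_eval_eq {σ K : Type*} [Field K] (Z : Finset (σ → K))
    (c : (σ → K) → K) :
    ∃ g : MvPolynomial σ K, g.totalDegree ≤ Z.card ∧ ∀ y ∈ Z, eval y g = c y := by
  classical
  choose! g hg using fun z (hz : z ∈ Z) =>
    exists_totalDegree_le_eval_ne (Z.erase z) z (Finset.notMem_erase z Z)
  refine ⟨∑ z ∈ Z, C (c z / eval z (g z)) * g z, ?_, fun y hy => ?_⟩
  · refine (totalDegree_finsetSum _ _).trans (Finset.sup_le fun z hz => ?_)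
    refine (totalDegree_mul _ _).trans ?_
    rw [totalDegree_C, zero_add]
    exact (hg z hz).1.trans (Finset.card_le_card (Finset.erase_subset _ _))
  · rw [map_sum, Finset.sum_eq_single y]
    · simp [div_mul_cancel₀ _ (hg y hy).2.2]
    · intro z hz hne
      rw [map_mul, (hg z hz).2.1 y (Finset.mem_erase.2 ⟨hne.symm, hy⟩), mul_zero]
    · exact fun h => (h hy).elim

/-- A weak form of Bézout's theorem for affine plane curves. -/
theorem card_le_mul_of_not_dvd {K : Type*} [Field K] {f g : MvPolynomial (Fin 2) K}
    (hf : Irreducible f) (hfg : ¬ f ∣ g) {d e : ℕ} (hd : f.totalDegree = d)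
    (he : g.totalDegree ≤ e) (Z : Finset (Fin 2 → K))
    (hZ : ∀ z ∈ Z, eval z f = 0 ∧ eval z g = 0) : Z.card ≤ d * e := by
  classical
  set s := Z.card with hs
  let V := restrictTotalDegree (Fin 2) K
  have hV : ∀ n, 2 * Module.finrank K (V n) = (n + 1) * (n + 2) := fun n => by
    rw [finrank_restrictTotalDegree, two_mul_card_degBox]
  have mV : ∀ {n p}, p ∈ V n ↔ p.totalDegree ≤ n := mem_restrictTotalDegree _ _ _
  let ev : V (d + e + s) →ₗ[K] (Z → K) :=
    (LinearMap.pi fun z : Z => (aeval (R := K) z.1).toLinearMap).domRestrict _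
  have evs : Function.Surjective ev := by
    intro c
    obtain ⟨g, hg, hgc⟩ := exists_totalDegree_le_eval_eq Z
      (fun z => if h : z ∈ Z then c ⟨z, h⟩ else 0)
    refine ⟨⟨g, mV.2 (by omega)⟩, ?_⟩
    funext z
    have := hgc z.1 z.2
    rw [dif_pos z.2] at this
    simpa [ev, aeval_eq_eval] using this
  have h1 := ev.finrank_range_add_finrank_ker
  rw [LinearMap.range_eq_top.2 evs, finrank_top, Module.finrank_pi, Fintype.card_coe] at h1
  let φ : V (s + e) × V (s + d) →ₗ[K] V (d + e + s) :=
    LinearMap.codRestrict _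
      ((LinearMap.mulLeft K f ∘ₗ (V (s + e)).subtype).coprod
        (LinearMap.mulLeft K g ∘ₗ (V (s + d)).subtype)) <| by
      rintro ⟨⟨u, hu⟩, ⟨v, hv⟩⟩
      rw [mV] at hu hv ⊢
      simp only [LinearMap.coprod_apply, LinearMap.comp_apply, Submodule.subtype_apply,
        LinearMap.mulLeft_apply]
      refine (totalDegree_add _ _).trans (max_le ?_ ?_)
      · have := totalDegree_mul f u
        omega
      · have := totalDegree_mul g v
        omega
  have h2 := φ.finrank_range_add_finrank_ker
  rw [Module.finrank_prod] at h2
  have h3 : Module.finrank K (LinearMap.range φ) ≤ Module.finrank K (LinearMap.ker ev) := by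
    refine Submodule.finrank_mono ?_
    rintro _ ⟨⟨⟨u, hu⟩, ⟨v, hv⟩⟩, rfl⟩
    rw [LinearMap.mem_ker]
    funext z
    have := hZ z.1 z.2
    simp [ev, φ, aeval_eq_eval, this]
  let ψ : V s →ₗ[K] V (s + e) × V (s + d) :=
    (LinearMap.codRestrict _ (LinearMap.mulLeft K (-g) ∘ₗ (V s).subtype) <| by
      rintro ⟨w, hw⟩
      rw [mV] at hw ⊢
      simp only [LinearMap.comp_apply, Submodule.subtype_apply,
        LinearMap.mulLeft_apply]
      have := totalDegree_mul (-g) w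
      rw [totalDegree_neg] at this
      omega).prod
    (LinearMap.codRestrict _ (LinearMap.mulLeft K f ∘ₗ (V s).subtype) <| by
      rintro ⟨w, hw⟩
      rw [mV] at hw ⊢
      simp only [LinearMap.comp_apply, Submodule.subtype_apply,
        LinearMap.mulLeft_apply]
      have := totalDegree_mul f w
      omega)
  have h4 : LinearMap.ker φ ≤ LinearMap.range ψ := by
    rintro ⟨⟨u, hu⟩, ⟨v, hv⟩⟩ huv
    rw [LinearMap.mem_ker] at huv
    have huv' : f * u + g * v = 0 := congrArg Subtype.val huv
    have hdv : f ∣ g * v := ⟨-u, by linear_combination huv'⟩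
    obtain ⟨w, rfl⟩ := (hf.prime.dvd_or_dvd hdv).resolve_left hfg
    have hu' : u = -g * w := mul_left_cancel₀ hf.ne_zero (by linear_combination huv')
    have hw : w ∈ V s := by
      rw [mV] at hv ⊢
      by_cases hw : w = 0
      · simp [hw]
      · rw [totalDegree_mul_of_isDomain hf.ne_zero hw] at hv
        omega
    refine ⟨⟨w, hw⟩, ?_⟩
    refine Prod.ext (Subtype.ext ?_) (Subtype.ext rfl)
    exact hu'.symm
  have h5 : Module.finrank K (LinearMap.ker φ) ≤ Module.finrank K (V s) :=
    (Submodule.finrank_mono h4).trans ψ.finrank_range_le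
  have e1 := hV s
  have e2 := hV (s + e)
  have e3 := hV (s + d)
  have e4 := hV (d + e + s)
  nlinarith

/-- Substituting `X i + a i` for each variable `X i`. -/
noncomputable def translateVars {σ R : Type*} [CommRing R] (a : σ → R) :
    MvPolynomial σ R →ₐ[R] MvPolynomial σ R :=
  aeval fun i => X i + C (a i)

theorem eval_translateVars {σ R : Type*} [CommRing R] (a x : σ → R) (F : MvPolynomial σ R) :
    eval x (translateVars a F) = eval (x + a) F := by
  have : (eval x).comp (translateVars a).toRingHom = eval (x + a) := by
    refine MvPolynomial.ringHom_ext (fun r => ?_) fun i => ?_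
    · simp [translateVars]
    · simp [translateVars]
  exact RingHom.congr_fun this F

theorem translateVars_translateVars {σ R : Type*} [CommRing R] (a b : σ → R)
    (F : MvPolynomial σ R) :
    translateVars a (translateVars b F) = translateVars (a + b) F := by
  have : (translateVars a).comp (translateVars b) = translateVars (a + b) := by
    refine MvPolynomial.algHom_ext fun i => ?_
    simp [translateVars]
    ring
  exact AlgHom.congr_fun this F

theorem translateVars_zero {σ R : Type*} [CommRing R] (F : MvPolynomial σ R) :
    translateVars 0 F = F := by
  simp [translateVars]

theorem map_translateVars {σ R S : Type*} [CommRing R] [CommRing S] (φ : R →+* S) (a : σ → R)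
    (F : MvPolynomial σ R) : map φ (translateVars a F) = translateVars (φ ∘ a) (map φ F) := by
  have : (map φ).comp (translateVars a).toRingHom =
      (translateVars (φ ∘ a)).toRingHom.comp (map φ) := by
    refine MvPolynomial.ringHom_ext (fun r => ?_) fun i => ?_
    · simp [translateVars]
    · simp [translateVars]
  exact RingHom.congr_fun this F

theorem totalDegree_translateVars_le {σ R : Type*} [CommRing R] (a : σ → R) (F : MvPolynomial σ R) :
    (translateVars a F).totalDegree ≤ F.totalDegree := by
  rw [translateVars, aeval_def, eval₂_eq]
  refine totalDegree_finsetSum_le fun m hm => ?_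
  refine (totalDegree_mul _ _).trans ?_
  rw [algebraMap_eq, totalDegree_C, zero_add]
  refine (totalDegree_finsetProd _ _).trans ?_
  refine le_trans (Finset.sum_le_sum fun i _ => ?_) (le_totalDegree hm)
  refine (totalDegree_pow _ _).trans ?_
  calc _ ≤ m i * 1 := Nat.mul_le_mul_left _ ?_
    _ = m i := mul_one _
  refine (totalDegree_add _ _).trans (max_le ?_ (by simp))
  exact (totalDegree_monomial_le _ _).trans (by simp)

theorem totalDegree_translateVars {σ R : Type*} [CommRing R] (a : σ → R) (F : MvPolynomial σ R) :
    (translateVars a F).totalDegree = F.totalDegree := by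
  refine (totalDegree_translateVars_le a F).antisymm ?_
  have := totalDegree_translateVars_le (-a) (translateVars a F)
  rwa [translateVars_translateVars, neg_add_cancel, translateVars_zero] at this

/-- The exponents of degree in `[d, d + E)` that are not above `u`. -/
noncomputable def normalExponents (u : Fin 2 →₀ ℕ) (E : ℕ) : Finset (Fin 2 →₀ ℕ) := by
  classical exact (degBox (u.degree + E)).filter fun m => u.degree ≤ m.degree ∧ ¬ u ≤ m

theorem mem_normalExponents {u m : Fin 2 →₀ ℕ} {E : ℕ} : m ∈ normalExponents u E ↔
    m.degree < u.degree + E ∧ u.degree ≤ m.degree ∧ ¬ u ≤ m := by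
  simp [normalExponents, mem_degBox]

theorem card_normalExponents_fiber (u : Fin 2 →₀ ℕ) {E t : ℕ} (ht : t < E) :
    ((normalExponents u E).filter fun m => m.degree = u.degree + t).card = u.degree := by
  classical
  have h1 := card_filter_degree_eq (u.degree + E) (u.degree + t) (by omega)
  have h2 := card_filter_degree_eq E t ht
  rw [← Finset.card_filter_add_card_filter_not (fun m => u ≤ m)] at h1
  have h3 : (((degBox (u.degree + E)).filter fun m => m.degree = u.degree + t).filter
      fun m => u ≤ m) = ((degBox E).filter fun m => m.degree = t).map (addLeftEmbedding u) := by
    ext m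
    simp only [Finset.mem_filter, mem_degBox, Finset.mem_map, addLeftEmbedding_apply]
    constructor
    · rintro ⟨⟨_, h⟩, hm⟩
      obtain ⟨v, rfl⟩ := exists_add_of_le hm
      rw [map_add] at h
      exact ⟨v, ⟨by omega, by omega⟩, rfl⟩
    · rintro ⟨v, ⟨_, h⟩, rfl⟩
      rw [map_add]
      exact ⟨⟨by omega, by omega⟩, by simp⟩
  have h4 : (((degBox (u.degree + E)).filter fun m => m.degree = u.degree + t).filter
      fun m => ¬ u ≤ m) = (normalExponents u E).filter fun m => m.degree = u.degree + t := by
    ext m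
    simp only [Finset.mem_filter, mem_degBox, mem_normalExponents]
    constructor
    · rintro ⟨⟨h, h'⟩, hm⟩
      exact ⟨⟨h, by omega, hm⟩, h'⟩
    · rintro ⟨⟨h, _, hm⟩, h'⟩
      exact ⟨⟨h, h'⟩, hm⟩
  rw [h3, h4, Finset.card_map, h2] at h1
  omega

theorem prod_normalExponents {M : Type*} [CommMonoid M] (u : Fin 2 →₀ ℕ) (E : ℕ) (w : ℕ → M) :
    ∏ m ∈ normalExponents u E, w m.degree = ∏ t ∈ Finset.range E, w (u.degree + t) ^ u.degree := by
  classical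
  rw [← Finset.prod_fiberwise_of_maps_to (t := Finset.range E)
    (g := fun m : Fin 2 →₀ ℕ => m.degree - u.degree)]
  · refine Finset.prod_congr rfl fun t ht => ?_
    have e : ((normalExponents u E).filter fun m => m.degree - u.degree = t) =
        (normalExponents u E).filter fun m => m.degree = u.degree + t := by
      ext m
      simp only [Finset.mem_filter, mem_normalExponents]
      constructor <;> rintro ⟨⟨h1, h2, h3⟩, h4⟩ <;> exact ⟨⟨h1, h2, h3⟩, by omega⟩
    rw [e, Finset.prod_congr rfl fun m hm => by rw [(Finset.mem_filter.1 hm).2],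
      Finset.prod_const, card_normalExponents_fiber u (Finset.mem_range.1 ht)]
  · intro m hm
    have := mem_normalExponents.1 hm
    simp
    omega

theorem card_normalExponents (u : Fin 2 →₀ ℕ) (E : ℕ) :
    (normalExponents u E).card = u.degree * E := by
  have := prod_normalExponents u E (fun _ => Multiplicative.ofAdd 1)
  simp only [Finset.prod_const, Finset.card_range, ← ofAdd_nsmul, smul_eq_mul, mul_one] at this
  rw [Multiplicative.ofAdd.injective this, mul_comm]

theorem sq_prod_weights (u : Fin 2 →₀ ℕ) (E A B : ℕ) :
    (∏ m ∈ normalExponents u E, B * A ^ (u.degree + E - m.degree)) ^ 2 =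
      (B ^ 2 * A ^ (E + 1)) ^ (u.degree * E) := by
  rw [prod_normalExponents u E (fun n => B * A ^ (u.degree + E - n)), Finset.prod_pow,
    Finset.prod_mul_distrib, Finset.prod_const, Finset.prod_pow_eq_pow_sum, Finset.card_range]
  have h1 : (∑ t ∈ Finset.range E, (u.degree + E - (u.degree + t))) * 2 = (E + 1) * E := by
    have h2 : ∑ t ∈ Finset.range E, (u.degree + E - (u.degree + t)) =
        ∑ t ∈ Finset.range E, (t + 1) := by
      rw [← Finset.sum_range_reflect]
      refine Finset.sum_congr rfl fun t ht => ?_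
      have := Finset.mem_range.1 ht
      omega
    have h3 := Finset.sum_range_id_mul_two (E + 1)
    rw [Finset.sum_range_succ'] at h3
    rw [h2]
    simpa using h3
  have h4 : (∑ t ∈ Finset.range E, (u.degree + E - (u.degree + t))) * (u.degree * 2) =
      (E + 1) * (u.degree * E) := by
    calc _ = (∑ t ∈ Finset.range E, (u.degree + E - (u.degree + t))) * 2 * u.degree := by ring
      _ = _ := by rw [h1]; ring
  rw [← pow_mul, mul_pow, ← pow_mul, ← pow_mul, h4, mul_pow, ← pow_mul, ← pow_mul]
  congr 2
  ring

theorem eval_map_intCast {σ : Type*} (F : MvPolynomial σ ℤ) (x : σ → ℤ) :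
    eval (fun i => (x i : ℚ)) (map (Int.castRingHom ℚ) F) = (eval x F : ℤ) := by
  rw [eval_map, eval, coe_eval₂Hom, eval₂_eq, eval₂_eq]
  simp

theorem abs_eval_le_of_support_subset {h : MvPolynomial (Fin 2) ℤ} {N : Finset (Fin 2 →₀ ℕ)}
    (hN : h.support ⊆ N) {A : ℕ} {x : Fin 2 → ℤ} (hx : ∀ i, |x i| ≤ A) {V : ℤ}
    (hV : ∀ m ∈ N, |coeff m h| * (A : ℤ) ^ m.degree ≤ V) : |eval x h| ≤ N.card * V := by
  have e : eval x h = ∑ m ∈ N, coeff m h * ∏ i, x i ^ m i := by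
    rw [eval_eq']
    refine Finset.sum_subset hN fun m _ hm => ?_
    rw [notMem_support_iff.1 hm, zero_mul]
  rw [e, ← nsmul_eq_mul]
  refine (Finset.abs_sum_le_sum_abs _ _).trans (Finset.sum_le_card_nsmul _ _ _ fun m hm => ?_)
  refine le_trans ?_ (hV m hm)
  rw [abs_mul]
  refine mul_le_mul_of_nonneg_left ?_ (abs_nonneg _)
  rw [Finset.abs_prod, Finsupp.degree_eq_sum, ← Finset.prod_pow_eq_pow_sum]
  refine Finset.prod_le_prod (fun i _ => abs_nonneg _) fun i _ => ?_
  rw [abs_pow]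
  exact pow_le_pow_left₀ (abs_nonneg _) (hx i) _

theorem not_dvd_of_support_subset_normalExponents {K : Type*} [Field K]
    {F h : MvPolynomial (Fin 2) K} {E : ℕ} (h0 : h ≠ 0)
    (hN : h.support ⊆ normalExponents (MonomialOrder.degLex.degree F) E) : ¬ F ∣ h := by
  rintro ⟨q, rfl⟩
  have hF := left_ne_zero_of_mul h0
  have hq := right_ne_zero_of_mul h0
  have h1 := (mem_normalExponents.1
    (hN (MonomialOrder.degree_mem_support (m := MonomialOrder.degLex) h0))).2.2
  rw [MonomialOrder.degree_mul hF hq] at h1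
  exact h1 le_self_add

/-- The points of an irreducible plane curve reducing to a point of small multiplicity modulo a
prime lie on another curve of small degree, and so are few. -/
theorem card_le_of_congruent {F : MvPolynomial (Fin 2) ℤ}
    (hF : Irreducible (map (Int.castRingHom ℚ) F)) {d : ℕ}
    (hd : (map (Int.castRingHom ℚ) F).totalDegree = d) (hd0 : 0 < d) {p : ℕ} (hp : p.Prime)
    {ν e A : ℕ} (hν : 0 < ν) (he : 0 < e) (hA : 0 < A)
    (hbound : 4 * (d * (ν * e)) ^ 2 * A ^ (ν * e + 2 * d) * p < p ^ (d * e))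
    (T : Finset (Fin 2 → ℤ)) (hT : ∀ x ∈ T, eval x F = 0)
    (hTA : ∀ x ∈ T, ∀ y ∈ T, ∀ i, |x i - y i| ≤ A)
    (hTp : ∀ x ∈ T, ∀ y ∈ T, ∀ i, (p : ℤ) ∣ x i - y i) {x₀ : Fin 2 → ℤ} (hx₀ : x₀ ∈ T)
    (hgood : ∃ m, ¬ (p : ℤ) ^ (ν + 1) ∣ (p : ℤ) ^ m.degree * coeff m (translateVars x₀ F)) :
    T.card ≤ d * (d + ν * e) := by
  classical
  set E := ν * e with hE
  set k := d * e with hk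
  have hE0 : 0 < E := Nat.mul_pos hν he
  have hdE : 0 < d * E := Nat.mul_pos hd0 hE0
  set Q := Int.castRingHom ℚ
  set G := translateVars x₀ F with hG
  set u := MonomialOrder.degLex.degree (map Q G) with hu
  have hud : u.degree = d := by
    rw [hu, degree_degLexDegree, hG, map_translateVars, totalDegree_translateVars, hd]
  set Z := d * E * A ^ (E + d) with hZ
  have hZ0 : 0 < Z := Nat.mul_pos hdE (pow_pos hA _)
  set B := (p ^ k - 1) / Z with hB
  have hAp : A ^ (E + d) * A ^ (E + d) ≤ A ^ (E + 1) * A ^ (E + 2 * d) := by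
    rw [← pow_add, ← pow_add]
    exact Nat.pow_le_pow_right hA (by omega)
  have hZp : 2 * Z ≤ p ^ k := by
    refine le_trans ?_ hbound.le
    calc 2 * Z = 2 * (d * E) * A ^ (E + d) * 1 := by rw [hZ]; ring
      _ ≤ 4 * (d * E) ^ 2 * A ^ (E + 2 * d) * p := by
        refine Nat.mul_le_mul (Nat.mul_le_mul ?_ ?_) hp.one_le
        · nlinarith
        · exact Nat.pow_le_pow_right hA (by omega)
  have hBZ : Z * B < p ^ k := by
    have : Z * B ≤ p ^ k - 1 := Nat.mul_div_le (p ^ k - 1) Z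
    have := pow_pos hp.pos k
    omega
  have hBZ2 : p ^ k ≤ 2 * (Z * B) := by
    have h1 := Nat.lt_mul_div_succ (p ^ k - 1) hZ0
    have h2 : Z * ((p ^ k - 1) / Z + 1) = Z * B + Z := by rw [hB]; ring
    rw [h2] at h1
    by_cases hB1 : B = 0
    · rw [hB1] at h1
      omega
    · have : Z * 1 ≤ Z * B := Nat.mul_le_mul_left _ (Nat.one_le_iff_ne_zero.2 hB1)
      omega
  have hmain : p ^ (k + 1) < B ^ 2 * A ^ (E + 1) := by
    have h1 : p ^ k * p ^ k ≤ (2 * (Z * B)) * (2 * (Z * B)) := Nat.mul_le_mul hBZ2 hBZ2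
    have h2 : 4 * Z ^ 2 * p < p ^ k * A ^ (E + 1) := by
      calc 4 * Z ^ 2 * p = 4 * (d * E) ^ 2 * (A ^ (E + d) * A ^ (E + d)) * p := by rw [hZ]; ring
        _ ≤ 4 * (d * E) ^ 2 * (A ^ (E + 1) * A ^ (E + 2 * d)) * p := by gcongr
        _ = (4 * (d * E) ^ 2 * A ^ (E + 2 * d) * p) * A ^ (E + 1) := by ring
        _ < _ := Nat.mul_lt_mul_of_pos_right hbound (pow_pos hA _)
    have h3 : (4 * Z ^ 2) * p ^ (k + 1) < (4 * Z ^ 2) * (B ^ 2 * A ^ (E + 1)) := by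
      calc (4 * Z ^ 2) * p ^ (k + 1) = (4 * Z ^ 2 * p) * p ^ k := by ring
        _ < (p ^ k * A ^ (E + 1)) * p ^ k := Nat.mul_lt_mul_of_pos_right h2 (pow_pos hp.pos _)
        _ = p ^ k * p ^ k * A ^ (E + 1) := by ring
        _ ≤ (2 * (Z * B)) * (2 * (Z * B)) * A ^ (E + 1) := Nat.mul_le_mul_right _ h1
        _ = _ := by ring
    exact Nat.lt_of_mul_lt_mul_left h3
  have hcard : p ^ (ν * (degBox k).card) <
      ∏ m ∈ normalExponents u E, B * A ^ (u.degree + E - m.degree) := by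
    refine lt_of_pow_lt_pow_left₀ 2 (Nat.zero_le _) ?_
    rw [sq_prod_weights, hud, ← pow_mul]
    have : ν * (degBox k).card * 2 = (k + 1) * (d * E) := by
      calc _ = ν * (2 * (degBox k).card) := by ring
        _ = _ := by rw [two_mul_card_degBox, hE, hk]; ring
    rw [this, pow_mul]
    exact Nat.pow_lt_pow_left hmain hdE.ne'
  obtain ⟨h, h0, hN, hc, hx⟩ := exists_pow_dvd_eval hp G k hgood (normalExponents u E)
    (fun m => B * A ^ (u.degree + E - m.degree)) hcard
  have hzero : ∀ x ∈ T, eval (x - x₀) h = 0 := fun x hxT => by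
    refine Int.eq_zero_of_abs_lt_dvd (hx (x - x₀) (fun i => hTp x hxT x₀ hx₀ i) ?_) ?_
    · rw [hG, eval_translateVars, sub_add_cancel]
      exact hT x hxT
    · have h1 := abs_eval_le_of_support_subset hN (A := A) (x := x - x₀)
        (fun i => hTA x hxT x₀ hx₀ i) (V := B * A ^ (E + d)) fun m hm => by
          have h2 := mem_normalExponents.1 hm
          have h3 : E + d = (u.degree + E - m.degree) + m.degree := by omega
          rw [h3, pow_add, ← mul_assoc]
          refine mul_le_mul_of_nonneg_right ?_ (by positivity)
          exact_mod_cast (hc m hm).le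
      refine h1.trans_lt ?_
      rw [card_normalExponents, hud]
      have h4 : ((d * E : ℕ) : ℤ) * (B * A ^ (E + d)) = ((Z * B : ℕ) : ℤ) := by
        rw [hZ]
        push_cast
        ring
      rw [h4]
      exact_mod_cast hBZ
  have hinj : Function.Injective Q := Int.cast_injective
  have hndvd : ¬ map Q F ∣ translateVars (Q ∘ (-x₀)) (map Q h) := by
    intro hdvd
    have h1 := (translateVars (Q ∘ x₀)).toRingHom.map_dvd hdvd
    have h2 : Q ∘ x₀ + Q ∘ (-x₀) = 0 := by
      funext i
      simp
    change translateVars (Q ∘ x₀) (map Q F) ∣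
      translateVars (Q ∘ x₀) (translateVars (Q ∘ (-x₀)) (map Q h)) at h1
    rw [translateVars_translateVars, h2, translateVars_zero, ← map_translateVars] at h1
    refine not_dvd_of_support_subset_normalExponents (E := E) ?_ ?_ h1
    · rwa [Ne, map_eq_zero_iff _ (map_injective _ hinj)]
    · exact (support_map_subset _ _).trans hN
  let ι : (Fin 2 → ℤ) ↪ (Fin 2 → ℚ) := ⟨fun x i => (x i : ℚ), fun x y hxy => by
    funext i
    exact Int.cast_injective (congrFun hxy i)⟩
  have hfin := card_le_mul_of_not_dvd hF hndvd (e := d + E) hd ?_ (T.map ι) ?_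
  · rwa [Finset.card_map] at hfin
  · rw [totalDegree_translateVars]
    refine Finset.sup_le fun m hm => ?_
    have := (mem_normalExponents.1 (hN (support_map_subset _ _ hm))).1
    change m.degree ≤ d + E
    omega
  · intro z hz
    obtain ⟨x, hxT, rfl⟩ := Finset.mem_map.1 hz
    refine ⟨?_, ?_⟩
    · change eval (fun i => (x i : ℚ)) _ = 0
      rw [eval_map_intCast, hT x hxT, Int.cast_zero]
    · rw [eval_translateVars]
      have h3 : ι x + Q ∘ (-x₀) = fun i => (((x - x₀) i : ℤ) : ℚ) := by
        funext i
        change (x i : ℚ) + ((-x₀ i : ℤ) : ℚ) = ((x i - x₀ i : ℤ) : ℚ)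
        push_cast
        ring
      rw [h3, eval_map_intCast, hzero x hxT, Int.cast_zero]

/-- All Taylor coefficients of `G` at `P` of degree less than `M` vanish. -/
def VanishesToOrder {σ R : Type*} [CommRing R] (P : σ → R) (M : ℕ) (G : MvPolynomial σ R) : Prop :=
  ∀ m : σ →₀ ℕ, m.degree < M → coeff m (translateVars P G) = 0

theorem VanishesToOrder.of_X_mul {σ K : Type*} [Field K] {P : σ → K} {M : ℕ} {i : σ} {a : K}
    {G : MvPolynomial σ K} (h : VanishesToOrder P M ((X i - C a) * G)) :
    VanishesToOrder P (M - 1) G ∧ (P i ≠ a → VanishesToOrder P M G) := by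
  classical
  have e : translateVars P ((X i - C a) * G) =
      X i * translateVars P G + C (P i - a) * translateVars P G := by
    rw [map_mul, ← add_mul]
    congr 1
    simp [translateVars]
    ring
  have key : ∀ m : σ →₀ ℕ, m.degree < M → coeff m (X i * translateVars P G) +
      (P i - a) * coeff m (translateVars P G) = 0 := fun m hm => by
    rw [← coeff_C_mul, ← coeff_add, ← e]
    exact h m hm
  by_cases hPa : P i = a
  · refine ⟨fun m hm => ?_, fun h => (h hPa).elim⟩
    have := key (Finsupp.single i 1 + m) (by
      rw [map_add, Finsupp.degree_single]
      omega)
    simpa [hPa] using this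
  · have hM : VanishesToOrder P M G := by
      intro m
      induction hn : m.degree generalizing m with
      | zero =>
        intro hm
        have h1 := key m (by omega)
        rw [Finsupp.degree_eq_zero_iff] at hn
        rw [hn, coeff_X_mul'] at h1
        simpa [hn, sub_eq_zero, hPa] using h1
      | succ n ih =>
        intro hm
        have h1 := key m (by omega)
        rw [coeff_X_mul'] at h1
        split_ifs at h1 with hi
        · rw [ih (m - Finsupp.single i 1) ?_ (by omega)] at h1
          · simpa [sub_eq_zero, hPa] using h1
          · have h2 : Finsupp.single i 1 ≤ m := by
              rw [Finsupp.single_le_iff]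
              exact Nat.one_le_iff_ne_zero.2 (Finsupp.mem_support_iff.1 hi)
            have h3 := congrArg Finsupp.degree (tsub_add_cancel_of_le h2)
            rw [map_add, Finsupp.degree_single] at h3
            omega
        · simpa [sub_eq_zero, hPa] using h1
    exact ⟨fun m hm => hM m (by omega), fun _ => hM⟩

/-- Restriction of a bivariate polynomial to the vertical axis. -/
noncomputable def restrictAxis (R : Type*) [CommRing R] :
    MvPolynomial (Fin 2) R →ₐ[R] Polynomial R :=
  aeval ![0, Polynomial.X]

theorem coeff_restrictAxis {R : Type*} [CommRing R] (F : MvPolynomial (Fin 2) R) (n : ℕ) :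
    (restrictAxis R F).coeff n = coeff (Finsupp.single 1 n) F := by
  classical
  induction F using MvPolynomial.induction_on' with
  | monomial u a =>
    rw [restrictAxis, aeval_monomial, Finsupp.prod_fintype _ _ (by simp), coeff_monomial]
    simp only [Fin.prod_univ_two, Matrix.cons_val_zero, Matrix.cons_val_one,
      Polynomial.algebraMap_eq, Polynomial.coeff_C_mul]
    by_cases h0 : u 0 = 0
    · have : u = Finsupp.single 1 n ↔ u 1 = n := by
        constructor
        · intro h
          simp [h]
        · intro h
          ext i
          fin_cases i <;> simp [h0, h]
      simp only [h0, pow_zero, one_mul, Polynomial.coeff_X_pow, this, eq_comm (a := n)]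
      split_ifs <;> simp
    · have : u ≠ Finsupp.single 1 n := fun h => h0 (by simp [h])
      simp [h0, this]
  | add p q hp hq => simp [hp, hq]

theorem restrictAxis_translateVars {R : Type*} [CommRing R] (b : R) (F : MvPolynomial (Fin 2) R) :
    restrictAxis R (translateVars ![0, b] F) = Polynomial.taylor b (restrictAxis R F) := by
  have : (restrictAxis R).comp (translateVars ![0, b]) =
      (Polynomial.taylorAlgHom b).comp (restrictAxis R) := by
    refine MvPolynomial.algHom_ext fun i => ?_
    fin_cases i <;> simp [restrictAxis, translateVars]
  exact AlgHom.congr_fun this F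

theorem X_sub_C_dvd_of_restrictAxis_eq_zero {K : Type*} [Field K] {a : K}
    {G : MvPolynomial (Fin 2) K} (h : restrictAxis K (translateVars ![a, 0] G) = 0) :
    X 0 - C a ∣ G := by
  classical
  have h1 : X 0 ∣ translateVars ![a, 0] G := by
    rw [X_dvd_iff_modMonomial_eq_zero]
    ext m
    by_cases hm : Finsupp.single 0 1 ≤ m
    · rw [coeff_modMonomial_of_le _ hm, coeff_zero]
    · rw [coeff_modMonomial_of_not_le _ hm, coeff_zero]
      rw [Finsupp.single_le_iff] at hm
      have : m = Finsupp.single 1 (m 1) := by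
        ext i
        fin_cases i
        · simp; omega
        · simp
      rw [this, ← coeff_restrictAxis, h, Polynomial.coeff_zero]
  have h2 := (translateVars (-![a, 0])).toRingHom.map_dvd h1
  change translateVars (-![a, 0]) (X 0) ∣ translateVars (-![a, 0]) (translateVars ![a, 0] G) at h2
  rw [translateVars_translateVars, neg_add_cancel, translateVars_zero] at h2
  simpa [translateVars, sub_eq_add_neg] using h2

theorem VanishesToOrder.pow_dvd_restrictAxis {K : Type*} [Field K] {a b : K} {M : ℕ}
    {G : MvPolynomial (Fin 2) K} (h : VanishesToOrder ![a, b] M G) :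
    (Polynomial.X - Polynomial.C b) ^ M ∣ restrictAxis K (translateVars ![a, 0] G) := by
  have h1 : Polynomial.X ^ M ∣ Polynomial.taylor b (restrictAxis K (translateVars ![a, 0] G)) := by
    rw [← restrictAxis_translateVars, translateVars_translateVars, Polynomial.X_pow_dvd_iff]
    intro n hn
    rw [coeff_restrictAxis]
    have : (![0, b] + ![a, 0] : Fin 2 → K) = ![a, b] := by simp
    rw [this]
    exact h _ (by simpa using hn)
  have h2 := (Polynomial.taylorAlgHom (-b)).toRingHom.map_dvd h1
  change Polynomial.taylorAlgHom (-b) _ ∣ Polynomial.taylorAlgHom (-b) _ at h2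
  rw [map_pow, Polynomial.taylorAlgHom_apply, Polynomial.taylorAlgHom_apply,
    Polynomial.taylor_taylor, Polynomial.taylor_X] at h2
  simpa [sub_eq_add_neg] using h2

theorem natDegree_restrictAxis_le {R : Type*} [CommRing R] (F : MvPolynomial (Fin 2) R) :
    (restrictAxis R F).natDegree ≤ F.totalDegree := by
  rw [Polynomial.natDegree_le_iff_coeff_eq_zero]
  intro n hn
  rw [coeff_restrictAxis]
  refine coeff_eq_zero_of_totalDegree_lt ?_
  change _ < (Finsupp.single (1 : Fin 2) n).degree
  simpa using hn

/-- The Schwartz-Zippel lemma with multiplicities for bivariate polynomials over a finite field. -/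
theorem sum_order_le {K : Type*} [Field K] [Fintype K] (d : ℕ) (G : MvPolynomial (Fin 2) K)
    (hG : G ≠ 0) (hd : G.totalDegree ≤ d) (μ : K → K → ℕ)
    (hμ : ∀ a b, VanishesToOrder ![a, b] (μ a b) G) :
    ∑ a, ∑ b, μ a b ≤ d * Fintype.card K := by
  classical
  induction d generalizing G μ with
  | zero =>
    rw [Nat.zero_mul, Nat.le_zero, Finset.sum_eq_zero]
    intro a _
    rw [Finset.sum_eq_zero]
    intro b _
    by_contra h
    have h1 := hμ a b 0 (by simpa using Nat.pos_of_ne_zero h)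
    rw [totalDegree_eq_zero_iff_eq_C.1 (Nat.le_zero.1 hd)] at h1 hG
    refine hG ?_
    simpa [translateVars] using h1
  | succ d ih =>
    by_cases h : ∃ a, restrictAxis K (translateVars ![a, 0] G) = 0
    · obtain ⟨a, ha⟩ := h
      obtain ⟨G', rfl⟩ := X_sub_C_dvd_of_restrictAxis_eq_zero ha
      have hX := left_ne_zero_of_mul hG
      have hG' := right_ne_zero_of_mul hG
      rw [totalDegree_mul_of_isDomain hX hG'] at hd
      have hX1 : (X 0 - C a : MvPolynomial (Fin 2) K).totalDegree = 1 := by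
        rw [sub_eq_add_neg, ← C_neg, totalDegree_add_eq_left_of_totalDegree_lt] <;> simp
      have h1 := ih G' hG' (by omega) (fun a' b => if a' = a then μ a' b - 1 else μ a' b) (by
        intro a' b
        have h2 := (hμ a' b).of_X_mul
        split_ifs with h3
        · exact h2.1
        · exact h2.2 h3)
      calc ∑ a', ∑ b, μ a' b
          ≤ ∑ a', ∑ b, ((if a' = a then μ a' b - 1 else μ a' b) + if a' = a then 1 else 0) := by
            refine Finset.sum_le_sum fun a' _ => Finset.sum_le_sum fun b _ => ?_
            split_ifs <;> omega
        _ = (∑ a', ∑ b, if a' = a then μ a' b - 1 else μ a' b) + Fintype.card K := by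
            simp_rw [Finset.sum_add_distrib]
            congr 1
            simp
        _ ≤ (d + 1) * Fintype.card K := by
            rw [add_mul, one_mul]
            exact Nat.add_le_add_right h1 _
    · push Not at h
      refine (Finset.sum_le_card_nsmul _ _ (d + 1) fun a _ => ?_).trans (by simp [mul_comm])
      have h1 : ∏ b, (Polynomial.X - Polynomial.C b) ^ μ a b ∣
          restrictAxis K (translateVars ![a, 0] G) := by
        refine Finset.prod_dvd_of_coprime (fun b _ b' _ hb => ?_) fun b _ =>
          (hμ a b).pow_dvd_restrictAxis
        exact (Polynomial.pairwise_coprime_X_sub_C Function.injective_id hb).pow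
      have h2 := Polynomial.natDegree_le_of_dvd h1 (h a)
      rw [Polynomial.natDegree_prod_of_monic _ _
        fun b _ => (Polynomial.monic_X_sub_C b).pow _] at h2
      simp only [Polynomial.natDegree_pow, Polynomial.natDegree_X_sub_C, mul_one] at h2
      refine h2.trans ((natDegree_restrictAxis_le _).trans ?_)
      rwa [totalDegree_translateVars]

theorem mul_card_vanishesToOrder_le {K : Type*} [Field K] [Fintype K] {d M : ℕ}
    {G : MvPolynomial (Fin 2) K} (hG : G ≠ 0) (hd : G.totalDegree ≤ d) (T : Finset (Fin 2 → K))
    (hT : ∀ P ∈ T, VanishesToOrder P M G) : M * T.card ≤ d * Fintype.card K := by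
  classical
  have h := sum_order_le d G hG hd (fun a b => if ![a, b] ∈ T then M else 0) (by
    intro a b
    split_ifs with h
    · exact hT _ h
    · exact fun m hm => (Nat.not_lt_zero _ hm).elim)
  refine le_trans (le_of_eq ?_) h
  rw [← Fintype.sum_prod_type', Finset.sum_ite, Finset.sum_const_zero, add_zero, Finset.sum_const,
    smul_eq_mul, mul_comm]
  congr 1
  refine Finset.card_bij (fun P _ => (P 0, P 1)) ?_ ?_ ?_
  · intro P hP
    have : ![P 0, P 1] = P := by
      funext i
      fin_cases i <;> rfl
    simpa [this] using hP
  · intro P _ P' _ h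
    rw [Prod.mk.injEq] at h
    funext i
    fin_cases i
    · exact h.1
    · exact h.2
  · rintro ⟨a, b⟩ hab
    exact ⟨![a, b], by simpa using hab, by simp⟩

/-- The polynomial `F` has order at most `ν` at the point `(p, x)` of the arithmetic plane. -/
def HasOrderLE {σ : Type*} (p ν : ℕ) (F : MvPolynomial σ ℤ) (x : σ → ℤ) : Prop :=
  ∃ m, ¬ (p : ℤ) ^ (ν + 1) ∣ (p : ℤ) ^ m.degree * coeff m (translateVars x F)

/-- The reduction of an integral point modulo `p`. -/
def reducePoint {σ : Type*} (p : ℕ) (x : σ → ℤ) : σ → ZMod p := fun i => (x i : ZMod p)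

theorem VanishesToOrder.of_not_hasOrderLE {σ : Type*} {p ν : ℕ} (hp : p.Prime)
    {F : MvPolynomial σ ℤ} {x : σ → ℤ} (h : ¬ HasOrderLE p ν F x) :
    VanishesToOrder (reducePoint p x) (ν + 1) (map (Int.castRingHom (ZMod p)) F) := by
  intro m hm
  have e : reducePoint p x = Int.castRingHom (ZMod p) ∘ x := rfl
  rw [e, ← map_translateVars, coeff_map, eq_intCast, ZMod.intCast_zmod_eq_zero_iff_dvd]
  unfold HasOrderLE at h
  push Not at h
  have h1 := h m
  have h2 : (p : ℤ) ^ (ν + 1) = (p : ℤ) ^ m.degree * (p : ℤ) ^ (ν + 1 - m.degree) := by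
    rw [← pow_add, Nat.add_sub_cancel' hm.le]
  rw [h2] at h1
  have h3 := (mul_dvd_mul_iff_left (pow_ne_zero _ (by exact_mod_cast hp.ne_zero))).1 h1
  exact (dvd_pow_self _ (by omega)).trans h3

theorem VanishesToOrder.of_eval_eq_zero {σ : Type*} (p : ℕ)
    {F : MvPolynomial σ ℤ} {x : σ → ℤ} (h : eval x F = 0) :
    VanishesToOrder (reducePoint p x) 1 (map (Int.castRingHom (ZMod p)) F) := by
  intro m hm
  have e : reducePoint p x = Int.castRingHom (ZMod p) ∘ x := rfl
  rw [Nat.lt_one_iff, Finsupp.degree_eq_zero_iff] at hm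
  have h0 : (fun _ => 0) + x = x := zero_add x
  rw [e, ← map_translateVars, coeff_map, hm, ← constantCoeff_eq, ← eval_zero',
    eval_translateVars, h0, h, map_zero]

theorem map_castRingHom_ne_zero {σ : Type*} {p : ℕ} {F : MvPolynomial σ ℤ}
    (h : ¬ C (p : ℤ) ∣ F) : map (Int.castRingHom (ZMod p)) F ≠ 0 := by
  contrapose! h
  rw [C_dvd_iff_dvd_coeff]
  intro m
  have := congrArg (coeff m) h
  rwa [coeff_map, coeff_zero, eq_intCast, ZMod.intCast_zmod_eq_zero_iff_dvd] at this

theorem totalDegree_map_le {σ R S : Type*} [CommRing R] [CommRing S] (φ : R →+* S)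
    (F : MvPolynomial σ R) : (map φ F).totalDegree ≤ F.totalDegree :=
  Finset.sup_mono (support_map_subset _ _)

theorem totalDegree_map_intCast {σ : Type*} (F : MvPolynomial σ ℤ) :
    (map (Int.castRingHom ℚ) F).totalDegree = F.totalDegree := by
  unfold totalDegree
  rw [support_map_of_injective _ (RingHom.injective_int _)]

open scoped Classical in
theorem card_image_reducePoint_mul_le {F : MvPolynomial (Fin 2) ℤ} {p d ν : ℕ} (hp : p.Prime)
    (hFp : ¬ C (p : ℤ) ∣ F) (hd : F.totalDegree ≤ d) (S : Finset (Fin 2 → ℤ))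
    (hS : ∀ x ∈ S, ¬ HasOrderLE p ν F x) :
    (ν + 1) * (S.image (reducePoint p)).card ≤ d * p := by
  have := Fact.mk hp
  have h := mul_card_vanishesToOrder_le (M := ν + 1) (map_castRingHom_ne_zero hFp)
    ((totalDegree_map_le _ _).trans hd) (S.image (reducePoint p)) (by
      intro P hP
      obtain ⟨x, hx, rfl⟩ := Finset.mem_image.1 hP
      exact .of_not_hasOrderLE hp (hS x hx))
  rwa [ZMod.card] at h

open scoped Classical in
theorem card_image_reducePoint_le {F : MvPolynomial (Fin 2) ℤ} {p d : ℕ} (hp : p.Prime)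
    (hFp : ¬ C (p : ℤ) ∣ F) (hd : F.totalDegree ≤ d) (S : Finset (Fin 2 → ℤ))
    (hS : ∀ x ∈ S, eval x F = 0) : (S.image (reducePoint p)).card ≤ d * p := by
  have := Fact.mk hp
  have h := mul_card_vanishesToOrder_le (M := 1) (map_castRingHom_ne_zero hFp)
    ((totalDegree_map_le _ _).trans hd) (S.image (reducePoint p)) (by
      intro P hP
      obtain ⟨x, hx, rfl⟩ := Finset.mem_image.1 hP
      exact .of_eval_eq_zero p (hS x hx))
  rwa [ZMod.card, one_mul] at h

open scoped Classical in
theorem card_image_reducePoint_le_sq {p : ℕ} (hp : p.Prime) (S : Finset (Fin 2 → ℤ)) :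
    (S.image (reducePoint p)).card ≤ p ^ 2 := by
  have := Fact.mk hp
  refine (Finset.card_le_univ _).trans (le_of_eq ?_)
  simp [ZMod.card]

open scoped Classical in
theorem card_filter_hasOrderLE_le {F : MvPolynomial (Fin 2) ℤ}
    (hF : Irreducible (map (Int.castRingHom ℚ) F)) {d : ℕ} (hd : F.totalDegree = d)
    (hd0 : 0 < d) {p : ℕ} (hp : p.Prime) {ν e A : ℕ} (hν : 0 < ν) (he : 0 < e) (hA : 0 < A)
    (hbound : 4 * (d * (ν * e)) ^ 2 * A ^ (ν * e + 2 * d) * p < p ^ (d * e))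
    (S : Finset (Fin 2 → ℤ)) (hS : ∀ x ∈ S, eval x F = 0)
    (hSA : ∀ x ∈ S, ∀ y ∈ S, ∀ i, |x i - y i| ≤ A) :
    (S.filter (HasOrderLE p ν F)).card ≤
      d * (d + ν * e) * (S.image (reducePoint p)).card := by
  refine (Finset.card_le_mul_card_image (f := reducePoint p) _ (d * (d + ν * e)) ?_).trans
    (Nat.mul_le_mul_left _ (Finset.card_le_card (Finset.image_subset_image
      (Finset.filter_subset _ _))))
  intro P hP
  obtain ⟨x₀, hx₀, rfl⟩ := Finset.mem_image.1 hP
  have hx₁ := Finset.mem_filter.1 hx₀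
  refine card_le_of_congruent hF ((totalDegree_map_intCast F).trans hd) hd0 hp hν he hA hbound _
    ?_ ?_ ?_ (x₀ := x₀) ?_ hx₁.2
  · exact fun x hx => hS x (Finset.mem_filter.1 (Finset.mem_filter.1 hx).1).1
  · exact fun x hx y hy => hSA x (Finset.mem_filter.1 (Finset.mem_filter.1 hx).1).1
      y (Finset.mem_filter.1 (Finset.mem_filter.1 hy).1).1
  · intro x hx y hy i
    have h1 := congrFun ((Finset.mem_filter.1 hx).2.trans (Finset.mem_filter.1 hy).2.symm) i
    exact (ZMod.intCast_eq_intCast_iff_dvd_sub _ _ _).1 h1.symm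
  · exact Finset.mem_filter.2 ⟨hx₀, rfl⟩

theorem eval_reducePoint_map {σ : Type*} (p : ℕ) (x : σ → ℤ) (F : MvPolynomial σ ℤ) :
    eval (reducePoint p x) (map (Int.castRingHom (ZMod p)) F) = (eval x F : ℤ) := by
  have e : reducePoint p x = Int.castRingHom (ZMod p) ∘ x := rfl
  rw [e, eval_map, ← eval₂_comp, eq_intCast]

theorem totalDegree_le_of_support_subset_degBox {R : Type*} [CommRing R]
    {g : MvPolynomial (Fin 2) R} {n : ℕ} (h : g.support ⊆ degBox (n + 1)) :
    g.totalDegree ≤ n :=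
  Finset.sup_le fun _ hm => Nat.le_of_lt_succ (mem_degBox.1 (h hm))

/-- A sufficiently large box of polynomials contains two whose difference vanishes at prescribed
points modulo several primes. -/
theorem exists_forall_prime_dvd_eval (P : Finset ℕ) (hP : ∀ p ∈ P, p.Prime)
    (T : ∀ p : ℕ, Finset (Fin 2 → ZMod p)) (N : Finset (Fin 2 →₀ ℕ)) (b : ℕ)
    (hcard : ∏ p ∈ P, p ^ (T p).card < b ^ N.card) :
    ∃ g : MvPolynomial (Fin 2) ℤ, g ≠ 0 ∧ g.support ⊆ N ∧ (∀ m ∈ N, |coeff m g| < b) ∧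
      ∀ p ∈ P, ∀ x, reducePoint p x ∈ T p → (p : ℤ) ∣ eval x g := by
  classical
  have hne : ∀ p : P, NeZero p.1 := fun p => ⟨(hP _ p.2).ne_zero⟩
  let G : (N → Fin b) → MvPolynomial (Fin 2) ℤ := fun c => ofCoeffs N fun m => (c m : ℕ)
  let Φ : (N → Fin b) → ∀ p : P, T p.1 → ZMod p.1 :=
    fun c p x => eval x.1 (map (Int.castRingHom (ZMod p.1)) (G c))
  have hlt : Fintype.card (∀ p : P, T p.1 → ZMod p.1) < Fintype.card (N → Fin b) := by
    simp only [Fintype.card_pi, ZMod.card, Fintype.card_fin, Finset.prod_const, Finset.card_univ,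
      Fintype.card_coe]
    rwa [Finset.prod_coe_sort P (fun p => p ^ (T p).card)]
  obtain ⟨g₁, g₂, hneq, heq⟩ := Fintype.exists_ne_map_eq_of_card_lt Φ hlt
  refine ⟨G g₁ - G g₂, ?_, ?_, ?_, ?_⟩
  · intro h0
    refine hneq (funext fun m => ?_)
    have h1 : coeff m.1 (G g₁ - G g₂) = 0 := by rw [h0, coeff_zero]
    rw [coeff_sub, coeff_ofCoeffs_of_mem, coeff_ofCoeffs_of_mem] at h1
    exact Fin.ext (by omega)
  · change (ofCoeffs N _ - ofCoeffs N _).support ⊆ N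
    rw [← ofCoeffs_sub]
    exact support_ofCoeffs_subset _ _
  · intro m hm
    have e1 := coeff_ofCoeffs_of_mem N (fun m => ((g₁ m : ℕ) : ℤ)) ⟨m, hm⟩
    have e2 := coeff_ofCoeffs_of_mem N (fun m => ((g₂ m : ℕ) : ℤ)) ⟨m, hm⟩
    rw [coeff_sub]
    simp only [G]
    rw [e1, e2, abs_lt]
    have b1 : (g₁ ⟨m, hm⟩ : ℕ) < b := (g₁ ⟨m, hm⟩).2
    have b2 : (g₂ ⟨m, hm⟩ : ℕ) < b := (g₂ ⟨m, hm⟩).2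
    constructor <;> omega
  · intro p hp x hx
    have h1 := congrFun (congrFun heq ⟨p, hp⟩) ⟨_, hx⟩
    simp only [Φ, eval_reducePoint_map] at h1
    rw [← ZMod.intCast_zmod_eq_zero_iff_dvd, map_sub, Int.cast_sub, h1, sub_self]

theorem not_map_dvd_of_totalDegree_lt {σ : Type*} {F g : MvPolynomial σ ℤ} (hg : g ≠ 0)
    (h : g.totalDegree < F.totalDegree) :
    ¬ map (Int.castRingHom ℚ) F ∣ map (Int.castRingHom ℚ) g := by
  rintro ⟨q, hq⟩
  have hg0 : map (Int.castRingHom ℚ) g ≠ 0 := by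
    rwa [Ne, map_eq_zero_iff _ (map_injective _ (RingHom.injective_int _))]
  rw [hq] at hg0
  have h2 := totalDegree_mul_of_isDomain (left_ne_zero_of_mul hg0) (right_ne_zero_of_mul hg0)
  rw [← hq, totalDegree_map_intCast, totalDegree_map_intCast] at h2
  omega

theorem card_le_of_eval_intCast_eq_zero {f g : MvPolynomial (Fin 2) ℚ} (hf : Irreducible f)
    {d e : ℕ} (hd : f.totalDegree = d) (hfg : ¬ f ∣ g) (he : g.totalDegree ≤ e)
    (S : Finset (Fin 2 → ℤ))
    (hS : ∀ x ∈ S, eval (fun i => (x i : ℚ)) f = 0 ∧ eval (fun i => (x i : ℚ)) g = 0) :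
    S.card ≤ d * e := by
  have hinj : Function.Injective fun (x : Fin 2 → ℤ) i => (x i : ℚ) := fun x y h =>
    funext fun i => Int.cast_injective (congrFun h i)
  rw [← Finset.card_map ⟨_, hinj⟩]
  refine card_le_mul_of_not_dvd hf hfg hd he _ fun z hz => ?_
  obtain ⟨x, hx, rfl⟩ := Finset.mem_map.1 hz
  exact hS x hx

theorem card_le_of_eval_map_eq_zero {F g : MvPolynomial (Fin 2) ℤ}
    (hF : Irreducible (map (Int.castRingHom ℚ) F)) {d e : ℕ} (hd : F.totalDegree = d)
    (hFg : ¬ map (Int.castRingHom ℚ) F ∣ map (Int.castRingHom ℚ) g) (he : g.totalDegree ≤ e)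
    (S : Finset (Fin 2 → ℤ)) (hS : ∀ x ∈ S, eval x F = 0 ∧ eval x g = 0) : S.card ≤ d * e := by
  refine card_le_of_eval_intCast_eq_zero hF ((totalDegree_map_intCast F).trans hd) hFg
    ((totalDegree_map_intCast g).trans_le he) S fun x hx => ?_
  simpa only [eval_map_intCast, Int.cast_eq_zero] using hS x hx

open scoped Classical in
theorem card_filter_forall_not_hasOrderLE_le {F : MvPolynomial (Fin 2) ℤ}
    (hF : Irreducible (map (Int.castRingHom ℚ) F)) {d : ℕ} (hd : F.totalDegree = d)
    (P : Finset ℕ) (hP : ∀ p ∈ P, p.Prime) (hFP : ∀ p ∈ P, ¬ C (p : ℤ) ∣ F)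
    {ν τ n A : ℕ} (hA : 0 < A) (hτ : ∀ p ∈ P, d * p ≤ (ν + 1) * τ) (hn : n ≤ d)
    (hnτ : 2 * τ < (degBox n).card)
    (hM : ((degBox n).card * A ^ n + 1) ^ 2 ≤ ∏ p ∈ P, p)
    (S : Finset (Fin 2 → ℤ)) (hS : ∀ x ∈ S, eval x F = 0) (hSA : ∀ x ∈ S, ∀ i, |x i| ≤ A) :
    (S.filter (fun x => ∀ p ∈ P, ¬ HasOrderLE p ν F x)).card ≤ d * n := by
  set S' := S.filter (fun x => ∀ p ∈ P, ¬ HasOrderLE p ν F x) with hS'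
  set M := ∏ p ∈ P, p with hM_def
  have hT : ∀ p ∈ P, (S'.image (reducePoint p)).card ≤ τ := fun p hp => by
    have h := (card_image_reducePoint_mul_le (ν := ν) (hP p hp) (hFP p hp) hd.le S'
      fun x hx => (Finset.mem_filter.1 hx).2 p hp).trans (hτ p hp)
    exact Nat.le_of_mul_le_mul_left h (Nat.succ_pos ν)
  obtain ⟨g, hg0, hgN, hgc, hgd⟩ := exists_forall_prime_dvd_eval P hP
    (fun p => S'.image (reducePoint p)) (degBox n) (M.sqrt + 1) (by
      calc ∏ p ∈ P, p ^ (S'.image (reducePoint p)).card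
          ≤ ∏ p ∈ P, p ^ τ :=
            Finset.prod_le_prod' fun p hp => Nat.pow_le_pow_right (hP p hp).pos (hT p hp)
        _ = M ^ τ := Finset.prod_pow _ _ _
        _ ≤ ((M.sqrt + 1) ^ 2) ^ τ := Nat.pow_le_pow_left (by
            rw [sq]
            exact (Nat.lt_succ_sqrt M).le) _
        _ = (M.sqrt + 1) ^ (2 * τ) := (pow_mul _ _ _).symm
        _ < (M.sqrt + 1) ^ (degBox n).card := Nat.pow_lt_pow_right (by
            have : 0 < M.sqrt := Nat.sqrt_pos.2 (Finset.prod_pos fun p hp => (hP p hp).pos)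
            omega) hnτ)
  have hn0 : 0 < n := by
    rcases Nat.eq_zero_or_pos n with rfl | h
    · have := two_mul_card_degBox 0
      omega
    · exact h
  have hgdeg : g.totalDegree < n := by
    have := totalDegree_le_of_support_subset_degBox (n := n - 1) (g := g) (by
      rwa [Nat.sub_add_cancel hn0])
    omega
  have hcop : (P : Set ℕ).Pairwise (Function.onFun IsCoprime fun p : ℕ => (p : ℤ)) :=
    fun p hp q hq hpq =>
      Nat.isCoprime_iff_coprime.2 ((Nat.coprime_primes (hP p hp) (hP q hq)).2 hpq)
  have hval : ∀ x ∈ S', eval x g = 0 := by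
    intro x hx
    have hx1 := Finset.mem_filter.1 hx
    refine Int.eq_zero_of_abs_lt_dvd (m := M) ?_ ?_
    · rw [hM_def, Nat.cast_prod]
      exact Finset.prod_dvd_of_coprime hcop fun p hp =>
        hgd p hp x (Finset.mem_image_of_mem _ hx)
    · have h1 := abs_eval_le_of_support_subset hgN (hSA x hx1.1) (V := M.sqrt * A ^ n)
        fun m hm => by
          have h2 : |coeff m g| ≤ M.sqrt := Int.lt_add_one_iff.1 (by exact_mod_cast hgc m hm)
          have h3 : (A : ℤ) ^ m.degree ≤ A ^ n :=
            pow_le_pow_right₀ (by exact_mod_cast hA) (mem_degBox.1 hm).le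
          exact mul_le_mul h2 h3 (by positivity) (by positivity)
      refine h1.trans_lt ?_
      have h4 : (degBox n).card * A ^ n + 1 ≤ M.sqrt := Nat.le_sqrt'.2 hM
      have h5 : (degBox n).card * (M.sqrt * A ^ n) < M :=
        calc (degBox n).card * (M.sqrt * A ^ n)
            = M.sqrt * ((degBox n).card * A ^ n) := by ring
          _ < M.sqrt * M.sqrt := Nat.mul_lt_mul_of_pos_left (by omega) (by omega)
          _ ≤ M := Nat.sqrt_le M
      exact_mod_cast h5
  exact card_le_of_eval_map_eq_zero hF hd
    (not_map_dvd_of_totalDegree_lt hg0 (by omega)) hgdeg.le _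
    fun x hx => ⟨hS x (Finset.mem_filter.1 hx).1, hval x hx⟩

attribute [local instance] Matrix.normedAddCommGroup in
/-- A form of Siegel's lemma in which the number of equations does not matter: if a system of
homogeneous linear equations has a nontrivial solution, it has a small integral one. -/
theorem exists_int_ne_zero_sum_mul_eq_zero {ι β : Type*} [Fintype β] [Finite ι] (v : ι → β → ℤ)
    {B : ℕ} (hB : 0 < B) (hv : ∀ x m, |v x m| ≤ B) (c : β → ℚ) (hc : c ≠ 0)
    (hcv : ∀ x, ∑ m, (v x m : ℚ) * c m = 0) :
    ∃ t : β → ℤ, t ≠ 0 ∧ (∀ x, ∑ m, v x m * t m = 0) ∧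
      ∀ m, |t m| ≤ (Fintype.card β * B) ^ Fintype.card β := by
  classical
  let w : ι → β → ℚ := fun x m => v x m
  let φ : (β → ℚ) → (β → ℚ) →ₗ[ℚ] ℚ := fun t => Fintype.linearCombination ℚ t
  have hφ : ∀ t u, φ t u = ∑ m, u m * t m := fun t u => by
    simp [φ, Fintype.linearCombination_apply]
  obtain ⟨κ, a, ha, hspan, hli⟩ := exists_linearIndependent' ℚ w
  have := Finite.of_injective a ha
  have := Fintype.ofFinite κ
  obtain ⟨m₀, hm₀⟩ := Function.ne_iff.1 hc
  have hker : ∀ t, (∀ k, φ t (w (a k)) = 0) → ∀ x, φ t (w x) = 0 := by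
    intro t ht x
    have h1 : Submodule.span ℚ (Set.range (w ∘ a)) ≤ LinearMap.ker (φ t) :=
      Submodule.span_le.2 (Set.range_subset_iff.2 ht)
    rw [hspan] at h1
    exact h1 (Submodule.subset_span ⟨x, rfl⟩)
  have hcard : Fintype.card κ < Fintype.card β := by
    refine lt_of_le_of_ne (by simpa using hli.fintype_card_le_finrank) fun h => ?_
    have h1 := hli.span_eq_top_of_card_eq_finrank' (by simpa using h)
    have h2 : Submodule.span ℚ (Set.range (w ∘ a)) ≤ LinearMap.ker (φ c) :=
      Submodule.span_le.2 (Set.range_subset_iff.2 fun k => (hφ _ _).trans (hcv _))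
    rw [h1] at h2
    have h3 : φ c (Pi.single m₀ 1) = 0 := h2 (Submodule.mem_top)
    rw [hφ] at h3
    simp [Pi.single_apply] at h3
    exact hm₀ h3
  have hred : ∀ t : β → ℤ, (∀ k, ∑ m, v (a k) m * t m = 0) → ∀ x, ∑ m, v x m * t m = 0 := by
    intro t ht x
    have := hker (fun m => t m) (fun k => by
      rw [hφ]
      simp only [w]
      exact_mod_cast ht k) x
    rw [hφ] at this
    simp only [w] at this
    exact_mod_cast this
  have hβ : 0 < Fintype.card β := Fintype.card_pos_iff.2 ⟨m₀⟩
  have h1B : 1 ≤ Fintype.card β * B := Nat.mul_pos hβ hB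
  rcases Nat.eq_zero_or_pos (Fintype.card κ) with h0 | h0
  · have := Fintype.card_eq_zero_iff.1 h0
    refine ⟨Pi.single m₀ 1, by simp, hred _ fun k => isEmptyElim k, fun m => ?_⟩
    have : |(Pi.single m₀ 1 : β → ℤ) m| ≤ 1 := by
      rw [Pi.single_apply]
      split_ifs <;> simp
    exact this.trans (by exact_mod_cast Nat.one_le_pow _ _ h1B)
  · let M : Matrix κ β ℤ := Matrix.of fun k m => v (a k) m
    obtain ⟨t, ht0, htM, htn⟩ := Int.Matrix.exists_ne_zero_int_vec_norm_le M hcard h0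
    refine ⟨t, ht0, hred t fun k => congrFun htM k, fun m => ?_⟩
    have hM : max 1 ‖M‖ ≤ B := max_le (by exact_mod_cast hB)
      ((Matrix.norm_le_iff (Nat.cast_nonneg B)).2 fun k m => by
        rw [Int.norm_eq_abs]
        exact_mod_cast hv (a k) m)
    have h1 : ((Fintype.card κ : ℝ) / (Fintype.card β - Fintype.card κ)) ≤ Fintype.card β := by
      have h2 : (Fintype.card κ : ℝ) + 1 ≤ Fintype.card β := by exact_mod_cast hcard
      rw [div_le_iff₀ (by linarith)]
      nlinarith [Nat.cast_nonneg (α := ℝ) (Fintype.card κ)]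
    have h3 : ‖t m‖ ≤ ((Fintype.card β : ℝ) * B) ^ Fintype.card β :=
      calc ‖t m‖ ≤ ‖t‖ := norm_le_pi_norm t m
        _ ≤ _ := htn
        _ ≤ ((Fintype.card β : ℝ) * B) ^ ((Fintype.card κ : ℝ) /
              (Fintype.card β - Fintype.card κ)) := by
            refine Real.rpow_le_rpow (by positivity) ?_ ?_
            · gcongr
            · have h2 : (Fintype.card κ : ℝ) + 1 ≤ Fintype.card β := by exact_mod_cast hcard
              exact div_nonneg (by positivity) (by linarith)
        _ ≤ ((Fintype.card β : ℝ) * B) ^ (Fintype.card β : ℝ) :=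
            Real.rpow_le_rpow_of_exponent_le (by exact_mod_cast h1B) h1
        _ = _ := Real.rpow_natCast _ _
    rw [Int.norm_eq_abs] at h3
    exact_mod_cast h3

theorem associated_of_dvd_of_totalDegree_le {σ K : Type*} [Field K] {f g : MvPolynomial σ K}
    (hg : g ≠ 0) (h : f ∣ g) (hd : g.totalDegree ≤ f.totalDegree) : Associated f g := by
  obtain ⟨q, rfl⟩ := h
  rw [totalDegree_mul_of_isDomain (left_ne_zero_of_mul hg) (right_ne_zero_of_mul hg)] at hd
  have hq := totalDegree_eq_zero_iff_eq_C.1 (show q.totalDegree = 0 by omega)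
  have hq0 : coeff 0 q ≠ 0 := fun h0 => right_ne_zero_of_mul hg (by rw [hq, h0, C_0])
  refine associated_mul_unit_right f q ?_
  rw [hq]
  exact (isUnit_iff_ne_zero.2 hq0).map C

theorem eval_eq_sum_of_support_subset {σ R : Type*} [CommRing R] [Fintype σ]
    {g : MvPolynomial σ R} {N : Finset (σ →₀ ℕ)} (hN : g.support ⊆ N) (x : σ → R) :
    eval x g = ∑ m : N, (∏ i, x i ^ m.1 i) * coeff m.1 g := by
  rw [eval_eq', Finset.sum_coe_sort N fun m => (∏ i, x i ^ m i) * coeff m g]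
  refine (Finset.sum_subset hN fun m _ hm => ?_).trans
    (Finset.sum_congr rfl fun _ _ => mul_comm _ _)
  rw [notMem_support_iff.1 hm, zero_mul]

/-- An irreducible plane curve over `ℚ` either has few integral points in a box, or has a
primitive integral equation of controlled height. -/
theorem card_le_or_exists_primitive_equation {f : MvPolynomial (Fin 2) ℚ} (hf : Irreducible f)
    {d : ℕ} (hd : f.totalDegree = d) {A : ℕ} (hA : 0 < A) (S : Finset (Fin 2 → ℤ))
    (hS : ∀ x ∈ S, eval (fun i => (x i : ℚ)) f = 0) (hSA : ∀ x ∈ S, ∀ i, |x i| ≤ A) :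
    S.card ≤ d * d ∨ ∃ F : MvPolynomial (Fin 2) ℤ, (∀ p : ℕ, p.Prime → ¬ C (p : ℤ) ∣ F) ∧
      Irreducible (map (Int.castRingHom ℚ) F) ∧ F.totalDegree = d ∧ (∀ x ∈ S, eval x F = 0) ∧
      F.support ⊆ degBox (d + 1) ∧
      ∀ m, |coeff m F| ≤ ((degBox (d + 1)).card * A ^ d) ^ (degBox (d + 1)).card := by
  classical
  set N := degBox (d + 1) with hN
  have hfN : f.support ⊆ N := fun m hm => by
    rw [hN, mem_degBox, Nat.lt_succ_iff, ← hd]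
    exact le_totalDegree hm
  obtain ⟨t, ht0, htS, htb⟩ := exists_int_ne_zero_sum_mul_eq_zero (ι := S)
    (fun x (m : N) => ∏ i, x.1 i ^ m.1 i) (B := A ^ d) (pow_pos hA _) (fun x m => by
      rw [Finset.abs_prod]
      calc ∏ i, |x.1 i ^ m.1 i| ≤ ∏ i, (A : ℤ) ^ m.1 i :=
            Finset.prod_le_prod (fun i _ => abs_nonneg _) fun i _ => by
              rw [abs_pow]
              exact pow_le_pow_left₀ (abs_nonneg _) (hSA x x.2 i) _
        _ = (A : ℤ) ^ m.1.degree := by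
            rw [Finset.prod_pow_eq_pow_sum, Finsupp.degree_eq_sum]
        _ ≤ ((A ^ d : ℕ) : ℤ) := by
            rw [Nat.cast_pow]
            exact pow_le_pow_right₀ (by exact_mod_cast hA)
              (Nat.lt_succ_iff.1 (mem_degBox.1 m.2)))
    (fun m => coeff m.1 f) (by
      obtain ⟨m, hm⟩ := support_nonempty.2 hf.ne_zero
      exact Function.ne_iff.2 ⟨⟨m, hfN hm⟩, mem_support_iff.1 hm⟩) (fun x => by
      have := hS x x.2
      rw [eval_eq_sum_of_support_subset hfN] at this
      exact_mod_cast this)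
  obtain ⟨s, hs, hs1⟩ := Finset.extract_gcd t (s := Finset.univ) (by
    obtain ⟨m, _⟩ := Function.ne_iff.1 ht0
    exact ⟨m, Finset.mem_univ _⟩)
  set e := Finset.univ.gcd t with he
  have he0 : e ≠ 0 := fun h => ht0 (funext fun m => by
    rw [hs m (Finset.mem_univ _), h, zero_mul]
    rfl)
  set F := ofCoeffs N s with hF
  have hFN : F.support ⊆ N := support_ofCoeffs_subset _ _
  have hFS : ∀ x ∈ S, eval x F = 0 := fun x hx => by
    have h1 := htS ⟨x, hx⟩
    rw [eval_eq_sum_of_support_subset hFN]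
    refine mul_left_cancel₀ he0 ?_
    rw [mul_zero, ← h1, Finset.mul_sum]
    refine Finset.sum_congr rfl fun m _ => ?_
    rw [hF, coeff_ofCoeffs_of_mem, hs m (Finset.mem_univ _)]
    ring
  have hF0 : F ≠ 0 := fun h => ht0 (funext fun m => by
    have := coeff_ofCoeffs_of_mem N s m
    rw [← hF, h, coeff_zero] at this
    rw [hs m (Finset.mem_univ _), ← this, mul_zero]
    rfl)
  have hFQ0 : map (Int.castRingHom ℚ) F ≠ 0 := by
    rwa [Ne, map_eq_zero_iff _ (map_injective _ (RingHom.injective_int _))]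
  have hFd : F.totalDegree ≤ d := totalDegree_le_of_support_subset_degBox hFN
  by_cases hdvd : f ∣ map (Int.castRingHom ℚ) F
  · right
    have hass := associated_of_dvd_of_totalDegree_le hFQ0 hdvd
      (by rwa [totalDegree_map_intCast, hd])
    refine ⟨F, ?_, hass.irreducible hf, ?_, hFS, hFN, fun m => ?_⟩
    · intro p hp h
      rw [C_dvd_iff_dvd_coeff] at h
      have h1 : (p : ℤ) ∣ Finset.univ.gcd s := Finset.dvd_gcd fun m _ => by
        rw [← coeff_ofCoeffs_of_mem N s m]
        exact h m.1
      rw [hs1] at h1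
      exact hp.one_lt.ne' (by exact_mod_cast Int.eq_one_of_dvd_one (by positivity) h1)
    · refine hFd.antisymm ?_
      rw [← hd, ← totalDegree_map_intCast F]
      exact totalDegree_le_of_dvd_of_isDomain hdvd hFQ0
    · by_cases hm : m ∈ N
      · have h1 := htb ⟨m, hm⟩
        rw [hF, coeff_ofCoeffs_of_mem N s ⟨m, hm⟩]
        rw [hs _ (Finset.mem_univ _), abs_mul] at h1
        have h2 : 1 ≤ |e| := Int.one_le_abs he0
        have h3 : |s ⟨m, hm⟩| ≤ |e| * |s ⟨m, hm⟩| := le_mul_of_one_le_left (abs_nonneg _) h2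
        refine h3.trans (h1.trans (le_of_eq ?_))
        rw [Fintype.card_coe]
        push_cast
        rfl
      · rw [hF, coeff_ofCoeffs_of_notMem N s hm, abs_zero]
        positivity
  · left
    refine card_le_of_eval_intCast_eq_zero hf hd hdvd
      ((totalDegree_map_intCast F).trans_le hFd) S fun x hx => ⟨hS x hx, ?_⟩
    rw [eval_map_intCast, hFS x hx, Int.cast_zero]

theorem two_pow_le_mul_card_primesLE (r : ℕ) :
    2 ^ r ≤ r * ((Nat.primesLE (2 ^ r)).card + 1) + 1 := by
  have h1 : Nat.lcmUpto (2 ^ r) ≤ (2 ^ r) ^ (Nat.primesLE (2 ^ r)).card := by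
    rw [Nat.lcmUpto_eq_prod_pow_log]
    exact Finset.prod_le_pow_card _ _ _ fun p _ =>
      Nat.pow_log_le_self _ (pow_ne_zero _ two_ne_zero)
  have h2 := (Chebyshev.two_pow_le_mul_lcmUpto (2 ^ r)).trans (Nat.mul_le_mul_left _ h1)
  have h3 : 2 ^ r + 1 ≤ 2 ^ (r + 1) := by
    rw [pow_succ]
    have := Nat.one_le_two_pow (n := r)
    omega
  have h4 := h2.trans (Nat.mul_le_mul_right _ h3)
  rw [← pow_mul, ← pow_add] at h4
  have h5 := (Nat.pow_le_pow_iff_right (by norm_num)).1 h4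
  linarith

theorem exists_primes_card_eq {q t K : ℕ} (h : (q + t) * (K + 2 ^ q) + 1 < 2 ^ (q + t)) :
    ∃ P : Finset ℕ, P.card = K ∧ ∀ p ∈ P, p.Prime ∧ 2 ^ q < p ∧ p ≤ 2 ^ (q + t) := by
  have h1 := two_pow_le_mul_card_primesLE (q + t)
  set Q := Nat.primesLE (2 ^ (q + t)) with hQ
  have h2 : K + 2 ^ q ≤ Q.card := by
    by_contra! h3
    have : (q + t) * (Q.card + 1) ≤ (q + t) * (K + 2 ^ q) := Nat.mul_le_mul_left _ h3
    omega
  have h4 : K ≤ (Q \ Finset.Icc 1 (2 ^ q)).card := by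
    have := Finset.le_card_sdiff (Finset.Icc 1 (2 ^ q)) Q
    rw [Nat.card_Icc, Nat.add_sub_cancel] at this
    have := Nat.one_le_two_pow (n := q)
    omega
  obtain ⟨P, hP, hPK⟩ := Finset.exists_subset_card_eq h4
  refine ⟨P, hPK, fun p hp => ?_⟩
  have h5 := Finset.mem_sdiff.1 (hP hp)
  have h6 := Nat.mem_primesLE.1 h5.1
  refine ⟨h6.2, ?_, h6.1⟩
  by_contra! h7
  exact h5.2 (Finset.mem_Icc.2 ⟨h6.2.one_lt.le, h7⟩)

theorem exists_primes_card_eq_of_le_two_pow {q K z : ℕ} (hz : (q + 1) * (K + 2) ≤ 2 ^ z) :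
    ∃ P : Finset ℕ, P.card = K ∧
      ∀ p ∈ P, p.Prime ∧ 2 ^ q < p ∧ p ≤ 2 ^ (q + (2 * z + 2)) := by
  refine exists_primes_card_eq ?_
  have h1 : z < 2 ^ z := Nat.lt_two_pow_self
  have h2 : 1 ≤ 2 ^ q := Nat.one_le_two_pow
  have h3 : 2 ^ (q + (2 * z + 2)) = 2 ^ q * (4 * (2 ^ z * 2 ^ z)) := by ring
  rw [h3]
  generalize 2 ^ z = Z at *
  generalize 2 ^ q = X at *
  have h4 : K + X ≤ (K + 1) * X := by nlinarith
  have h5 : (q + 1) * (K + 1) < Z := by nlinarith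
  have h6 : K + 1 < Z := by nlinarith
  have h7 : (2 * z + 1) * (K + 1) ≤ 2 * Z * Z := Nat.mul_le_mul (by omega) h6.le
  have h8 : (q + (2 * z + 2)) * (K + 1) + 1 < 4 * (Z * Z) := by nlinarith
  calc (q + (2 * z + 2)) * (K + X) + 1 ≤ (q + (2 * z + 2)) * ((K + 1) * X) + X := by gcongr
    _ = X * ((q + (2 * z + 2)) * (K + 1) + 1) := by ring
    _ < X * (4 * (Z * Z)) := by gcongr

open scoped Classical in
theorem card_le_card_filter_forall_add_sum {α β : Type*} (S : Finset α) (P : Finset β)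
    (r : β → α → Prop) : S.card ≤
      (S.filter fun x => ∀ p ∈ P, ¬ r p x).card + ∑ p ∈ P, (S.filter (r p)).card := by
  have h : S ⊆ (S.filter fun x => ∀ p ∈ P, ¬ r p x) ∪ P.biUnion fun p => S.filter (r p) := by
    intro x hx
    by_cases h : ∀ p ∈ P, ¬ r p x
    · exact Finset.mem_union_left _ (Finset.mem_filter.2 ⟨hx, h⟩)
    · push Not at h
      obtain ⟨p, hp, hr⟩ := h
      exact Finset.mem_union_right _
        (Finset.mem_biUnion.2 ⟨p, hp, Finset.mem_filter.2 ⟨hx, hr⟩⟩)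
  exact (Finset.card_le_card h).trans ((Finset.card_union_le _ _).trans
    (Nat.add_le_add_left Finset.card_biUnion_le _))

theorem pderiv_translateVars {σ R : Type*} [CommRing R] (a : σ → R) (i : σ)
    (F : MvPolynomial σ R) : pderiv i (translateVars a F) = translateVars a (pderiv i F) := by
  classical
  induction F using MvPolynomial.induction_on with
  | C r => simp [translateVars]
  | add f g hf hg => simp only [map_add, hf, hg]
  | mul_X f j hf =>
    have h : pderiv i (translateVars a (X j)) = translateVars a (pderiv i (X j)) := by
      simp only [translateVars, aeval_X, map_add, pderiv_X, pderiv_C, add_zero]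
      rcases eq_or_ne j i with rfl | hji
      · simp
      · simp [hji]
    rw [map_mul, Derivation.leibniz, Derivation.leibniz, hf, h]
    simp only [smul_eq_mul, map_add, map_mul]

theorem coeff_single_translateVars {σ R : Type*} [CommRing R] (x : σ → R) (i : σ)
    (F : MvPolynomial σ R) :
    coeff (Finsupp.single i 1) (translateVars x F) = eval x (pderiv i F) := by
  have h := coeff_pderiv (i := i) (translateVars x F) 0
  have h0 : (fun _ => 0) + x = x := zero_add x
  rw [zero_add, Finsupp.coe_zero, Pi.zero_apply, Nat.cast_zero, zero_add, mul_one] at h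
  rw [← h, pderiv_translateVars, ← constantCoeff_eq, ← eval_zero', eval_translateVars, h0]

theorem dvd_eval_pderiv_of_not_hasOrderLE {σ : Type*} {p : ℕ} (hp : p.Prime)
    {F : MvPolynomial σ ℤ} {x : σ → ℤ} (h : ¬ HasOrderLE p 1 F x) (i : σ) :
    (p : ℤ) ∣ eval x (pderiv i F) := by
  unfold HasOrderLE at h
  push Not at h
  have h1 := h (Finsupp.single i 1)
  rw [Finsupp.degree_single, coeff_single_translateVars, pow_succ,
    mul_dvd_mul_iff_left (by exact_mod_cast pow_ne_zero 1 hp.ne_zero)] at h1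
  exact h1

theorem totalDegree_pderiv_lt {σ R : Type*} [CommRing R] {F : MvPolynomial σ R} {d : ℕ}
    (hd : F.totalDegree ≤ d) (hd0 : 0 < d) (i : σ) : (pderiv i F).totalDegree < d := by
  refine (Finset.sup_lt_iff (by exact hd0)).2 fun m hm => ?_
  have h1 : coeff (m + Finsupp.single i 1) F ≠ 0 := by
    intro h
    rw [mem_support_iff, coeff_pderiv, h, zero_mul] at hm
    exact hm rfl
  have h2 := (le_totalDegree (mem_support_iff.2 h1)).trans hd
  change (m + Finsupp.single i 1).degree ≤ d at h2
  change m.degree < d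
  rw [map_add, Finsupp.degree_single] at h2
  omega

theorem exists_pderiv_ne_zero {σ R : Type*} [CommRing R] [IsDomain R] [CharZero R]
    {F : MvPolynomial σ R} (hd : F.totalDegree ≠ 0) : ∃ i, pderiv i F ≠ 0 := by
  by_contra! h
  refine hd (Nat.le_zero.1 (Finset.sup_le fun m hm => ?_))
  have : m = 0 := by
    ext i
    by_contra hi
    have h1 := congrArg (coeff (m - Finsupp.single i 1)) (h i)
    have h2 : m - Finsupp.single i 1 + Finsupp.single i 1 = m :=
      tsub_add_cancel_of_le (Finsupp.single_le_iff.2 (Nat.one_le_iff_ne_zero.2 hi))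
    rw [coeff_pderiv, h2, coeff_zero] at h1
    exact (mul_ne_zero (mem_support_iff.1 hm) (Nat.cast_add_one_ne_zero _)) h1
  simp [this]

theorem card_degBox_succ_bounds {d : ℕ} (hd : 2 ≤ d) :
    (degBox (d + 1)).card + 1 ≤ 2 * d ^ 2 ∧ (degBox (d + 1)).card ≤ 2 ^ (2 * d) := by
  have h := two_mul_card_degBox (d + 1)
  have h1 : d + 1 ≤ 2 ^ d := Nat.lt_two_pow_self
  constructor
  · nlinarith
  · rw [mul_comm, pow_mul]
    nlinarith

/-- An upper bound for the partial derivatives of `F` at the integral points of a box. -/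
theorem abs_eval_pderiv_lt {F : MvPolynomial (Fin 2) ℤ} {d l : ℕ} (hd : 2 ≤ d) (hl : 1 ≤ l)
    (hF : F.totalDegree ≤ d)
    (hc : ∀ m, |coeff m F| ≤ ((degBox (d + 1)).card * (2 ^ l : ℕ) ^ d) ^ (degBox (d + 1)).card)
    {x : Fin 2 → ℤ} (hx : ∀ i, |x i| ≤ (2 ^ l : ℕ)) (i : Fin 2) :
    |eval x (pderiv i F)| < 2 ^ (8 * d ^ 3 * (l + 1)) := by
  obtain ⟨h1, h2⟩ := card_degBox_succ_bounds hd
  set h := (degBox (d + 1)).card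
  have hN : (pderiv i F).support ⊆ degBox (d + 1) := fun m hm => by
    have := (le_totalDegree hm).trans_lt (totalDegree_pderiv_lt hF (by omega) i)
    change m.degree < d at this
    exact mem_degBox.2 (by omega)
  have h3 := abs_eval_le_of_support_subset hN hx
    (V := ((h * (2 ^ l) ^ d) ^ h * (d + 1) * (2 ^ l) ^ d)) fun m hm => by
      rw [coeff_pderiv, abs_mul]
      have hm1 := mem_degBox.1 hm
      have hm2 : m i ≤ m.degree := Finsupp.le_degree i m
      have hm3 : |((m i : ℤ) + 1)| ≤ d + 1 := by
        rw [abs_of_nonneg (by positivity)]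
        exact_mod_cast (by omega : m i + 1 ≤ d + 1)
      push_cast at hc ⊢
      gcongr
      · exact hc _
      · exact one_le_pow₀ (by norm_num)
      · omega
  refine h3.trans_lt ?_
  have h4 : d + 1 ≤ 2 ^ d := Nat.lt_two_pow_self
  have h5 : h * ((h * (2 ^ l) ^ d) ^ h * (d + 1) * (2 ^ l) ^ d) < 2 ^ (8 * d ^ 3 * (l + 1)) :=
    calc h * ((h * (2 ^ l) ^ d) ^ h * (d + 1) * (2 ^ l) ^ d)
        ≤ 2 ^ (2 * d) * ((2 ^ (2 * d) * (2 ^ l) ^ d) ^ h * 2 ^ d * (2 ^ l) ^ d) := by gcongr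
      _ = 2 ^ ((2 * d + l * d) * h + (3 * d + l * d)) := by
          rw [← pow_mul, ← pow_add, ← pow_mul, ← pow_add, ← pow_add, ← pow_add]
          congr 1
          ring
      _ < 2 ^ (8 * d ^ 3 * (l + 1)) := by
          refine Nat.pow_lt_pow_right (by norm_num) ?_
          calc (2 * d + l * d) * h + (3 * d + l * d) ≤ (3 * d + l * d) * (h + 1) := by nlinarith
            _ ≤ (3 * d + l * d) * (2 * d ^ 2) := Nat.mul_le_mul_left _ h1
            _ = 2 * d ^ 3 * (l + 3) := by ring
            _ < 2 * d ^ 3 * (4 * (l + 1)) := by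
                refine Nat.mul_lt_mul_of_pos_left (by omega) (by positivity)
            _ = _ := by ring
  exact_mod_cast h5

theorem weight_lt_pow_of_small_degree {d L p q : ℕ} (hd : 2 ≤ d) (hL : 2 ≤ L) (hq : q = L / d + 1)
    (hp : 2 ^ q < p) :
    4 * (d * (1 * (16 * d * L))) ^ 2 * (2 ^ L) ^ (1 * (16 * d * L) + 2 * d) * p <
      p ^ (d * (16 * d * L)) := by
  have h1 : L + 1 ≤ d * q := by
    rw [hq]
    have := Nat.div_add_mod L d
    have := Nat.mod_lt L (by omega : 0 < d)
    nlinarith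
  have hqL : q ≤ L + 1 := by
    rw [hq]
    have := Nat.div_le_self L d
    omega
  have h2 : d * (16 * d * L) = (d * (16 * d * L) - 1) + 1 :=
    (Nat.sub_add_cancel (by nlinarith [Nat.mul_le_mul hd (Nat.mul_le_mul hd hL)])).symm
  set n := d * (16 * d * L) - 1
  have hdl : d ≤ 2 ^ d := Nat.lt_two_pow_self.le
  have hll : L ≤ 2 ^ L := Nat.lt_two_pow_self.le
  rw [h2, pow_succ p]
  refine Nat.mul_lt_mul_of_pos_right ?_ (Nat.zero_lt_of_lt hp)
  calc 4 * (d * (1 * (16 * d * L))) ^ 2 * (2 ^ L) ^ (1 * (16 * d * L) + 2 * d)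
      = 2 ^ 10 * d ^ 4 * L ^ 2 * (2 ^ L) ^ (1 * (16 * d * L) + 2 * d) := by ring
    _ ≤ 2 ^ 10 * (2 ^ d) ^ 4 * (2 ^ L) ^ 2 * (2 ^ L) ^ (1 * (16 * d * L) + 2 * d) := by gcongr
    _ = 2 ^ (10 + 4 * d + 2 * L + L * (16 * d * L + 2 * d)) := by
        ring
    _ < 2 ^ (q * n) := by
        refine Nat.pow_lt_pow_right (by norm_num) ?_
        have h3 : q * n + q = (d * q) * (16 * d * L) := by
          rw [← Nat.mul_succ, ← Nat.add_one, ← h2]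
          ring
        have h4 : (L + 1) * (16 * d * L) ≤ (d * q) * (16 * d * L) := Nat.mul_le_mul_right _ h1
        have h5 : 4 ≤ d * L := Nat.mul_le_mul hd hL
        nlinarith
    _ = (2 ^ q) ^ n := pow_mul _ _ _
    _ ≤ p ^ n := Nat.pow_le_pow_left hp.le _

theorem abs_sub_le_two_pow_succ {l : ℕ} {a b : ℤ} (ha : |a| ≤ (2 ^ l : ℕ))
    (hb : |b| ≤ (2 ^ l : ℕ)) :
    |a - b| ≤ (2 ^ (l + 1) : ℕ) := by
  have := abs_sub a b
  push_cast at *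
  rw [pow_succ]
  linarith

theorem card_le_of_small_degree {F : MvPolynomial (Fin 2) ℤ} {d l : ℕ} (hd : 2 ≤ d) (hl : 1 ≤ l)
    (hF : Irreducible (map (Int.castRingHom ℚ) F)) (hFp : ∀ p : ℕ, p.Prime → ¬ C (p : ℤ) ∣ F)
    (hFd : F.totalDegree = d)
    (hc : ∀ m, |coeff m F| ≤ ((degBox (d + 1)).card * (2 ^ l : ℕ) ^ d) ^ (degBox (d + 1)).card)
    (S : Finset (Fin 2 → ℤ)) (hS : ∀ x ∈ S, eval x F = 0)
    (hSA : ∀ x ∈ S, ∀ i, |x i| ≤ (2 ^ l : ℕ)) :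
    S.card ≤ 1500000 * d ^ 12 * (l + 1) ^ 6 * 2 ^ ((l + 1) / d) := by
  classical
  set L := l + 1 with hL
  set q := L / d + 1 with hq
  set K := 8 * d ^ 3 * L with hK
  set z := Nat.clog 2 ((q + 1) * (K + 2)) with hz
  obtain ⟨P, hPK, hP⟩ := exists_primes_card_eq_of_le_two_pow (q := q) (K := K) (z := z)
    (Nat.le_pow_clog (by norm_num) _)
  have h1 := card_le_card_filter_forall_add_sum S P fun p => HasOrderLE p 1 F
  have hcop : (P : Set ℕ).Pairwise (Function.onFun IsCoprime fun p : ℕ => (p : ℤ)) :=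
    fun p hp q hq hpq =>
      Nat.isCoprime_iff_coprime.2 ((Nat.coprime_primes (hP p hp).1 (hP q hq).1).2 hpq)
  have hKP : 2 ^ K ≤ ∏ p ∈ P, p := by
    rw [← hPK, ← Finset.prod_const]
    exact Finset.prod_le_prod' fun p hp => (hP p hp).1.two_le
  have hbad : ∀ x ∈ S.filter (fun x => ∀ p ∈ P, ¬ HasOrderLE p 1 F x), ∀ i,
      eval x (pderiv i F) = 0 := by
    intro x hx i
    have hx1 := Finset.mem_filter.1 hx
    refine Int.eq_zero_of_abs_lt_dvd (m := ((∏ p ∈ P, p : ℕ) : ℤ)) ?_ ?_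
    · rw [Nat.cast_prod]
      exact Finset.prod_dvd_of_coprime hcop fun p hp =>
        dvd_eval_pderiv_of_not_hasOrderLE (hP p hp).1 (hx1.2 p hp) i
    · refine (abs_eval_pderiv_lt hd hl hFd.le hc (hSA x hx1.1) i).trans_le ?_
      exact_mod_cast hKP
  have h2 : (S.filter fun x => ∀ p ∈ P, ¬ HasOrderLE p 1 F x).card ≤ d * d := by
    obtain ⟨i, hi⟩ := exists_pderiv_ne_zero (F := F) (by omega)
    have hlt := totalDegree_pderiv_lt hFd.le (by omega) i
    exact card_le_of_eval_map_eq_zero hF hFd (not_map_dvd_of_totalDegree_lt hi (by omega)) hlt.le _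
      fun x hx => ⟨hS x (Finset.mem_filter.1 hx).1, hbad x hx i⟩
  have h3 : ∀ p ∈ P, (S.filter (HasOrderLE p 1 F)).card ≤
      d * (d + 1 * (16 * d * L)) * (d * 2 ^ (q + (2 * z + 2))) := fun p hp => by
    obtain ⟨hp1, hp2, hp3⟩ := hP p hp
    refine (card_filter_hasOrderLE_le (A := 2 ^ L) (e := 16 * d * L) hF hFd (by omega) hp1 one_pos
      (by positivity) (by positivity) (weight_lt_pow_of_small_degree hd (by omega) hq hp2) S hS
      fun x hx y hy i => abs_sub_le_two_pow_succ (hSA x hx i) (hSA y hy i)).trans ?_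
    exact Nat.mul_le_mul_left _ ((card_image_reducePoint_le hp1 (hFp p hp1) hFd.le S hS).trans
      (Nat.mul_le_mul_left _ hp3))
  have h4 := h1.trans (Nat.add_le_add h2 (Finset.sum_le_card_nsmul _ _ _ h3))
  rw [hPK, smul_eq_mul] at h4
  have h5 : 2 ^ z ≤ 2 * (18 * d ^ 3 * L ^ 2) := by
    have h6 : 1 < (q + 1) * (K + 2) := by nlinarith
    have h7 : 2 ^ z < 2 * ((q + 1) * (K + 2)) := by
      have := Nat.pow_pred_clog_lt_self (b := 2) (by norm_num) h6
      have h8 : 0 < z := Nat.clog_pos (by norm_num) h6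
      rw [← hz] at this
      obtain ⟨y, hy⟩ := Nat.exists_eq_succ_of_ne_zero h8.ne'
      rw [hy, Nat.pred_succ] at this
      rw [hy, Nat.pow_succ]
      omega
    have h9 : q + 1 ≤ 2 * L := by
      have := Nat.div_le_self L d
      omega
    have h10 : K + 2 ≤ 9 * d ^ 3 * L := by
      have : 2 ≤ d ^ 3 * L := by
        have : 1 ≤ d ^ 3 := Nat.one_le_pow _ _ (by omega)
        nlinarith
      rw [hK]
      linarith
    have := Nat.mul_le_mul h9 h10
    refine h7.le.trans (Nat.mul_le_mul_left _ (this.trans (le_of_eq ?_)))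
    ring
  refine h4.trans ?_
  have hL2 : 1 ≤ L := by omega
  have hd1 : 1 ≤ d := by omega
  calc d * d + K * (d * (d + 1 * (16 * d * L)) * (d * 2 ^ (q + (2 * z + 2))))
      ≤ d * d + K * (d * (d * L + 1 * (16 * d * L)) * (d * 2 ^ (q + (2 * z + 2)))) := by
        gcongr
        exact Nat.le_mul_of_pos_right _ hL2
    _ = d ^ 2 * 1 * 1 + 1088 * d ^ 6 * L ^ 2 * (2 ^ z) ^ 2 * 2 ^ (L / d) := by
        rw [hK, hq]
        ring
    _ ≤ d ^ 2 * (d ^ 10 * L ^ 6) * 2 ^ (L / d) +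
          1088 * d ^ 6 * L ^ 2 * (2 * (18 * d ^ 3 * L ^ 2)) ^ 2 * 2 ^ (L / d) := by
        gcongr
        · exact Nat.mul_pos (by positivity) (by positivity)
        · exact Nat.one_le_two_pow
    _ = 1410049 * (d ^ 12 * L ^ 6 * 2 ^ (L / d)) := by ring
    _ ≤ 1500000 * (d ^ 12 * L ^ 6 * 2 ^ (L / d)) := by gcongr; norm_num
    _ = _ := by ring

theorem weight_lt_pow_of_large_degree {d L p e w : ℕ} (hd : 3 ≤ d) (hL : 2 ≤ L)
    (he : e = 16 * L) (hw : w ≤ 8 * d) (hp : p.Prime) (hpd : p ≤ 2 ^ d) :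
    4 * (d * w) ^ 2 * (2 ^ L) ^ (w + 2 * d) * p < p ^ (d * e) := by
  have hdl : d ≤ 2 ^ d := Nat.lt_two_pow_self.le
  calc 4 * (d * w) ^ 2 * (2 ^ L) ^ (w + 2 * d) * p
      ≤ 4 * (2 ^ d * (8 * 2 ^ d)) ^ 2 * (2 ^ L) ^ (8 * d + 2 * d) * 2 ^ d := by
        gcongr
        · exact hw.trans (Nat.mul_le_mul_left _ hdl)
        · exact Nat.one_le_two_pow
    _ = 2 ^ (8 + 5 * d + L * (10 * d)) := by
        have : (2 ^ d * (8 * 2 ^ d)) ^ 2 = 2 ^ (6 + 4 * d) := by ring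
        rw [this]
        ring
    _ < 2 ^ (d * (16 * L)) := by
        refine Nat.pow_lt_pow_right (by norm_num) ?_
        nlinarith
    _ ≤ p ^ (d * (16 * L)) := Nat.pow_le_pow_left hp.two_le _
    _ = _ := by rw [he]

theorem card_primesLE_ge {L z : ℕ} (hL : 1 ≤ L) (hz : 16 * L ≤ 2 ^ z) :
    9 * L ^ 2 * 2 ^ (3 * z) ≤ (Nat.primesLE (2 ^ (2 * (3 * z)))).card := by
  have h := two_pow_le_mul_card_primesLE (2 * (3 * z))
  by_contra! h1
  have h2 : 2 ^ (2 * (3 * z)) = 2 ^ (3 * z) * 2 ^ (3 * z) := by ring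
  have h3 : 2 ^ (3 * z) = 2 ^ z * (2 ^ z * 2 ^ z) := by ring
  have hzz : z < 2 ^ z := Nat.lt_two_pow_self
  have h4 : 2 * (3 * z) * ((Nat.primesLE (2 ^ (2 * (3 * z)))).card + 1) ≤
      2 * (3 * z) * (9 * L ^ 2 * 2 ^ (3 * z)) := Nat.mul_le_mul_left _ h1
  have h5 : 54 * (z * L ^ 2) + 1 < 2 ^ (3 * z) := by
    have h6 : 256 * L ^ 2 ≤ 2 ^ z * 2 ^ z := by nlinarith
    have h7 : (z + 1) * (256 * L ^ 2) ≤ 2 ^ z * (2 ^ z * 2 ^ z) := Nat.mul_le_mul hzz h6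
    rw [h3]
    nlinarith
  have h8 : 1 ≤ 2 ^ (3 * z) := Nat.one_le_two_pow
  have h9 : 2 ^ (3 * z) * 2 ^ (3 * z) ≤ (54 * (z * L ^ 2) + 1) * 2 ^ (3 * z) := by
    rw [← h2]
    refine h.trans ((Nat.add_le_add_right h4 1).trans ?_)
    rw [add_mul, one_mul]
    refine Nat.add_le_add (le_of_eq (by ring)) h8
  exact absurd (Nat.le_of_mul_le_mul_right h9 h8) (not_le.2 h5)

theorem exists_finset_primes_le_card {L : ℕ} (hL : 2 ≤ L) :
    ∃ (Y : ℕ) (P : Finset ℕ), 1 ≤ Y ∧ Y ≤ 32768 * L ^ 3 ∧ 9 * L ^ 2 * Y ≤ P.card ∧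
      (∀ p ∈ P, p.Prime ∧ p ≤ Y ^ 2) ∧ P.card ≤ Y ^ 2 := by
  set z := Nat.clog 2 (16 * L) with hz
  have hz1 : 16 * L ≤ 2 ^ z := Nat.le_pow_clog (by norm_num) _
  have hz2 : 2 ^ z ≤ 32 * L := by
    have h6 : 1 < 16 * L := by omega
    have := Nat.pow_pred_clog_lt_self (b := 2) (by norm_num) h6
    have h8 : 0 < z := Nat.clog_pos (by norm_num) h6
    rw [← hz] at this
    obtain ⟨y, hy⟩ := Nat.exists_eq_succ_of_ne_zero h8.ne'
    rw [hy, Nat.pred_succ] at this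
    rw [hy, Nat.pow_succ]
    omega
  have hYY : 2 ^ (2 * (3 * z)) = (2 ^ (3 * z)) ^ 2 := by ring
  have hP : ∀ p ∈ Nat.primesLE (2 ^ (2 * (3 * z))), p.Prime ∧ p ≤ (2 ^ (3 * z)) ^ 2 :=
    fun p hp => by
      have := Nat.mem_primesLE.1 hp
      rw [hYY] at this
      exact this.symm
  refine ⟨2 ^ (3 * z), Nat.primesLE (2 ^ (2 * (3 * z))), Nat.one_le_two_pow, ?_,
    card_primesLE_ge (by omega) hz1, hP, ?_⟩
  · calc 2 ^ (3 * z) = (2 ^ z) ^ 3 := by ring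
      _ ≤ (32 * L) ^ 3 := Nat.pow_le_pow_left hz2 3
      _ = _ := by ring
  · have h4 : Nat.primesLE (2 ^ (2 * (3 * z))) ⊆ Finset.Icc 1 ((2 ^ (3 * z)) ^ 2) := fun p hp =>
      Finset.mem_Icc.2 ⟨(hP p hp).1.one_lt.le, (hP p hp).2⟩
    simpa using Finset.card_le_card h4

theorem card_le_of_large_degree {F : MvPolynomial (Fin 2) ℤ} {d l : ℕ} (hl : 1 ≤ l)
    (hd : 98304 * (l + 1) ^ 4 ≤ d)
    (hF : Irreducible (map (Int.castRingHom ℚ) F)) (hFp : ∀ p : ℕ, p.Prime → ¬ C (p : ℤ) ∣ F)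
    (hFd : F.totalDegree = d) (S : Finset (Fin 2 → ℤ)) (hS : ∀ x ∈ S, eval x F = 0)
    (hSA : ∀ x ∈ S, ∀ i, |x i| ≤ (2 ^ l : ℕ)) :
    S.card ≤ 10 * 2 ^ 90 * d ^ 2 * (l + 1) ^ 18 := by
  classical
  set L := l + 1 with hL
  have hL2 : 2 ≤ L := by omega
  obtain ⟨Y, P, hY1, hYL, hYn, hP, hPc⟩ := exists_finset_primes_le_card hL2
  set n := 3 * L * Y with hn
  have hnd : n ≤ d := by
    refine le_trans ?_ hd
    rw [hn]
    calc 3 * L * Y ≤ 3 * L * (32768 * L ^ 3) := Nat.mul_le_mul_left _ hYL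
      _ = _ := by ring
  set ν := d / (2 * L) with hν
  have hdν := Nat.div_add_mod d (2 * L)
  have hdm := Nat.mod_lt d (by omega : 0 < 2 * L)
  rw [← hν] at hdν
  have hw : ν * (16 * L) ≤ 8 * d :=
    calc ν * (16 * L) = 8 * (2 * L * ν) := by ring
      _ ≤ 8 * d := Nat.mul_le_mul_left _ (by omega)
  have hn2 : 2 * L ≤ n := by rw [hn]; nlinarith
  have hν0 : 0 < ν := Nat.div_pos (hn2.trans hnd) (by omega)
  have hYd : Y ^ 2 ≤ 2 ^ d := by
    calc Y ^ 2 ≤ (2 ^ Y) ^ 2 := Nat.pow_le_pow_left Nat.lt_two_pow_self.le 2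
      _ = 2 ^ (Y * 2) := (pow_mul _ _ _).symm
      _ ≤ 2 ^ d := Nat.pow_le_pow_right (by norm_num) (le_trans (by rw [hn]; nlinarith) hnd)
  have h1 := card_le_card_filter_forall_add_sum S P fun p => HasOrderLE p ν F
  have hcard := two_mul_card_degBox n
  have h2 : (S.filter fun x => ∀ p ∈ P, ¬ HasOrderLE p ν F x).card ≤ d * n := by
    refine card_filter_forall_not_hasOrderLE_le (τ := 2 * L * Y ^ 2) (A := 2 ^ l) hF hFd P
      (fun p hp => (hP p hp).1) (fun p hp => hFp p (hP p hp).1) (by positivity) (fun p hp => ?_)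
      hnd ?_ ?_ S hS hSA
    · calc d * p ≤ ((ν + 1) * (2 * L)) * Y ^ 2 := Nat.mul_le_mul (by linarith) (hP p hp).2
        _ = _ := by ring
    · have : n * n = 9 * L ^ 2 * Y ^ 2 := by rw [hn]; ring
      have h3 : 1 ≤ Y ^ 2 := Nat.one_le_pow _ _ hY1
      have h4 : 2 * L * (L * Y ^ 2) ≥ 2 * 2 * (L * Y ^ 2) := by gcongr
      nlinarith
    · have h3 : (degBox n).card * (2 ^ l) ^ n + 1 ≤ 2 ^ (n * (l + 2)) := by
        have h4 : n + 1 ≤ 2 ^ n := Nat.lt_two_pow_self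
        have h5 : 1 ≤ (degBox n).card := by nlinarith
        have h6 : 2 * (degBox n).card ≤ 2 ^ n * 2 ^ n := by
          rw [hcard]
          exact Nat.mul_le_mul (by omega) h4
        have h7 : 1 ≤ (2 ^ l) ^ n := Nat.one_le_pow _ _ (by positivity)
        calc (degBox n).card * (2 ^ l) ^ n + 1 ≤ 2 * (degBox n).card * (2 ^ l) ^ n := by nlinarith
          _ ≤ 2 ^ n * 2 ^ n * (2 ^ l) ^ n := Nat.mul_le_mul_right _ h6
          _ = _ := by ring
      calc ((degBox n).card * (2 ^ l) ^ n + 1) ^ 2 ≤ (2 ^ (n * (l + 2))) ^ 2 :=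
            Nat.pow_le_pow_left h3 2
        _ = 2 ^ (n * (l + 2) * 2) := (pow_mul _ _ _).symm
        _ ≤ 2 ^ P.card := by
            refine Nat.pow_le_pow_right (by norm_num)
              (le_trans ?_ hYn)
            rw [hn]
            calc 3 * L * Y * (l + 2) * 2 = 3 * L * Y * (2 * (l + 2)) := by ring
              _ ≤ 3 * L * Y * (3 * L) := Nat.mul_le_mul_left _ (by omega)
              _ = _ := by ring
        _ ≤ ∏ p ∈ P, p := by
            rw [← Finset.prod_const]
            exact Finset.prod_le_prod' fun p hp => (hP p hp).1.two_le
  have h3 : ∀ p ∈ P, (S.filter (HasOrderLE p ν F)).card ≤ 9 * d ^ 2 * (Y ^ 2) ^ 2 := by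
    intro p hp
    obtain ⟨hp1, hp2⟩ := hP p hp
    refine (card_filter_hasOrderLE_le (A := 2 ^ L) (e := 16 * L) hF hFd (by omega) hp1 hν0
      (by positivity) (by positivity)
      (weight_lt_pow_of_large_degree (by omega) hL2 rfl hw hp1 (hp2.trans hYd)) S hS
      fun x hx y hy i => abs_sub_le_two_pow_succ (hSA x hx i) (hSA y hy i)).trans ?_
    have h4 : d * (d + ν * (16 * L)) ≤ 9 * d ^ 2 :=
      (Nat.mul_le_mul_left d (show d + ν * (16 * L) ≤ 9 * d by omega)).trans (le_of_eq (by ring))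
    exact Nat.mul_le_mul h4 ((card_image_reducePoint_le_sq hp1 S).trans
      (Nat.pow_le_pow_left hp2 2))
  have h4 := h1.trans (Nat.add_le_add h2 (Finset.sum_le_card_nsmul _ _ _ h3))
  rw [smul_eq_mul] at h4
  calc S.card ≤ d * n + P.card * (9 * d ^ 2 * (Y ^ 2) ^ 2) := h4
    _ ≤ d * d + Y ^ 2 * (9 * d ^ 2 * (Y ^ 2) ^ 2) := by gcongr
    _ = d ^ 2 * 1 + 9 * d ^ 2 * Y ^ 6 := by ring
    _ ≤ d ^ 2 * Y ^ 6 + 9 * d ^ 2 * Y ^ 6 := by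
        gcongr
        exact Nat.one_le_pow _ _ hY1
    _ = 10 * d ^ 2 * Y ^ 6 := by ring
    _ ≤ 10 * d ^ 2 * (32768 * L ^ 3) ^ 6 := by gcongr
    _ = _ := by ring

/-- The counting bound for the integral points of a plane curve in a box of dyadic size. -/
theorem card_le_of_dyadic_box {f : MvPolynomial (Fin 2) ℚ} (hf : Irreducible f) {d l : ℕ}
    (hfd : f.totalDegree = d) (hd : 2 ≤ d) (hl : 1 ≤ l) (S : Finset (Fin 2 → ℤ))
    (hS : ∀ x ∈ S, eval (fun i => (x i : ℚ)) f = 0) (hSA : ∀ x ∈ S, ∀ i, |x i| ≤ (2 ^ l : ℕ)) :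
    S.card ≤ 1500000 * 98304 ^ 10 * d ^ 2 * (l + 1) ^ 46 * 2 ^ ((l + 1) / d) := by
  have hT : 1 ≤ 2 ^ ((l + 1) / d) := Nat.one_le_two_pow
  generalize hX : 2 ^ ((l + 1) / d) = X at *
  rcases card_le_or_exists_primitive_equation hf hfd (A := 2 ^ l) (by positivity) S hS hSA with
    h | ⟨F, hFp, hF, hFd, hFS, -, hFc⟩
  · calc S.card ≤ 1 * d ^ 2 * 1 * 1 := by linarith
      _ ≤ _ := by
        gcongr
        · norm_num
        · exact Nat.one_le_pow _ _ (by omega)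
  · rcases le_total (98304 * (l + 1) ^ 4) d with h | h
    · calc S.card ≤ 10 * 2 ^ 90 * d ^ 2 * (l + 1) ^ 18 * 1 := by
            rw [mul_one]
            exact card_le_of_large_degree hl h hF hFp hFd S hFS hSA
        _ ≤ _ := Nat.mul_le_mul (Nat.mul_le_mul (Nat.mul_le_mul_right _ (by norm_num))
          (Nat.pow_le_pow_right (by omega) (by norm_num))) hT
    · calc S.card ≤ 1500000 * d ^ 12 * (l + 1) ^ 6 * X := by
            rw [← hX]
            exact card_le_of_small_degree hd hl hF hFp hFd hFc S hFS hSA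
        _ = 1500000 * d ^ 10 * d ^ 2 * (l + 1) ^ 6 * X := by ring
        _ ≤ 1500000 * (98304 * (l + 1) ^ 4) ^ 10 * d ^ 2 * (l + 1) ^ 6 * X := by gcongr
        _ = _ := by ring

theorem exists_nat_two_pow_near {H : ℝ} (hH : 2 < H) :
    ∃ l : ℕ, 1 ≤ l ∧ H ≤ 2 ^ l ∧ (2 : ℝ) ^ (l + 1) ≤ 4 * H ∧ (l + 1 : ℝ) ≤ 5 * Real.log H := by
  have h0 : 0 < H := by linarith
  have h1 : 1 < Real.logb 2 H := by
    rw [Real.lt_logb_iff_rpow_lt (by norm_num) h0]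
    simpa using hH
  set l := ⌈Real.logb 2 H⌉₊ with hl
  have h2 : Real.logb 2 H ≤ l := Nat.le_ceil _
  have h3 : (l : ℝ) < Real.logb 2 H + 1 := Nat.ceil_lt_add_one (by linarith)
  have h4 : (2 : ℝ) ^ Real.logb 2 H = H := Real.rpow_logb (by norm_num) (by norm_num) h0
  refine ⟨l, ?_, ?_, ?_, ?_⟩
  · have : (1 : ℝ) < l := h1.trans_le h2
    exact_mod_cast this.le
  · calc H = 2 ^ Real.logb 2 H := h4.symm
      _ ≤ 2 ^ (l : ℝ) := Real.rpow_le_rpow_of_exponent_le (by norm_num) h2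
      _ = 2 ^ l := Real.rpow_natCast 2 l
  · have h5 : (2 : ℝ) ^ (l : ℝ) ≤ 2 ^ (Real.logb 2 H + 1) :=
      Real.rpow_le_rpow_of_exponent_le (by norm_num) h3.le
    rw [Real.rpow_add (by norm_num), h4, Real.rpow_one, Real.rpow_natCast] at h5
    rw [pow_succ]
    linarith
  · have h6 : Real.logb 2 H * Real.log 2 = Real.log H := by
      rw [Real.logb, div_mul_cancel₀]
      exact (Real.log_pos (by norm_num)).ne'
    nlinarith [Real.log_two_gt_d9]

theorem two_pow_div_le {H : ℝ} (hH : 0 < H) {L d : ℕ} (hd : 0 < d) (h : (2 : ℝ) ^ L ≤ 4 * H) :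
    (2 : ℝ) ^ (L / d) ≤ 4 * H ^ ((1 : ℝ) / d) := by
  have hd' : (1 : ℝ) ≤ d := by exact_mod_cast hd
  calc (2 : ℝ) ^ (L / d) = ((2 : ℝ) ^ (L / d * d)) ^ ((1 : ℝ) / d) := by
        rw [pow_mul, one_div, Real.pow_rpow_inv_natCast (by positivity) hd.ne']
    _ ≤ (4 * H) ^ ((1 : ℝ) / d) := by
        refine Real.rpow_le_rpow (by positivity) (le_trans ?_ h) (by positivity)
        exact pow_le_pow_right₀ (by norm_num) (Nat.div_mul_le_self _ _)
    _ = 4 ^ ((1 : ℝ) / d) * H ^ ((1 : ℝ) / d) := Real.mul_rpow (by norm_num) hH.le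
    _ ≤ 4 * H ^ ((1 : ℝ) / d) := by
        refine mul_le_mul_of_nonneg_right ?_ (by positivity)
        calc (4 : ℝ) ^ ((1 : ℝ) / d) ≤ 4 ^ (1 : ℝ) :=
              Real.rpow_le_rpow_of_exponent_le (by norm_num) (by
                rw [div_le_one (by linarith)]
                exact hd')
          _ = 4 := Real.rpow_one 4

/-- There are an absolute constant `c` and an absolute constant `κ` such that
for every integer `d > 1`, every irreducible `f ∈ ℚ[x₁,x₂]` of degree `d`
defining the affine plane curve `C ⊆ 𝔸²_ℚ`, and every real `H > 2`, one has
`#C(ℤ,H) ≤ c·d²·H^(1/d)·(log H)^κ`. -/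
theorem statement11 :
    ∃ c : ℝ, ∃ κ : ℕ, ∀ (d : ℕ), 1 < d →
      ∀ f : MvPolynomial (Fin 2) ℚ, Irreducible f → f.totalDegree = d →
      ∀ H : ℝ, 2 < H →
      (Nat.card {x : Fin 2 → ℤ //
          (∀ i, |(x i : ℝ)| ≤ H) ∧ eval (fun i => (x i : ℚ)) f = 0} : ℝ)
        ≤ c * (d : ℝ) ^ 2 * H ^ ((1 : ℝ) / (d : ℝ)) * Real.log H ^ κ := by
  classical
  refine ⟨1500000 * 98304 ^ 10 * 4 * 5 ^ 46, 46, fun d hd f hf hfd H hH => ?_⟩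
  obtain ⟨l, hl, hHl, hlH, hlog⟩ := exists_nat_two_pow_near hH
  set B : Finset (Fin 2 → ℤ) :=
    Fintype.piFinset fun _ => Finset.Icc (-((2 ^ l : ℕ) : ℤ)) ((2 ^ l : ℕ) : ℤ) with hB
  set S := B.filter fun x => eval (fun i => (x i : ℚ)) f = 0 with hS
  have hcard : Nat.card {x : Fin 2 → ℤ //
      (∀ i, |(x i : ℝ)| ≤ H) ∧ eval (fun i => (x i : ℚ)) f = 0} ≤ S.card := by
    have hsub : {x : Fin 2 → ℤ | (∀ i, |(x i : ℝ)| ≤ H) ∧ eval (fun i => (x i : ℚ)) f = 0} ⊆ S := by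
      intro x hx
      refine Finset.mem_coe.2 (Finset.mem_filter.2 ⟨Fintype.mem_piFinset.2 fun i => ?_, hx.2⟩)
      rw [Finset.mem_Icc, ← abs_le]
      have := (hx.1 i).trans hHl
      exact_mod_cast this
    have := Set.ncard_le_ncard hsub S.finite_toSet
    rwa [Set.ncard_coe_finset] at this
  have h1 := hcard.trans (card_le_of_dyadic_box hf hfd hd hl S
    (fun x hx => (Finset.mem_filter.1 hx).2) fun x hx i => by
      have := Fintype.mem_piFinset.1 (Finset.mem_filter.1 hx).1 i
      rwa [Finset.mem_Icc, ← abs_le] at this)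
  have h2 : (Nat.card {x : Fin 2 → ℤ //
      (∀ i, |(x i : ℝ)| ≤ H) ∧ eval (fun i => (x i : ℚ)) f = 0} : ℝ) ≤
      1500000 * 98304 ^ 10 * d ^ 2 * (l + 1) ^ 46 * 2 ^ ((l + 1) / d) := by
    exact_mod_cast h1
  refine h2.trans ?_
  have h3 := two_pow_div_le (by linarith : 0 < H) (by omega : 0 < d) hlH
  calc (1500000 * 98304 ^ 10 * d ^ 2 * (l + 1) ^ 46 * 2 ^ ((l + 1) / d) : ℝ)
      ≤ 1500000 * 98304 ^ 10 * d ^ 2 * (5 * Real.log H) ^ 46 * (4 * H ^ ((1 : ℝ) / d)) := by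
        have : 0 ≤ 5 * Real.log H := le_trans (by positivity) hlog
        gcongr
    _ = _ := by
        rw [mul_pow]
        ring
end

section
/- Let n > 2 be an integer. There exist constants N = N(n), c = c(n), κ = κ(n) and H₀ = H₀(n) such that the following holds. Let H ≥ H₀ be a real number and let d be an integer with (log H)^N < d < H. Let f ∈ ℚ[x₁,…,x_n] be an irreducible polynomial of degree d defining the hypersurface X ⊆ 𝔸ⁿ_ℚ. Then there exist nonzero polynomials g₁, …, g_r ∈ ℚ[x₁,…,x_n], each of degree d−1, with r ≤ c·(log H)^κ, such that every point of X(ℤ,H) lies in the zero locus of at least one g_i. -/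
open MvPolynomial

theorem mul_card_le_of_pow_dvd_comp {R : Type*} [CommRing R] [IsDomain R] {π : R} (hπ : Prime π)
    {h : Polynomial R} (hh : ¬ Polynomial.C π ∣ h) {d : ℕ} (hd : h.natDegree ≤ d)
    {S : Finset R} (hS : ∀ a ∈ S, ∀ b ∈ S, π ∣ a - b → a = b) {M : ℕ}
    (hM : ∀ a ∈ S, Polynomial.C π ^ M ∣ h.comp (Polynomial.C a + Polynomial.C π * Polynomial.X)) :
    M * S.card ≤ d := by
  classical
  let I : Ideal R := Ideal.span {π}
  have : I.IsPrime := (Ideal.span_singleton_prime hπ.ne_zero).2 hπ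
  let q := Ideal.Quotient.mk I
  have hq (a : R) : q a = 0 ↔ π ∣ a := by
    rw [Ideal.Quotient.eq_zero_iff_mem, Ideal.mem_span_singleton]
  have hne : h.map q ≠ 0 := by
    intro h0
    refine hh ((Polynomial.C_dvd_iff_dvd_coeff _ _).2 fun i => (hq _).1 ?_)
    rw [← Polynomial.coeff_map, h0, Polynomial.coeff_zero]
  have hdvd (a : R) (ha : a ∈ S) : (Polynomial.X - Polynomial.C (q a)) ^ M ∣ h.map q := by
    have h1 : Polynomial.X ^ M ∣ Polynomial.taylor (q a) (h.map q) := by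
      rw [Polynomial.X_pow_dvd_iff]
      intro i hi
      rw [← Polynomial.map_taylor, Polynomial.coeff_map, hq]
      have h2 := hM a ha
      have h3 : h.comp (Polynomial.C a + Polynomial.C π * Polynomial.X) =
          (Polynomial.taylor a h).comp (Polynomial.C π * Polynomial.X) := by
        rw [Polynomial.taylor_apply, Polynomial.comp_assoc]
        simp [add_comm]
      rw [h3, ← Polynomial.C_pow, Polynomial.C_dvd_iff_dvd_coeff] at h2
      have h4 := h2 i
      rw [Polynomial.comp_C_mul_X_coeff] at h4
      obtain ⟨c, hc⟩ := h4
      refine ⟨π ^ (M - i - 1) * c, ?_⟩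
      have h5 : π ^ M = π ^ i * (π * π ^ (M - i - 1)) := by
        rw [← pow_succ', ← pow_add]; congr 1; omega
      refine mul_left_cancel₀ (pow_ne_zero i hπ.ne_zero) ?_
      rw [mul_comm, hc, h5]
      ring
    obtain ⟨u, hu⟩ := h1
    have h2 : h.map q = Polynomial.taylor (-q a) (Polynomial.taylor (q a) (h.map q)) := by
      rw [Polynomial.taylor_taylor, neg_add_cancel, Polynomial.taylor_zero]
    rw [h2, hu, Polynomial.taylor_mul, Polynomial.taylor_X_pow, Polynomial.C_neg, ← sub_eq_add_neg]
    exact dvd_mul_right _ _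
  have hinj : Set.InjOn q S := by
    intro a ha b hb hab
    exact hS a ha b hb ((hq _).1 (by rw [map_sub, hab, sub_self]))
  have hle : M • (S.image q).val ≤ (h.map q).roots := by
    rw [Multiset.le_iff_count]
    intro x
    rw [Multiset.count_nsmul, Polynomial.count_roots]
    by_cases hx : x ∈ S.image q
    · rw [Multiset.count_eq_one_of_mem (S.image q).nodup hx]
      obtain ⟨a, ha, rfl⟩ := Finset.mem_image.1 hx
      simpa using (Polynomial.le_rootMultiplicity_iff hne).2 (hdvd a ha)
    · rw [Multiset.count_eq_zero_of_notMem hx]; simp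
  calc M * S.card = M * (S.image q).card := by rw [Finset.card_image_of_injOn hinj]
    _ = (M • (S.image q).val).card := by
      rw [Multiset.card_nsmul, Finset.card_val]
    _ ≤ (h.map q).roots.card := Multiset.card_le_card hle
    _ ≤ (h.map q).natDegree := Polynomial.card_roots' _
    _ ≤ h.natDegree := Polynomial.natDegree_map_le
    _ ≤ d := hd

/-- The ring homomorphism sending a polynomial `f(x)` to `f(a + p z)`. -/
noncomputable def scaledShift {n : ℕ} (p : ℤ) (a : Fin n → ℤ) :
    MvPolynomial (Fin n) ℤ →ₐ[ℤ] MvPolynomial (Fin n) ℤ :=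
  aeval fun i => C (a i) + C p * X i

theorem finSuccEquiv_scaledShift {n : ℕ} (p : ℤ) (a : Fin (n + 1) → ℤ)
    (f : MvPolynomial (Fin (n + 1)) ℤ) :
    finSuccEquiv ℤ n (scaledShift p a f) =
      ((finSuccEquiv ℤ n f).map (scaledShift p (Fin.tail a)).toRingHom).comp
        (Polynomial.C (C (a 0)) + Polynomial.C (C p) * Polynomial.X) := by
  induction f using MvPolynomial.induction_on with
  | C r => simp [scaledShift]
  | add f g hf hg => simp only [map_add, Polynomial.map_add, Polynomial.add_comp, hf, hg]
  | mul_X f i hf =>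
    have hX : finSuccEquiv ℤ n (scaledShift p a (X i)) =
        ((finSuccEquiv ℤ n (X i)).map (scaledShift p (Fin.tail a)).toRingHom).comp
          (Polynomial.C (C (a 0)) + Polynomial.C (C p) * Polynomial.X) := by
      obtain rfl | ⟨j, rfl⟩ := Fin.eq_zero_or_eq_succ i
      · simp [scaledShift, finSuccEquiv_X_zero]
      · simp [scaledShift, finSuccEquiv_X_succ, Fin.tail]
    simp only [map_mul, Polynomial.map_mul, Polynomial.mul_comp, hf, hX]

/-- The points of `{0, …, p - 1}ⁿ` at which `f` vanishes to order at least `μ` with respect to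
the valuation for which `p` and the local coordinates all have order one. -/
noncomputable def highOrderPoints {n : ℕ} (p μ : ℕ) (f : MvPolynomial (Fin n) ℤ) :
    Finset (Fin n → ℕ) := by
  classical
  exact (Fintype.piFinset fun _ : Fin n => Finset.range p).filter fun a =>
    (C (p : ℤ)) ^ μ ∣ scaledShift (p : ℤ) (fun i => (a i : ℤ)) f

theorem mem_highOrderPoints {n : ℕ} {p μ : ℕ} {f : MvPolynomial (Fin n) ℤ} {a : Fin n → ℕ} :
    a ∈ highOrderPoints p μ f ↔ (∀ i, a i < p) ∧
      (C (p : ℤ)) ^ μ ∣ scaledShift (p : ℤ) (fun i => (a i : ℤ)) f := by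
  simp [highOrderPoints]

theorem prime_C_natCast {n p : ℕ} (hp : p.Prime) : Prime (C (p : ℤ) : MvPolynomial (Fin n) ℤ) :=
  (prime_C_iff _).2 (Nat.prime_iff_prime_int.1 hp)

theorem card_highOrderPoints_le {p : ℕ} (hp : p.Prime) (d M : ℕ) : ∀ (n : ℕ)
    (f : MvPolynomial (Fin n) ℤ), (∀ i, degreeOf i f ≤ d) → ¬ C (p : ℤ) ∣ f →
    p * (M * (highOrderPoints p (n * M + 1) f).card) ≤ n * d * p ^ n := by
  classical
  intro n
  induction n with
  | zero =>
    intro f _ hf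
    have : highOrderPoints p (0 * M + 1) f = ∅ := by
      refine Finset.eq_empty_of_forall_notMem fun a ha => hf ?_
      have := (mem_highOrderPoints.1 ha).2
      rw [zero_mul, zero_add, pow_one] at this
      convert this
      rw [scaledShift]
      conv_lhs => rw [← aeval_X_left_apply f]
      congr 2
      exact Subsingleton.elim _ _
    rw [this]; simp
  | succ n ih =>
    intro f hd hf
    obtain ⟨t, ht⟩ : ∃ t, ¬ C (p : ℤ) ∣ (finSuccEquiv ℤ n f).coeff t := by
      by_contra! hcon
      refine hf ((C_dvd_iff_dvd_coeff _ _).2 fun m => ?_)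
      have := (C_dvd_iff_dvd_coeff _ _).1 (hcon (m 0)) m.tail
      rwa [finSuccEquiv_coeff_coeff, Finsupp.cons_tail] at this
    set B := highOrderPoints p (n * M + 1) ((finSuccEquiv ℤ n f).coeff t) with hB
    have hBcard := ih _ (fun i => (degreeOf_coeff_finSuccEquiv f i t).trans (hd i.succ)) ht
    set T := highOrderPoints p ((n + 1) * M + 1) f with hT
    set P := Fintype.piFinset fun _ : Fin n => Finset.range p with hP
    have hBP : B ⊆ P := by
      intro a ha
      simpa [hP] using (mem_highOrderPoints.1 ha).1
    have hmaps : ∀ a ∈ T, Fin.tail a ∈ P := by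
      intro a ha
      have := (mem_highOrderPoints.1 ha).1
      simp only [hP, Fintype.mem_piFinset, Finset.mem_range]
      exact fun i => this i.succ
    have hfib : ∀ b ∈ P, M * (T.filter fun a => Fin.tail a = b).card ≤
        if b ∈ B then M * p else d := by
      intro b hb
      have hcard : (T.filter fun a => Fin.tail a = b).card =
          ((T.filter fun a => Fin.tail a = b).image fun a => a 0).card := by
        refine (Finset.card_image_of_injOn ?_).symm
        intro a ha a' ha' h0
        have h1 := (Finset.mem_filter.1 ha).2
        have h2 := (Finset.mem_filter.1 ha').2
        rw [← Fin.cons_self_tail a, ← Fin.cons_self_tail a', h1, h2]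
        simp only at h0
        rw [h0]
      split_ifs with hbB
      · refine Nat.mul_le_mul_left _ ?_
        rw [hcard, ← Finset.card_range p]
        refine Finset.card_le_card fun x hx => ?_
        obtain ⟨a, ha, rfl⟩ := Finset.mem_image.1 hx
        exact Finset.mem_range.2 ((mem_highOrderPoints.1 (Finset.mem_filter.1 ha).1).1 0)
      · set G := (finSuccEquiv ℤ n f).map (scaledShift (p : ℤ) fun i => (b i : ℤ)).toRingHom
          with hG
        have hGt : ¬ C (p : ℤ) ^ (n * M + 1) ∣ G.coeff t := by
          intro h
          refine hbB (mem_highOrderPoints.2 ⟨by simpa [hP] using hb, ?_⟩)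
          rw [hG, Polynomial.coeff_map] at h
          exact h
        have hπ := prime_C_natCast (n := n) hp
        have hCπ : Prime (Polynomial.C (C (p : ℤ)) : Polynomial (MvPolynomial (Fin n) ℤ)) :=
          Polynomial.prime_C_iff.2 hπ
        have hG' : ¬ Polynomial.C (C (p : ℤ)) ^ (n * M + 1) ∣ G := by
          intro h
          rw [← Polynomial.C_pow, Polynomial.C_dvd_iff_dvd_coeff] at h
          exact hGt (h t)
        have hfin : FiniteMultiplicity (Polynomial.C (C (p : ℤ))) G := ⟨n * M, hG'⟩
        obtain ⟨h, hh, hnd⟩ := hfin.exists_eq_pow_mul_and_not_dvd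
        set j := multiplicity (Polynomial.C (C (p : ℤ))) G
        have hj : j ≤ n * M := by
          by_contra! hlt
          exact hG' ((pow_dvd_pow _ hlt).trans ⟨h, hh⟩)
        have hdeg : h.natDegree ≤ d := by
          calc h.natDegree = G.natDegree := by
                rw [hh, ← Polynomial.C_pow,
                  Polynomial.natDegree_C_mul (pow_ne_zero _ hπ.ne_zero)]
            _ ≤ (finSuccEquiv ℤ n f).natDegree := Polynomial.natDegree_map_le
            _ = degreeOf 0 f := natDegree_finSuccEquiv f
            _ ≤ d := hd 0
        rw [hcard]
        have hinj : Function.Injective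
            (fun x : ℕ => (C (x : ℤ) : MvPolynomial (Fin n) ℤ)) := by
          intro x y hxy
          exact_mod_cast C_injective _ _ hxy
        rw [← Finset.card_image_of_injective _ hinj]
        refine mul_card_le_of_pow_dvd_comp hπ hnd hdeg ?_ ?_
        · intro x hx y hy hxy
          simp only [Finset.mem_image, Finset.mem_filter] at hx hy
          obtain ⟨_, ⟨a, ⟨ha, -⟩, rfl⟩, rfl⟩ := hx
          obtain ⟨_, ⟨a', ⟨ha', -⟩, rfl⟩, rfl⟩ := hy
          have h1 := (mem_highOrderPoints.1 ha).1 0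
          have h2 := (mem_highOrderPoints.1 ha').1 0
          rw [← C_sub, C_dvd_iff_dvd_coeff] at hxy
          have h3 := hxy 0
          rw [coeff_zero_C] at h3
          have h4 : a' 0 ≡ a 0 [MOD p] := (Nat.modEq_iff_dvd).2 h3
          rw [Nat.ModEq.eq_of_lt_of_lt h4 h2 h1]
        · intro x hx
          simp only [Finset.mem_image, Finset.mem_filter] at hx
          obtain ⟨_, ⟨a, ⟨ha, hab⟩, rfl⟩, rfl⟩ := hx
          have h1 := (mem_highOrderPoints.1 ha).2
          have h2 := map_dvd (finSuccEquiv ℤ n) h1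
          rw [finSuccEquiv_scaledShift, map_pow] at h2
          have h3 : Fin.tail (fun i => (a i : ℤ)) = fun i => (b i : ℤ) := by
            rw [← hab]; rfl
          have h4 : finSuccEquiv ℤ n (C (p : ℤ)) = Polynomial.C (C (p : ℤ)) := by
            simp
          rw [h3, h4, ← hG, hh, Polynomial.mul_comp, Polynomial.pow_comp, Polynomial.C_comp] at h2
          have h5 : (n + 1) * M + 1 = j + (M + (n * M - j + 1)) := by
            have : (n + 1) * M = n * M + M := by ring
            omega
          rw [h5, pow_add, mul_dvd_mul_iff_left (pow_ne_zero _ hCπ.ne_zero)] at h2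
          exact (pow_dvd_pow _ (Nat.le_add_right _ _)).trans h2
    have hsum : M * T.card ≤ M * p * B.card + d * p ^ n := by
      rw [Finset.card_eq_sum_card_fiberwise hmaps, Finset.mul_sum]
      refine (Finset.sum_le_sum hfib).trans ?_
      calc ∑ b ∈ P, (if b ∈ B then M * p else d) ≤ ∑ b ∈ P, ((if b ∈ B then M * p else 0) + d) := by
            refine Finset.sum_le_sum fun b _ => ?_
            split_ifs <;> omega
        _ = M * p * B.card + d * p ^ n := by
            rw [Finset.sum_add_distrib, ← Finset.sum_filter, Finset.filter_mem_eq_inter,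
              Finset.inter_eq_right.2 hBP]
            simp [hP, mul_comm]
    calc p * (M * T.card) ≤ p * (M * p * B.card + d * p ^ n) := Nat.mul_le_mul_left _ hsum
      _ = (p * (M * B.card)) * p + d * p ^ (n + 1) := by ring
      _ ≤ (n * d * p ^ n) * p + d * p ^ (n + 1) := by gcongr
      _ = (n + 1) * d * p ^ (n + 1) := by ring

theorem Prime.pow_sub_dvd_of_pow_dvd_mul_s12 {R : Type*} [CommRing R] [IsDomain R] {π : R}
    (hπ : Prime π) {μ k : ℕ} {x y : R} (hy : ¬ π ^ (μ + 1) ∣ y) (h : π ^ k ∣ x * y) :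
    π ^ (k - μ) ∣ x := by
  have hfin : FiniteMultiplicity π y := ⟨μ, hy⟩
  obtain ⟨z, hz, hnd⟩ := hfin.exists_eq_pow_mul_and_not_dvd
  have he : multiplicity π y ≤ μ := by
    by_contra! hlt
    exact hy ((pow_dvd_pow _ hlt).trans ⟨z, hz⟩)
  have h1 : π ^ k ∣ x * π ^ multiplicity π y := by
    refine hπ.pow_dvd_of_dvd_mul_right k hnd ?_
    rwa [mul_assoc, ← hz]
  rcases le_total k μ with hk | hk
  · simp [Nat.sub_eq_zero_of_le hk]
  · have h2 : π ^ k = π ^ (k - multiplicity π y) * π ^ multiplicity π y := by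
      rw [← pow_add]; congr 1; omega
    rw [h2, mul_dvd_mul_iff_right (pow_ne_zero _ hπ.ne_zero)] at h1
    exact (pow_dvd_pow _ (by omega)).trans h1

/-- The polynomial with all exponents less than `m` and prescribed coefficients. -/
noncomputable def boxPoly {n m : ℕ} (g : (Fin n → Fin m) → ℤ) : MvPolynomial (Fin n) ℤ :=
  ∑ α, monomial (Finsupp.equivFunOnFinite.symm fun i => (α i : ℕ)) (g α)

theorem coeff_boxPoly {n m : ℕ} (g : (Fin n → Fin m) → ℤ) (α : Fin n → Fin m) :
    coeff (Finsupp.equivFunOnFinite.symm fun i => (α i : ℕ)) (boxPoly g) = g α := by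
  classical
  rw [boxPoly, coeff_sum, Finset.sum_eq_single α]
  · simp
  · intro β _ hβ
    rw [coeff_monomial, if_neg]
    intro h
    refine hβ (funext fun i => Fin.ext ?_)
    exact congrFun (Finsupp.equivFunOnFinite.symm.injective h) i
  · simp

theorem boxPoly_ne_zero {n m : ℕ} {g : (Fin n → Fin m) → ℤ} (hg : g ≠ 0) : boxPoly g ≠ 0 := by
  intro h
  refine hg (funext fun α => ?_)
  rw [← coeff_boxPoly g α, h, coeff_zero, Pi.zero_apply]

theorem boxPoly_sub {n m : ℕ} (g h : (Fin n → Fin m) → ℤ) :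
    boxPoly (g - h) = boxPoly g - boxPoly h := by
  simp [boxPoly, Finset.sum_sub_distrib]

theorem totalDegree_boxPoly_le {n m : ℕ} (g : (Fin n → Fin m) → ℤ) :
    (boxPoly g).totalDegree ≤ n * (m - 1) := by
  refine totalDegree_finsetSum_le fun α _ => (totalDegree_monomial_le _ _).trans ?_
  rw [Finsupp.sum_fintype _ _ (fun _ => rfl)]
  calc ∑ i, (α i : ℕ) ≤ ∑ _i : Fin n, (m - 1) :=
        Finset.sum_le_sum fun i _ => Nat.le_pred_of_lt (α i).2
    _ = n * (m - 1) := by simp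

theorem abs_eval_boxPoly_le {n m : ℕ} {g : (Fin n → Fin m) → ℤ} {B R : ℤ} (hR : 1 ≤ R)
    (hg : ∀ α, |g α| ≤ B) {s : Fin n → ℤ} (hs : ∀ i, |s i| ≤ R) :
    |eval s (boxPoly g)| ≤ m ^ n * (B * R ^ (n * (m - 1))) := by
  rw [boxPoly, map_sum]
  refine (Finset.abs_sum_le_sum_abs _ _).trans ?_
  calc ∑ α, |eval s (monomial (Finsupp.equivFunOnFinite.symm fun i => (α i : ℕ)) (g α))|
      ≤ ∑ _α : Fin n → Fin m, B * R ^ (n * (m - 1)) := by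
        refine Finset.sum_le_sum fun α _ => ?_
        rw [eval_monomial, abs_mul, Finsupp.prod_fintype _ _ (fun _ => pow_zero _),
          Finset.abs_prod]
        refine mul_le_mul (hg α) ?_ (Finset.prod_nonneg fun _ _ => abs_nonneg _)
          ((abs_nonneg _).trans (hg α))
        calc ∏ i, |s i ^ (α i : ℕ)| ≤ ∏ _i : Fin n, R ^ (m - 1) := by
              refine Finset.prod_le_prod (fun _ _ => abs_nonneg _) fun i _ => ?_
              rw [abs_pow]
              exact (pow_le_pow_left₀ (abs_nonneg _) (hs i) _).trans
                (pow_le_pow_right₀ hR (Nat.le_pred_of_lt (α i).2))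
          _ = R ^ (n * (m - 1)) := by simp [← pow_mul, mul_comm]
    _ = m ^ n * (B * R ^ (n * (m - 1))) := by simp

theorem coeff_scaledShift_zero {n : ℕ} (p : ℤ) (f : MvPolynomial (Fin n) ℤ) (β : Fin n →₀ ℕ) :
    coeff β (scaledShift p 0 f) = p ^ (∑ i, β i) * coeff β f := by
  classical
  induction f using MvPolynomial.induction_on' with
  | monomial α c =>
    have h : scaledShift p 0 (monomial α c) = monomial α (p ^ (∑ i, α i) * c) := by
      rw [scaledShift, aeval_monomial, Finsupp.prod_fintype _ _ (fun _ => pow_zero _)]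
      simp only [Pi.zero_apply, C_0, zero_add, mul_pow, Finset.prod_mul_distrib]
      rw [monomial_eq (s := α), Finsupp.prod_fintype _ _ (fun _ => pow_zero _),
        Finset.prod_pow_eq_pow_sum, C_mul, C_pow, algebraMap_eq]
      ring
    rw [h, coeff_monomial, coeff_monomial]
    split_ifs with hαβ
    · rw [hαβ]
    · simp
  | add f g hf hg => rw [map_add, coeff_add, hf, hg, coeff_add, mul_add]

theorem eval_scaledShift {n : ℕ} (p : ℤ) (a z : Fin n → ℤ) (f : MvPolynomial (Fin n) ℤ) :
    eval z (scaledShift p a f) = eval (fun i => a i + p * z i) f := by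
  induction f using MvPolynomial.induction_on with
  | C r => simp [scaledShift]
  | add f g hf hg => simp only [map_add, hf, hg]
  | mul_X f i hf =>
    rw [map_mul, map_mul, hf, map_mul]
    simp [scaledShift]

theorem exists_boxPoly_pow_dvd {n p μ b m : ℕ} (hp : p.Prime) {f : MvPolynomial (Fin n) ℤ}
    (hf : ¬ C (p : ℤ) ^ (μ + 1) ∣ scaledShift (p : ℤ) 0 f)
    (hcard : μ * (2 * b) ^ n < b * m ^ n) :
    ∃ g : (Fin n → Fin m) → ℤ, g ≠ 0 ∧ (∀ α, |g α| ≤ (p : ℤ) ^ b) ∧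
      ∀ s : Fin n → ℤ, (∀ i, (p : ℤ) ∣ s i) → eval s f = 0 →
        (p : ℤ) ^ (2 * b) ∣ eval s (boxPoly g) := by
  classical
  set k := 2 * b with hk
  have hpos (e : ℕ) : NeZero (p ^ e) := ⟨pow_ne_zero _ hp.ne_zero⟩
  let w : (Fin n → Fin k) → ℕ := fun α => ∑ i, (α i : ℕ)
  let Ω := ((Fin n → Fin m) → Fin (p ^ b)) × ((α : Fin n → Fin k) → Fin (p ^ (k - μ - w α)))
  let Φ : Ω → (α : Fin n → Fin k) → ZMod (p ^ (k - w α)) := fun x α =>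
    (coeff (Finsupp.equivFunOnFinite.symm fun i => (α i : ℕ))
      (boxPoly (fun β => ((x.1 β : ℕ) : ℤ)) + boxPoly (fun β => ((x.2 β : ℕ) : ℤ)) * f) : ℤ)
  have hlt : Fintype.card ((α : Fin n → Fin k) → ZMod (p ^ (k - w α))) < Fintype.card Ω := by
    rw [Fintype.card_prod, Fintype.card_pi, Fintype.card_pi, Fintype.card_pi]
    simp only [ZMod.card, Fintype.card_fin, Finset.prod_const, Finset.prod_pow_eq_pow_sum,
      Finset.card_univ, Fintype.card_fun, ← pow_mul, ← pow_add]
    refine Nat.pow_lt_pow_right hp.one_lt ?_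
    calc ∑ α, (k - w α) ≤ ∑ α : Fin n → Fin k, (μ + (k - μ - w α)) :=
          Finset.sum_le_sum fun α _ => by omega
      _ = μ * k ^ n + ∑ α, (k - μ - w α) := by
          rw [Finset.sum_add_distrib]; simp [mul_comm]
      _ < b * m ^ n + ∑ α, (k - μ - w α) := by gcongr
  obtain ⟨x, y, hxy, hΦ⟩ := Fintype.exists_ne_map_eq_of_card_lt Φ hlt
  set g : (Fin n → Fin m) → ℤ := (fun β => ((x.1 β : ℕ) : ℤ)) - fun β => ((y.1 β : ℕ) : ℤ) with hg
  set q : (Fin n → Fin k) → ℤ := (fun β => ((x.2 β : ℕ) : ℤ)) - fun β => ((y.2 β : ℕ) : ℤ) with hq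
  have hcoeff (α : Fin n → Fin k) : (p : ℤ) ^ (k - w α) ∣
      coeff (Finsupp.equivFunOnFinite.symm fun i => (α i : ℕ)) (boxPoly g + boxPoly q * f) := by
    have h1 := congrFun hΦ α
    have h2 := ((ZMod.intCast_eq_intCast_iff_dvd_sub _ _ _).1 h1.symm)
    rw [← coeff_sub] at h2
    rw [hg, hq, boxPoly_sub, boxPoly_sub]
    convert h2 using 1
    · push_cast; rfl
    · congr 1; ring
  have hdvd : C (p : ℤ) ^ k ∣ scaledShift (p : ℤ) 0 (boxPoly g + boxPoly q * f) := by
    rw [← C_pow, C_dvd_iff_dvd_coeff]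
    intro β
    rw [coeff_scaledShift_zero]
    by_cases hβ : ∀ i, β i < k
    · have h1 := hcoeff fun i => ⟨β i, hβ i⟩
      have h2 : (Finsupp.equivFunOnFinite.symm fun i => β i) = β := by
        ext i; rfl
      simp only [w, h2] at h1
      refine (pow_dvd_pow _ (show k ≤ (∑ i, β i) + (k - ∑ i, β i) by omega)).trans ?_
      rw [pow_add]
      exact mul_dvd_mul_left _ h1
    · push Not at hβ
      obtain ⟨i, hi⟩ := hβ
      refine ((pow_dvd_pow _ ?_)).trans (dvd_mul_right _ _)
      exact hi.trans (Finset.single_le_sum (f := fun i => β i) (fun _ _ => Nat.zero_le _)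
        (Finset.mem_univ i))
  refine ⟨g, ?_, ?_, ?_⟩
  · intro h0
    have h1 : x.1 = y.1 := by
      ext β
      have := congrFun h0 β
      simp only [hg, Pi.sub_apply, Pi.zero_apply] at this
      omega
    have h2 : boxPoly g = 0 := by rw [h0]; simp [boxPoly]
    rw [h2, zero_add, map_mul] at hdvd
    have h3 := (prime_C_natCast hp).pow_sub_dvd_of_pow_dvd_mul_s12 hf hdvd
    rw [← C_pow, C_dvd_iff_dvd_coeff] at h3
    refine hxy (Prod.ext h1 (funext fun α => ?_))
    have h4 := h3 (Finsupp.equivFunOnFinite.symm fun i => (α i : ℕ))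
    rw [coeff_scaledShift_zero, coeff_boxPoly] at h4
    have h5 : (p : ℤ) ^ (k - μ - w α) ∣ q α := by
      by_cases hle : w α ≤ k - μ
      · have h6 : (p : ℤ) ^ (k - μ) = p ^ w α * p ^ (k - μ - w α) := by
          rw [← pow_add]; congr 1; omega
        have h7 : (∑ i, (Finsupp.equivFunOnFinite.symm fun i => (α i : ℕ)) i) = w α := rfl
        rw [h6, h7] at h4
        exact (mul_dvd_mul_iff_left (pow_ne_zero _ (by exact_mod_cast hp.ne_zero))).1 h4
      · rw [Nat.sub_eq_zero_of_le (by omega), pow_zero]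
        exact one_dvd _
    have h8 : (y.2 α : ℕ) ≡ x.2 α [MOD p ^ (k - μ - w α)] := by
      rw [Nat.modEq_iff_dvd]
      push_cast
      exact h5
    exact Fin.ext (h8.symm.eq_of_lt_of_lt (x.2 α).2 (y.2 α).2)
  · intro α
    have h1 := (x.1 α).2
    have h2 := (y.1 α).2
    simp only [hg, Pi.sub_apply]
    rw [abs_le]
    zify at h1 h2
    constructor <;> linarith [Int.natCast_nonneg (x.1 α : ℕ), Int.natCast_nonneg (y.1 α : ℕ)]
  · intro s hs hfs
    choose z hz using hs
    have h1 := map_dvd (eval z) hdvd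
    rw [map_pow, eval_C, eval_scaledShift] at h1
    have h2 : (fun i => (0 : Fin n → ℤ) i + (p : ℤ) * z i) = s := by
      ext i; simp [hz i]
    rw [h2, map_add, map_mul, hfs, mul_zero, add_zero] at h1
    exact h1

theorem scaledShift_scaledShift {n : ℕ} (p q : ℤ) (a b : Fin n → ℤ) (f : MvPolynomial (Fin n) ℤ) :
    scaledShift p b (scaledShift q a f) = scaledShift (q * p) (fun i => a i + q * b i) f := by
  induction f using MvPolynomial.induction_on with
  | C r => simp [scaledShift]
  | add f g hf hg => simp only [map_add, hf, hg]
  | mul_X f i hf =>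
    rw [map_mul, map_mul, hf, map_mul]
    congr 1
    simp only [scaledShift, aeval_X, map_add, map_mul, algHom_C, algebraMap_eq]
    ring

theorem scaledShift_one_zero {n : ℕ} (f : MvPolynomial (Fin n) ℤ) :
    scaledShift 1 0 f = f := by
  simp [scaledShift]

theorem totalDegree_scaledShift_le {n : ℕ} (p : ℤ) (a : Fin n → ℤ) (f : MvPolynomial (Fin n) ℤ) :
    (scaledShift p a f).totalDegree ≤ f.totalDegree := by
  rw [scaledShift, aeval_def, eval₂_eq']
  refine totalDegree_finsetSum_le fun α hα => ?_
  rw [algebraMap_eq]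
  refine (totalDegree_mul _ _).trans ?_
  rw [totalDegree_C, zero_add]
  refine (totalDegree_finsetProd _ _).trans ?_
  refine le_trans ?_ (le_totalDegree hα)
  rw [Finsupp.sum_fintype _ _ (fun _ => rfl)]
  refine Finset.sum_le_sum fun i _ => (totalDegree_pow _ _).trans ?_
  have h : (C (a i) + C p * X i : MvPolynomial (Fin n) ℤ).totalDegree ≤ 1 := by
    refine (totalDegree_add _ _).trans (max_le ((totalDegree_C _).trans_le zero_le_one) ?_)
    refine (totalDegree_mul _ _).trans ?_
    rw [totalDegree_C, zero_add, totalDegree_X]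
  nlinarith

theorem exists_lowDegree_of_lowOrder {n p L d M : ℕ} (hn : 1 ≤ n) (hL : 8 * n ≤ L) (hnd : n ≤ d)
    (hd : d ≤ 2 ^ L) (hM : M * L ^ (2 * n + 1) < d) (hp : p.Prime) (hpL : p ≤ 2 ^ L)
    {a : Fin n → ℕ} (ha : ∀ i, a i < p) {f : MvPolynomial (Fin n) ℤ}
    (hf : ¬ C (p : ℤ) ^ (n * M + 1) ∣ scaledShift (p : ℤ) (fun i => (a i : ℤ)) f) :
    ∃ g : MvPolynomial (Fin n) ℤ, g ≠ 0 ∧ g.totalDegree ≤ d - 1 ∧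
      ∀ s : Fin n → ℤ, (∀ i, |s i| ≤ 2 ^ L) → eval s f = 0 → (∀ i, (p : ℤ) ∣ s i - a i) →
        eval s g = 0 := by
  set a' : Fin n → ℤ := fun i => (a i : ℤ) with ha'
  have hd1 : 1 ≤ d := hn.trans hnd
  have hL1 : 1 ≤ L := by omega
  set m := (d - 1) / n + 1 with hm
  have hm1 : n * (m - 1) ≤ d - 1 := by
    rw [hm, Nat.add_sub_cancel]; exact Nat.mul_div_le _ _
  have hm2 : d ≤ n * m := by
    have := Nat.lt_mul_div_succ (d - 1) (show 0 < n by omega)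
    rw [hm]; omega
  have hm3 : m ≤ d := by
    have := Nat.div_le_self (d - 1) n
    omega
  have hf' : ¬ C (p : ℤ) ^ (n * M + 1) ∣ scaledShift (p : ℤ) 0 (scaledShift 1 a' f) := by
    rw [scaledShift_scaledShift]
    simpa using hf
  have hcard : n * M * (2 * (4 * d * L)) ^ n < 4 * d * L * m ^ n := by
    have h1 : n * (8 * n) ^ n * L ^ n ≤ L ^ (2 * n + 1) := by
      calc n * (8 * n) ^ n * L ^ n ≤ L * L ^ n * L ^ n := by gcongr; omega
        _ = L ^ (2 * n + 1) := by ring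
    have hn0 : 0 < n ^ n := by positivity
    refine lt_of_mul_lt_mul_left (a := n ^ n) ?_ hn0.le
    calc n ^ n * (n * M * (2 * (4 * d * L)) ^ n)
        = M * (n * (8 * n) ^ n * L ^ n) * d ^ n := by
          rw [show 2 * (4 * d * L) = 8 * d * L by ring]
          simp only [mul_pow]; ring
      _ ≤ M * L ^ (2 * n + 1) * d ^ n := by gcongr
      _ < d * d ^ n := by gcongr
      _ ≤ 4 * d * L * (n * m) ^ n := by
          gcongr
          nlinarith
      _ = n ^ n * (4 * d * L * m ^ n) := by rw [mul_pow]; ring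
  obtain ⟨g, hg0, hgB, hg⟩ := exists_boxPoly_pow_dvd hp hf' hcard
  refine ⟨scaledShift 1 (fun i => -a' i) (boxPoly g), ?_, ?_, ?_⟩
  · intro h
    have h1 : scaledShift 1 a' (scaledShift 1 (fun i => -a' i) (boxPoly g)) = boxPoly g := by
      rw [scaledShift_scaledShift]
      have : (fun i => -a' i + 1 * a' i) = 0 := by ext i; simp
      rw [this, mul_one, scaledShift_one_zero]
    rw [h, map_zero] at h1
    exact boxPoly_ne_zero hg0 h1.symm
  · exact (totalDegree_scaledShift_le _ _ _).trans ((totalDegree_boxPoly_le g).trans hm1)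
  · intro s hs hfs hdiv
    rw [eval_scaledShift]
    set z : Fin n → ℤ := fun i => -a' i + 1 * s i with hz
    have h1 : (p : ℤ) ^ (2 * (4 * d * L)) ∣ eval z (boxPoly g) := by
      refine hg z (fun i => ?_) ?_
      · simpa [hz, ha', neg_add_eq_sub] using hdiv i
      · rw [eval_scaledShift]
        have : (fun i => a' i + 1 * z i) = s := by ext i; simp [hz]
        rw [this, hfs]
    have hzR : ∀ i, |z i| ≤ 2 ^ (L + 1) := by
      intro i
      have h2 := hs i
      have h3 := ha i
      rw [abs_le] at h2 ⊢
      have h4 : (p : ℤ) ≤ 2 ^ L := by exact_mod_cast hpL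
      have h5 : (0 : ℤ) ≤ a i := Int.natCast_nonneg _
      zify at h3
      rw [pow_succ]
      simp only [hz, ha']
      constructor <;> linarith [h2.1, h2.2]
    have h2 := abs_eval_boxPoly_le (one_le_pow₀ (by norm_num)) hgB hzR
    refine Int.eq_zero_of_abs_lt_dvd h1 (h2.trans_lt ?_)
    have h3 : m ^ n * (2 ^ (L + 1)) ^ (n * (m - 1)) < p ^ (4 * d * L) := by
      calc m ^ n * (2 ^ (L + 1)) ^ (n * (m - 1))
          ≤ (2 ^ L) ^ d * (2 ^ (L + 1)) ^ d := by
            refine Nat.mul_le_mul ?_ ?_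
            · calc m ^ n ≤ (2 ^ L) ^ n := by gcongr; omega
                _ ≤ (2 ^ L) ^ d := by gcongr; exact Nat.one_le_two_pow
            · gcongr
              · exact Nat.one_le_two_pow
              · omega
        _ = 2 ^ (L * d + (L + 1) * d) := by rw [← pow_mul, ← pow_mul, ← pow_add]
        _ < 2 ^ (4 * d * L) := by
            refine Nat.pow_lt_pow_right (by norm_num) ?_
            nlinarith [Nat.mul_le_mul hL1 hd1, Nat.mul_le_mul_right d hL1]
        _ ≤ p ^ (4 * d * L) := by gcongr; exact hp.two_le
    have h4 : (m : ℤ) ^ n * (2 ^ (L + 1)) ^ (n * (m - 1)) < (p : ℤ) ^ (4 * d * L) := by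
      exact_mod_cast h3
    have h5 : (0 : ℤ) < (p : ℤ) ^ (4 * d * L) := pow_pos (by exact_mod_cast hp.pos) _
    calc (m : ℤ) ^ n * ((p : ℤ) ^ (4 * d * L) * (2 ^ (L + 1)) ^ (n * (m - 1)))
        = (m : ℤ) ^ n * (2 ^ (L + 1)) ^ (n * (m - 1)) * (p : ℤ) ^ (4 * d * L) := by ring
      _ < (p : ℤ) ^ (4 * d * L) * (p : ℤ) ^ (4 * d * L) := by gcongr
      _ = (p : ℤ) ^ (2 * (4 * d * L)) := by rw [← pow_add]; congr 1; ring

theorem dvd_eval_sub_eval {n : ℕ} {p : ℤ} {s t : Fin n → ℤ} (h : ∀ i, p ∣ s i - t i)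
    (f : MvPolynomial (Fin n) ℤ) : p ∣ eval s f - eval t f := by
  induction f using MvPolynomial.induction_on with
  | C r => simp
  | add f g hf hg =>
    rw [map_add, map_add, add_sub_add_comm]
    exact dvd_add hf hg
  | mul_X f i hf =>
    rw [map_mul, map_mul, eval_X, eval_X]
    exact dvd_mul_sub_mul hf (h i)

theorem exists_boxPoly_eq_zero_of_few_residues {n m b ℓ K : ℕ} {R : ℤ} (hR : 1 ≤ R)
    {P : Finset ℕ} (hP : ∀ p ∈ P, p.Prime ∧ p ≤ 2 ^ ℓ) (hPcard : P.card = 2 * b)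
    (A : ℕ → Finset (Fin n → ℕ)) (hA : ∀ p ∈ P, (A p).card ≤ K)
    (hcard : ℓ * (2 * b) * K < b * m ^ n)
    (hsize : (m : ℤ) ^ n * (2 ^ b * R ^ (n * (m - 1))) < 2 ^ (2 * b)) :
    ∃ g : (Fin n → Fin m) → ℤ, g ≠ 0 ∧ ∀ s : Fin n → ℤ, (∀ i, |s i| ≤ R) →
      (∀ p ∈ P, ∃ a ∈ A p, ∀ i, (p : ℤ) ∣ s i - a i) → eval s (boxPoly g) = 0 := by
  classical
  have hne (p : P) : NeZero (p : ℕ) := ⟨(hP p p.2).1.ne_zero⟩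
  let Φ : ((Fin n → Fin m) → Fin (2 ^ b)) → (p : P) → A p → ZMod p := fun x _ a =>
    (eval (fun i => ((a : Fin n → ℕ) i : ℤ)) (boxPoly fun β => ((x β : ℕ) : ℤ)) : ℤ)
  have hlt : Fintype.card ((p : P) → A p → ZMod p) <
      Fintype.card ((Fin n → Fin m) → Fin (2 ^ b)) := by
    rw [Fintype.card_pi]
    simp only [ZMod.card, Fintype.card_fin, Fintype.card_fun, ← pow_mul, Fintype.card_coe]
    calc ∏ p : P, (p : ℕ) ^ (A p).card ≤ ∏ _p : P, 2 ^ (ℓ * K) := by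
          refine Finset.prod_le_prod' fun p _ => ?_
          calc (p : ℕ) ^ (A p).card ≤ (p : ℕ) ^ K :=
                Nat.pow_le_pow_right (hP p p.2).1.pos (hA p p.2)
            _ ≤ (2 ^ ℓ) ^ K := Nat.pow_le_pow_left (hP p p.2).2 _
            _ = 2 ^ (ℓ * K) := by rw [pow_mul]
      _ = 2 ^ (ℓ * (2 * b) * K) := by
          rw [Finset.prod_const, Finset.card_univ, Fintype.card_coe, hPcard, ← pow_mul]
          congr 1; ring
      _ < 2 ^ (b * m ^ n) := Nat.pow_lt_pow_right (by norm_num) hcard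
  obtain ⟨x, y, hxy, hΦ⟩ := Fintype.exists_ne_map_eq_of_card_lt Φ hlt
  refine ⟨(fun β => ((x β : ℕ) : ℤ)) - fun β => ((y β : ℕ) : ℤ), ?_, ?_⟩
  · intro h0
    refine hxy (funext fun β => Fin.ext ?_)
    have := congrFun h0 β
    simp only [Pi.sub_apply, Pi.zero_apply] at this
    omega
  · intro s hs hres
    set g : (Fin n → Fin m) → ℤ := (fun β => ((x β : ℕ) : ℤ)) - fun β => ((y β : ℕ) : ℤ) with hg
    have hgB : ∀ α, |g α| ≤ 2 ^ b := by
      intro α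
      have h1 := (x α).2
      have h2 := (y α).2
      simp only [hg, Pi.sub_apply]
      rw [abs_le]
      zify at h1 h2
      constructor <;> linarith [Int.natCast_nonneg (x α : ℕ), Int.natCast_nonneg (y α : ℕ)]
    have hdvd : (∏ p ∈ P, (p : ℤ)) ∣ eval s (boxPoly g) := by
      refine Finset.prod_dvd_of_coprime ?_ ?_
      · intro p hp q hq hpq
        exact Nat.isCoprime_iff_coprime.2 ((Nat.coprime_primes (hP p hp).1 (hP q hq).1).2 hpq)
      · intro p hp
        obtain ⟨a, ha, has⟩ := hres p hp
        have h1 := congrFun (congrFun hΦ ⟨p, hp⟩) ⟨a, ha⟩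
        have h2 := (ZMod.intCast_eq_intCast_iff_dvd_sub _ _ _).1 h1.symm
        rw [← map_sub, ← boxPoly_sub] at h2
        have h3 := dvd_eval_sub_eval has (boxPoly g)
        exact (dvd_sub_left h2).1 h3
    refine Int.eq_zero_of_abs_lt_dvd hdvd ((abs_eval_boxPoly_le hR hgB hs).trans_lt ?_)
    refine hsize.trans_le ?_
    rw [← hPcard, ← Finset.prod_const]
    refine Finset.prod_le_prod (fun _ _ => by norm_num) fun p hp => ?_
    exact_mod_cast (hP p hp).1.two_le

theorem le_mul_primeCounting_add_one {x L : ℕ} (hx : 2 ≤ x) (hL : x + 1 ≤ 2 ^ L) :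
    x ≤ L * (Nat.primeCounting x + 1) := by
  have h1 := Chebyshev.pi_ge x
  have hlog2 : 0 < Real.log 2 := Real.log_pos (by norm_num)
  have hlogx : 0 < Real.log x := Real.log_pos (by exact_mod_cast hx)
  have h2 : Real.log ((x : ℝ) + 1) ≤ L * Real.log 2 := by
    rw [← Real.log_pow]
    exact Real.log_le_log (by positivity) (by exact_mod_cast hL)
  have h3 : Real.log x ≤ L * Real.log 2 :=
    (Real.log_le_log (by positivity) (by linarith)).trans h2
  rw [div_le_iff₀ hlogx] at h1
  have h4 : (x : ℝ) * Real.log 2 ≤ L * (Nat.primeCounting x + 1) * Real.log 2 := by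
    have : (Nat.primeCounting x : ℝ) * Real.log x ≤ Nat.primeCounting x * (L * Real.log 2) := by
      gcongr
    linarith
  exact_mod_cast le_of_mul_le_mul_right h4 hlog2

theorem exists_lowDegree_cover {n L d : ℕ} (hn : 1 ≤ n) (hL : 8 * n ≤ L)
    (hxL : L ^ (10 * n) + 1 ≤ 2 ^ L) (hLd : L ^ (10 * n) < d) (hd : d ≤ 2 ^ L)
    {f : MvPolynomial (Fin n) ℤ} (hfd : f.totalDegree ≤ d)
    (hf : ∀ p : ℕ, p.Prime → ¬ C (p : ℤ) ∣ f) :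
    ∃ G : Finset (MvPolynomial (Fin n) ℤ),
      G.card ≤ (L ^ (10 * n) + 1) * (L ^ (10 * n)) ^ n + 1 ∧
      (∀ g ∈ G, g ≠ 0 ∧ g.totalDegree ≤ d - 1) ∧
      ∀ s : Fin n → ℤ, (∀ i, |s i| ≤ 2 ^ L) → eval s f = 0 → ∃ g ∈ G, eval s g = 0 := by
  classical
  set x := L ^ (10 * n) with hx
  have hL1 : 8 ≤ L := by omega
  have hpowle {i j : ℕ} (hij : i ≤ j) : L ^ i ≤ L ^ j := Nat.pow_le_pow_right (by omega) hij
  have hx2 : 2 ≤ x := by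
    calc 2 ≤ L ^ 1 := by rw [pow_one]; omega
      _ ≤ x := hpowle (by omega)
  have hnd : n ≤ d := by
    have : L ^ 1 ≤ x := hpowle (by omega)
    rw [pow_one] at this
    omega
  set M := (d - 1) / L ^ (2 * n + 1) with hMdef
  have hLM : L ^ (2 * n + 1) ≤ d - 1 := by
    have : L ^ (2 * n + 1) ≤ x := hpowle (by omega)
    omega
  have hM1 : 1 ≤ M := (Nat.one_le_div_iff (by positivity)).2 hLM
  have hM2 : M * L ^ (2 * n + 1) < d := by
    have := Nat.div_mul_le_self (d - 1) (L ^ (2 * n + 1))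
    rw [← hMdef] at this
    omega
  have hM3 : d ≤ 2 * M * L ^ (2 * n + 1) := by
    have h1 := Nat.lt_mul_div_succ (d - 1) (show 0 < L ^ (2 * n + 1) by positivity)
    rw [← hMdef] at h1
    have h2 : L ^ (2 * n + 1) * (M + 1) ≤ 2 * M * L ^ (2 * n + 1) := by
      rw [mul_comm]; gcongr; omega
    omega
  have hgood : ∀ (p : ℕ) (a : Fin n → ℕ), ∃ g : MvPolynomial (Fin n) ℤ,
      g ≠ 0 ∧ g.totalDegree ≤ d - 1 ∧ (p.Prime → p ≤ x → (∀ i, a i < p) →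
        a ∉ highOrderPoints p (n * M + 1) f → ∀ s : Fin n → ℤ, (∀ i, |s i| ≤ 2 ^ L) →
          eval s f = 0 → (∀ i, (p : ℤ) ∣ s i - a i) → eval s g = 0) := by
    intro p a
    by_cases h : p.Prime ∧ p ≤ x ∧ (∀ i, a i < p) ∧ a ∉ highOrderPoints p (n * M + 1) f
    · obtain ⟨h1, h2, h3, h4⟩ := h
      rw [mem_highOrderPoints, not_and] at h4
      obtain ⟨g, hg⟩ := exists_lowDegree_of_lowOrder hn hL hnd hd hM2 h1 (by omega) h3 (h4 h3)
      exact ⟨g, hg.1, hg.2.1, fun _ _ _ _ => hg.2.2⟩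
    · exact ⟨1, one_ne_zero, by simp, fun h1 h2 h3 h4 => (h ⟨h1, h2, h3, h4⟩).elim⟩
  choose g hg0 hgdeg hg using hgood
  set m := L ^ (10 * (n - 1) + 6) with hm
  set b := 2 * L * n * m with hb
  have hm1 : 1 ≤ m := Nat.one_le_pow _ _ (by omega)
  have hπ : 2 * b ≤ Nat.primeCounting x := by
    have h1 := le_mul_primeCounting_add_one hx2 hxL
    have h2 : L * (L * m * L ^ 2) ≤ L * (Nat.primeCounting x + 1) := by
      refine le_trans (le_of_eq ?_) h1
      rw [hm, hx]
      have h3 : 10 * n = 10 * (n - 1) + 6 + 4 := by omega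
      rw [h3, pow_add]
      ring
    have h4 := Nat.le_of_mul_le_mul_left h2 (by omega)
    have h5 : 2 * b + 1 ≤ L * m * L ^ 2 := by
      have h6 : 1 ≤ L * m := Nat.mul_pos (by omega) hm1
      calc 2 * b + 1 ≤ L * m * (4 * n) + L * m := by rw [hb]; nlinarith
        _ = L * m * (4 * n + 1) := by ring
        _ ≤ L * m * L ^ 2 := by gcongr; nlinarith
    omega
  obtain ⟨P, hPsub, hPcard⟩ : ∃ P ⊆ (Finset.range (x + 1)).filter Nat.Prime, P.card = 2 * b := by
    refine Finset.exists_subset_card_eq ?_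
    rwa [Nat.primeCounting, Nat.primeCounting', Nat.count_eq_card_filter_range] at hπ
  have hP : ∀ p ∈ P, p.Prime ∧ p ≤ x := by
    intro p hp
    have := Finset.mem_filter.1 (hPsub hp)
    exact ⟨this.2, by have := Finset.mem_range.1 this.1; omega⟩
  have hbad : ∀ p ∈ P, (highOrderPoints p (n * M + 1) f).card ≤
      L ^ (2 * n + 2) * x ^ (n - 1) := by
    intro p hp
    obtain ⟨hp1, hp2⟩ := hP p hp
    have h1 := card_highOrderPoints_le hp1 d M n f
      (fun i => (degreeOf_le_totalDegree f i).trans hfd) (hf p hp1)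
    refine le_of_mul_le_mul_left (a := p * M) ?_ (Nat.mul_pos hp1.pos hM1)
    calc p * M * (highOrderPoints p (n * M + 1) f).card
        = p * (M * (highOrderPoints p (n * M + 1) f).card) := by ring
      _ ≤ n * d * p ^ n := h1
      _ ≤ n * (2 * M * L ^ (2 * n + 1)) * p ^ n := by gcongr
      _ = p * M * ((2 * n) * L ^ (2 * n + 1) * p ^ (n - 1)) := by
          obtain ⟨k, rfl⟩ : ∃ k, n = k + 1 := ⟨n - 1, by omega⟩
          rw [Nat.add_sub_cancel, pow_succ p k]; ring
      _ ≤ p * M * (L * L ^ (2 * n + 1) * x ^ (n - 1)) := by gcongr; omega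
      _ = p * M * (L ^ (2 * n + 2) * x ^ (n - 1)) := by ring
  have hcard : L * (2 * b) * (L ^ (2 * n + 2) * x ^ (n - 1)) < b * m ^ n := by
    have hb1 : 0 < b := by rw [hb]; positivity
    have hmn : m ^ n = x ^ (n - 1) * L ^ (6 * n) := by
      rw [hm, hx, ← pow_mul, ← pow_mul, ← pow_add]
      congr 1
      obtain ⟨k, rfl⟩ : ∃ k, n = k + 1 := ⟨n - 1, by omega⟩
      rw [Nat.add_sub_cancel]; ring
    rw [hmn]
    calc L * (2 * b) * (L ^ (2 * n + 2) * x ^ (n - 1))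
        = b * (x ^ (n - 1) * (2 * L ^ (2 * n + 3))) := by ring
      _ < b * (x ^ (n - 1) * (L * L ^ (2 * n + 3))) := by gcongr; omega
      _ = b * (x ^ (n - 1) * L ^ (2 * n + 4)) := by ring
      _ ≤ b * (x ^ (n - 1) * L ^ (6 * n)) := by
          gcongr
          · omega
          · omega
  have hsize : (m : ℤ) ^ n * (2 ^ b * (2 ^ L) ^ (n * (m - 1))) < 2 ^ (2 * b) := by
    have : m ^ n * (2 ^ b * (2 ^ L) ^ (n * (m - 1))) < 2 ^ (2 * b) := by
      calc m ^ n * (2 ^ b * (2 ^ L) ^ (n * (m - 1)))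
          ≤ (2 ^ m) ^ n * (2 ^ b * (2 ^ L) ^ (n * m)) := by
            gcongr
            · exact Nat.lt_two_pow_self.le
            · exact Nat.one_le_two_pow
            · omega
        _ = 2 ^ (m * n + (b + L * (n * m))) := by
            rw [← pow_mul, ← pow_mul, ← pow_add, ← pow_add]
        _ < 2 ^ (2 * b) := by
            refine Nat.pow_lt_pow_right (by norm_num) ?_
            have : 0 < n * m := by positivity
            rw [hb]; nlinarith
    exact_mod_cast this
  obtain ⟨h, hh0, hh⟩ := exists_boxPoly_eq_zero_of_few_residues (R := 2 ^ L) (ℓ := L)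
    (one_le_pow₀ (by norm_num)) (fun p hp => ⟨(hP p hp).1, (hP p hp).2.trans (by omega)⟩) hPcard
    (fun p => highOrderPoints p (n * M + 1) f) hbad hcard hsize
  refine ⟨insert (boxPoly h) ((Finset.range (x + 1)).biUnion fun p =>
    (Fintype.piFinset fun _ : Fin n => Finset.range p).image (g p)), ?_, ?_, ?_⟩
  · refine (Finset.card_insert_le _ _).trans (Nat.add_le_add_right ?_ 1)
    calc _ ≤ (Finset.range (x + 1)).card * x ^ n := by
          refine Finset.card_biUnion_le_card_mul _ _ _ fun p hp => Finset.card_image_le.trans ?_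
          have := Finset.mem_range.1 hp
          simp only [Fintype.card_piFinset, Finset.card_range, Finset.prod_const,
            Finset.card_univ, Fintype.card_fin]
          gcongr; omega
      _ = (x + 1) * x ^ n := by rw [Finset.card_range]
  · intro q hq
    rcases Finset.mem_insert.1 hq with rfl | hq
    · refine ⟨boxPoly_ne_zero hh0, (totalDegree_boxPoly_le h).trans ?_⟩
      have h1 : n * (m - 1) ≤ x := by
        calc n * (m - 1) ≤ L * m := by gcongr <;> omega
          _ = L ^ (10 * (n - 1) + 7) := by rw [hm]; ring
          _ ≤ x := hpowle (by omega)
      omega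
    · simp only [Finset.mem_biUnion, Finset.mem_image] at hq
      obtain ⟨p, -, a, -, rfl⟩ := hq
      exact ⟨hg0 p a, hgdeg p a⟩
  · intro s hs hfs
    by_cases hall : ∀ p ∈ P, ∃ a ∈ highOrderPoints p (n * M + 1) f, ∀ i, (p : ℤ) ∣ s i - a i
    · exact ⟨_, Finset.mem_insert_self _ _, hh s hs hall⟩
    · push Not at hall
      obtain ⟨p, hpP, hpa⟩ := hall
      obtain ⟨hp1, hp2⟩ := hP p hpP
      have hp0 : (0 : ℤ) < p := by exact_mod_cast hp1.pos
      set a : Fin n → ℕ := fun i => (s i % p).toNat with ha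
      have ha1 : ∀ i, (a i : ℤ) = s i % p := fun i =>
        Int.toNat_of_nonneg (Int.emod_nonneg _ hp0.ne')
      have ha2 : ∀ i, a i < p := by
        intro i
        have := Int.emod_lt_of_pos (s i) hp0
        rw [← ha1 i] at this
        exact_mod_cast this
      have ha3 : ∀ i, (p : ℤ) ∣ s i - a i := by
        intro i
        rw [ha1 i]
        exact Int.dvd_self_sub_emod
      have ha4 : a ∉ highOrderPoints p (n * M + 1) f := by
        intro hmem
        obtain ⟨i, hi⟩ := hpa a hmem
        exact hi (ha3 i)
      refine ⟨g p a, Finset.mem_insert_of_mem ?_, hg p a hp1 hp2 ha2 ha4 s hs hfs ha3⟩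
      refine Finset.mem_biUnion.2 ⟨p, Finset.mem_range.2 (by omega), Finset.mem_image_of_mem _ ?_⟩
      simpa using ha2

/-- Every nonzero rational polynomial is proportional to a primitive integral one. -/
theorem exists_primitive_integral_multiple {σ : Type*} {f : MvPolynomial σ ℚ} (hf : f ≠ 0) :
    ∃ (F : MvPolynomial σ ℤ) (c : ℚ), c ≠ 0 ∧ F.map (Int.castRingHom ℚ) = C c * f ∧
      ∀ p : ℕ, p.Prime → ¬ C (p : ℤ) ∣ F := by
  classical
  obtain ⟨β, hβ⟩ := ne_zero_iff.1 hf
  have hex : ∃ k : ℕ, ∃ (F : MvPolynomial σ ℤ) (c : ℚ), c ≠ 0 ∧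
      F.map (Int.castRingHom ℚ) = C c * f ∧ (coeff β F).natAbs = k := by
    obtain ⟨b, hb⟩ := IsLocalization.exist_integer_multiples_of_finset (nonZeroDivisors ℤ)
      (f.support.image fun α => coeff α f)
    have hcleared : ∀ α, ∃ z : ℤ, (z : ℚ) = (b : ℤ) * coeff α f := by
      intro α
      by_cases hα : α ∈ f.support
      · obtain ⟨z, hz⟩ := hb _ (Finset.mem_image_of_mem _ hα)
        exact ⟨z, by simpa [Algebra.smul_def] using hz⟩
      · exact ⟨0, by simp [notMem_support_iff.1 hα]⟩
    choose z hz using hcleared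
    refine ⟨_, ∑ α ∈ f.support, monomial α (z α), (b : ℤ), ?_, ?_, rfl⟩
    · exact_mod_cast nonZeroDivisors.ne_zero b.2
    · ext α
      rw [coeff_map, coeff_C_mul, coeff_sum]
      simp only [coeff_monomial, Finset.sum_ite_eq', eq_intCast]
      split_ifs with hα
      · exact hz α
      · simp [notMem_support_iff.1 hα]
  obtain ⟨F, c, hc, hF, hk⟩ := Nat.find_spec hex
  refine ⟨F, c, hc, hF, fun p hp => ?_⟩
  rintro ⟨F', rfl⟩
  have hp0 : (p : ℚ) ≠ 0 := by exact_mod_cast hp.ne_zero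
  have hF' : F'.map (Int.castRingHom ℚ) = C ((p : ℚ)⁻¹ * c) * f := by
    rw [map_mul, map_C] at hF
    rw [C_mul, mul_assoc, ← hF, ← mul_assoc]
    simp only [eq_intCast, Int.cast_natCast]
    rw [← C_mul, inv_mul_cancel₀ hp0, C_1, one_mul]
  have hne : coeff β F' ≠ 0 := by
    intro h0
    have h1 := congrArg (coeff β) hF'
    rw [coeff_map, h0, map_zero, coeff_C_mul] at h1
    exact (mul_ne_zero (mul_ne_zero (inv_ne_zero hp0) hc) hβ) h1.symm
  refine Nat.find_min hex ?_ ⟨F', _, mul_ne_zero (inv_ne_zero hp0) hc, hF', rfl⟩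
  rw [← hk, coeff_C_mul, Int.natAbs_mul, Int.natAbs_natCast]
  exact lt_mul_of_one_lt_left (Int.natAbs_pos.2 hne) hp.one_lt

theorem totalDegree_map_of_injective {σ R S : Type*} [CommSemiring R] [CommSemiring S]
    (p : MvPolynomial σ R) {φ : R →+* S} (hφ : Function.Injective φ) :
    (map φ p).totalDegree = p.totalDegree := by
  rw [totalDegree, totalDegree, support_map_of_injective p hφ]

theorem exists_totalDegree_eq_of_le {σ : Type*} (i : σ) {e : ℕ} {g : MvPolynomial σ ℤ}
    (hg : g ≠ 0) (hge : g.totalDegree ≤ e) :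
    ∃ G : MvPolynomial σ ℚ, G ≠ 0 ∧ G.totalDegree = e ∧
      ∀ s : σ → ℤ, eval s g = 0 → eval (fun i => (s i : ℚ)) G = 0 := by
  have hinj : Function.Injective (Int.castRingHom ℚ) := Int.cast_injective
  have hg0 : map (Int.castRingHom ℚ) g ≠ 0 := (map_ne_zero_iff _ (map_injective _ hinj)).2 hg
  have hX : (X i ^ (e - g.totalDegree) : MvPolynomial σ ℚ) ≠ 0 := pow_ne_zero _ (X_ne_zero _)
  refine ⟨map (Int.castRingHom ℚ) g * X i ^ (e - g.totalDegree), mul_ne_zero hg0 hX, ?_, ?_⟩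
  · rw [totalDegree_mul_of_isDomain hg0 hX, totalDegree_X_pow,
      totalDegree_map_of_injective _ hinj, Nat.add_sub_cancel' hge]
  · intro s hs
    have h1 := map_eval (Int.castRingHom ℚ) s g
    rw [hs, map_zero] at h1
    rw [map_mul]
    exact mul_eq_zero_of_left h1.symm _

theorem exists_forall_pow_succ_le_two_pow (k : ℕ) : ∃ L₀ : ℕ, ∀ L ≥ L₀, L ^ k + 1 ≤ 2 ^ L := by
  have h := tendsto_pow_const_div_const_pow_of_one_lt k (one_lt_two : (1 : ℝ) < 2)
  obtain ⟨L₀, hL₀⟩ := Filter.eventually_atTop.1 (h.eventually (gt_mem_nhds one_pos))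
  refine ⟨L₀, fun L hL => ?_⟩
  have h1 := hL₀ L hL
  rw [div_lt_one (by positivity)] at h1
  exact_mod_cast h1

/-- Let `n > 2`.  There are constants `N = N(n)`, `c = c(n)`, `κ = κ(n)` and
`H₀ = H₀(n)` such that the following holds.  Let `H ≥ H₀` and let `d` be an
integer with `(log H)^N < d < H`.  Let `f ∈ ℚ[x₁,…,x_n]` be irreducible of
degree `d`, defining the hypersurface `X ⊆ 𝔸ⁿ_ℚ`.  Then there are at most
`c·(log H)^κ` nonzero polynomials of degree `d − 1` whose joint zero locus
contains `X(ℤ,H)`. -/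
theorem statement12 (n : ℕ) (hn : 2 < n) :
    ∃ (N : ℕ) (c : ℝ) (κ : ℕ) (H₀ : ℝ), ∀ H : ℝ, H₀ ≤ H → ∀ d : ℕ,
      Real.log H ^ N < (d : ℝ) → (d : ℝ) < H →
      ∀ f : MvPolynomial (Fin n) ℚ, Irreducible f → f.totalDegree = d →
      ∃ (r : ℕ) (g : Fin r → MvPolynomial (Fin n) ℚ),
        (r : ℝ) ≤ c * Real.log H ^ κ ∧
        (∀ i, g i ≠ 0 ∧ (g i).totalDegree = d - 1) ∧
        ∀ x : Fin n → ℤ, (∀ i, |(x i : ℝ)| ≤ H) →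
          eval (fun i => (x i : ℚ)) f = 0 →
          ∃ i, eval (fun j => (x j : ℚ)) (g i) = 0 := by
  obtain ⟨L₀, hL₀⟩ := exists_forall_pow_succ_le_two_pow (10 * n)
  set K := 10 * n + 1 + 10 * n * n + 1 with hK
  refine ⟨2 * (10 * n), 1, 2 * K, Real.exp (3 + L₀ + 8 * n), fun H hH d hd1 hd2 f hf hfd => ?_⟩
  have hH0 : 0 < H := (Real.exp_pos _).trans_le hH
  have hlog : 3 + L₀ + 8 * n ≤ Real.log H := (Real.le_log_iff_exp_le hH0).2 hH
  have hlog3 : 3 ≤ Real.log H := by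
    have : (0 : ℝ) ≤ L₀ + 8 * n := by positivity
    linarith
  set L := ⌈Real.log H / Real.log 2⌉₊ with hLdef
  have hlog2 := Real.log_two_gt_d9
  have hlog2' := Real.log_two_lt_d9
  have hlogL : Real.log H ≤ L * Real.log 2 :=
    (div_le_iff₀ (Real.log_pos one_lt_two)).1 (Nat.le_ceil _)
  have hHL : H ≤ 2 ^ L := by
    rw [← Real.log_le_log_iff hH0 (by positivity), Real.log_pow]
    exact hlogL
  have hLlog : (L : ℝ) ≤ Real.log H ^ 2 := by
    have h1 : (L : ℝ) < Real.log H / Real.log 2 + 1 := Nat.ceil_lt_add_one (by positivity)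
    have h2 : Real.log H / Real.log 2 ≤ 2 * Real.log H := by
      rw [div_le_iff₀ (by positivity)]
      nlinarith
    nlinarith
  have hlogL' : Real.log H ≤ L := hlogL.trans (mul_le_of_le_one_right (by positivity) (by linarith))
  have hL : L₀ + 8 * n + 3 ≤ L := by
    have : ((L₀ + 8 * n + 3 : ℕ) : ℝ) ≤ L := by push_cast; linarith
    exact_mod_cast this
  have hLpow (k : ℕ) : (L : ℝ) ^ k ≤ Real.log H ^ (2 * k) := by
    rw [pow_mul]
    gcongr
  have hLd : L ^ (10 * n) < d := by exact_mod_cast (hLpow _).trans_lt hd1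
  have hdL : d ≤ 2 ^ L := by exact_mod_cast hd2.le.trans hHL
  obtain ⟨F, c, -, hF, hFp⟩ := exists_primitive_integral_multiple hf.ne_zero
  have hFd : F.totalDegree ≤ d := by
    have hinj : Function.Injective (Int.castRingHom ℚ) := Int.cast_injective
    rw [← totalDegree_map_of_injective F hinj, hF, ← hfd]
    exact (totalDegree_mul _ _).trans (by simp)
  obtain ⟨G, hGcard, hG, hcover⟩ := exists_lowDegree_cover (by omega) (by omega)
    (hL₀ L (by omega)) hLd hdL hFd hFp
  have hex (q : G) := exists_totalDegree_eq_of_le (⟨0, by omega⟩ : Fin n) (hG q q.2).1 (hG q q.2).2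
  choose g hg0 hgd hg using hex
  refine ⟨G.card, fun i => g (G.equivFin.symm i), ?_, fun i => ⟨hg0 _, hgd _⟩, fun s hs hfs => ?_⟩
  · rw [one_mul]
    refine le_trans ?_ (hLpow K)
    have hle : G.card ≤ L ^ K := by
      have h1 : 1 ≤ L ^ (10 * n) := Nat.one_le_pow _ _ (by omega)
      have h2 : 1 ≤ L ^ (10 * n * n) := Nat.one_le_pow _ _ (by omega)
      calc G.card ≤ (L ^ (10 * n) + 1) * L ^ (10 * n * n) + 1 := by rwa [pow_mul L (10 * n) n]
        _ ≤ (L ^ (10 * n) * L) * L ^ (10 * n * n) + L ^ (10 * n * n) := by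
            gcongr
            nlinarith
        _ ≤ (L ^ (10 * n) * L) * L ^ (10 * n * n) * L := by
            have h3 : 1 ≤ L ^ (10 * n) * L := Nat.mul_pos h1 (by omega)
            nlinarith [Nat.mul_le_mul h3 h2]
        _ = L ^ K := by rw [hK, pow_succ, pow_add, pow_succ]
    exact_mod_cast hle
  · have hs' : ∀ i, |s i| ≤ 2 ^ L := fun i => by exact_mod_cast (hs i).trans hHL
    have hFs : eval s F = 0 := by
      have h1 := map_eval (Int.castRingHom ℚ) s F
      have h2 : eval (Int.castRingHom ℚ ∘ s) f = 0 := hfs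
      rw [hF, map_mul, h2, mul_zero] at h1
      rwa [eq_intCast, Int.cast_eq_zero] at h1
    obtain ⟨q, hq, hqs⟩ := hcover s hs' hFs
    refine ⟨G.equivFin ⟨q, hq⟩, ?_⟩
    beta_reduce
    rw [Equiv.symm_apply_apply]
    exact hg _ s hqs
end
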